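/- Let G be a connected reductive group over an algebraically closed field, B a Borel subgroup, and w ∈ W an element of the Weyl group such that the automorphism l ↦ ẇ l ẇ⁻¹ normalizes B (i.e., ẇBẇ⁻¹ = B for a representative ẇ of w in N(T)). Then G·ẇ = {g b ẇ g⁻¹ : g ∈ G, b ∈ B}, i.e., every element of the coset Gẇ (in G ⋊ ⟨ẇ⟩) is conjugate under G to an element of Bẇ. -/

import Mathlib

open MvPolynomial

/-- The Zariski topology on `n × n` matrices over `k`: the topology generated by the
complements of hypersurfaces cut out by polynomials in the matrix entries. -/
def zariskiMatrix (k : Type*) [CommRing k] (n : ℕ) :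
    TopologicalSpace (Matrix (Fin n) (Fin n) k) :=
  TopologicalSpace.generateFrom
    {U | ∃ p : MvPolynomial (Fin n × Fin n) k,
      U = {A | eval (fun q : Fin n × Fin n => A q.1 q.2) p ≠ 0}}

/-- The Zariski topology on `GL_n(k)`, induced from the Zariski topology on matrices. -/
def zariskiGL (k : Type*) [CommRing k] (n : ℕ) : TopologicalSpace (GL (Fin n) k) :=
  (zariskiMatrix k n).induced fun g => (g : Matrix (Fin n) (Fin n) k)

namespace Stein

section ext
variable {k : Type*} [Field k] (K : Type*) [Field K] [Algebra k K] {ι σ : Type*}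

/-- `K`-points of the Zariski closure of a set of `k`-points. -/
def ext (S : Set (ι → k)) : Set (ι → K) :=
  {u | ∀ F : MvPolynomial ι k, (∀ s ∈ S, aeval s F = 0) → aeval u F = 0}

/-- Irreducible set of points. -/
def Irr (S : Set (ι → k)) : Prop :=
  S.Nonempty ∧ ∀ F₁ F₂ : MvPolynomial ι k, (∀ s ∈ S, aeval s (F₁ * F₂) = 0) →
    (∀ s ∈ S, aeval s F₁ = 0) ∨ (∀ s ∈ S, aeval s F₂ = 0)

/-- polynomial map -/
noncomputable def pmap (Φ : ι → MvPolynomial σ k) (t : σ → K) : ι → K := fun i => aeval t (Φ i)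

variable {K}

lemma aeval_pmap (Φ : ι → MvPolynomial σ k) (t : σ → K) (F : MvPolynomial ι k) :
    aeval (pmap K Φ t) F = aeval t (bind₁ Φ F) := by
  rw [aeval_bind₁]; rfl

lemma aeval_algebraMap_pt (s : ι → k) (F : MvPolynomial ι k) :
    aeval (fun i => algebraMap k K (s i)) F = algebraMap k K (aeval s F) := by
  rw [← aeval_algebraMap_apply]; rfl

lemma algebraMap_mem_ext {S : Set (ι → k)} {s : ι → k} (hs : s ∈ ext k S) :
    (fun i => algebraMap k K (s i)) ∈ ext K S := by
  intro F hF
  rw [aeval_algebraMap_pt, hs F hF, map_zero]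

lemma subset_ext {S : Set (ι → k)} : S ⊆ ext k S := fun s hs _ hF => hF s hs

lemma pmap_mem_ext {S : Set (σ → k)} {S' : Set (ι → k)} (Φ : ι → MvPolynomial σ k)
    (h : ∀ s ∈ S, pmap k Φ s ∈ ext k S') {t : σ → K} (ht : t ∈ ext K S) :
    pmap K Φ t ∈ ext K S' := by
  intro F hF
  rw [aeval_pmap]
  apply ht
  intro s hs
  rw [← aeval_pmap]
  exact h s hs F hF

lemma ext_mono {S S' : Set (ι → k)} (h : S ⊆ ext k S') : ext K S ⊆ ext K S' :=
  fun _ hu F hF => hu F fun _ hs => h hs F hF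

lemma Irr.pmap {S : Set (σ → k)} (hS : Irr S) (Φ : ι → MvPolynomial σ k) :
    Irr (pmap k Φ '' S) := by
  refine ⟨hS.1.image _, fun F₁ F₂ h => ?_⟩
  have := hS.2 (bind₁ Φ F₁) (bind₁ Φ F₂) (fun s hs => by
    have := h _ ⟨s, hs, rfl⟩
    rwa [aeval_pmap, map_mul] at this)
  simpa [aeval_pmap, -aeval_eq_eval] using this

lemma ext_union {S S' : Set (ι → k)} : ext K (S ∪ S') ⊆ ext K S ∪ ext K S' := by
  intro u hu
  by_contra hcon
  simp only [Set.mem_union, not_or] at hcon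
  obtain ⟨h1, h2⟩ := hcon
  simp only [ext, Set.mem_ofPred_eq, not_forall] at h1 h2
  obtain ⟨F, hF, hFu⟩ := h1
  obtain ⟨F', hF', hFu'⟩ := h2
  have := hu (F * F') (by
    rintro s (hs | hs)
    · rw [map_mul, hF s hs, zero_mul]
    · rw [map_mul, hF' s hs, mul_zero])
  rw [map_mul] at this
  rcases mul_eq_zero.1 this with h | h
  · exact hFu h
  · exact hFu' h

lemma ext_baseChange {S : Set (ι → k)} (Q : MvPolynomial ι K)
    (hQ : ∀ s ∈ S, aeval (fun i => algebraMap k K (s i)) Q = 0) {u : ι → K}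
    (hu : u ∈ ext K S) : aeval u Q = 0 := by
  classical
  let b := Module.Free.chooseBasis k K
  -- coefficient polynomials
  let c : Module.Free.ChooseBasisIndex k K → MvPolynomial ι k := fun j =>
    Q.support.sum fun m => monomial m (b.repr (Q.coeff m) j)
  have key : ∀ v : ι → K, ∀ J : Finset (Module.Free.ChooseBasisIndex k K),
      (∀ m ∈ Q.support, (b.repr (Q.coeff m)).support ⊆ J) →
      aeval v Q = ∑ j ∈ J, b j * aeval v (c j) := by
    intro v J hJ
    have h1 : ∀ m ∈ Q.support, Q.coeff m = ∑ j ∈ J, (b.repr (Q.coeff m) j) • b j := by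
      intro m hm
      conv_lhs => rw [← b.linearCombination_repr (Q.coeff m)]
      rw [Finsupp.linearCombination_apply, Finsupp.sum]
      apply Finset.sum_subset (hJ m hm)
      intro j _ hj
      simp [Finsupp.notMem_support_iff.1 hj]
    conv_lhs => rw [Q.as_sum]
    simp only [map_sum, c, Finset.mul_sum]
    rw [Finset.sum_comm]
    refine Finset.sum_congr rfl fun m hm => ?_
    rw [aeval_monomial]
    conv_lhs => rw [h1 m hm]
    simp only [map_sum, Finset.sum_mul, aeval_monomial, Algebra.smul_def, Algebra.algebraMap_self,
      RingHom.id_apply]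
    refine Finset.sum_congr rfl fun j _ => by ring
  let J := Q.support.biUnion fun m => (b.repr (Q.coeff m)).support
  have hJ : ∀ m ∈ Q.support, (b.repr (Q.coeff m)).support ⊆ J := fun m hm =>
    Finset.subset_biUnion_of_mem (fun m => (b.repr (Q.coeff m)).support) hm
  rw [key u J hJ]
  refine Finset.sum_eq_zero fun j hj => ?_
  rw [hu (c j), mul_zero]
  intro s hs
  have := hQ s hs
  rw [key _ J hJ] at this
  simp only [aeval_algebraMap_pt] at this
  have hli := linearIndependent_iff'.1 b.linearIndependent J (fun j => aeval s (c j)) (by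
    rw [← this]
    refine Finset.sum_congr rfl fun j _ => ?_
    rw [Algebra.smul_def, mul_comm])
  exact hli j hj

/-- Nullstellensatz -/
lemma exists_kpoint [IsAlgClosed k] [Finite ι] (x : ι → K) (F : MvPolynomial ι k)
    (hF : aeval x F ≠ 0) :
    ∃ t : ι → k, (∀ P : MvPolynomial ι k, aeval x P = 0 → aeval t P = 0) ∧ aeval t F ≠ 0 := by
  let I : Ideal (MvPolynomial ι k) := RingHom.ker (aeval x : MvPolynomial ι k →ₐ[k] K)
  have hI : I.IsPrime := RingHom.ker_isPrime _
  have h := vanishingIdeal_zeroLocus_eq_radical (K := k) I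
  rw [hI.radical] at h
  by_contra hcon
  push Not at hcon
  have : F ∈ vanishingIdeal k (zeroLocus k I) := by
    rw [mem_vanishingIdeal_iff]
    intro t ht
    exact hcon t (fun P hP => (mem_zeroLocus_iff.1 ht) P hP)
  rw [h] at this
  exact hF this

/-- generic points -/
lemma exists_generic.{u, v} {k : Type u} [Field k] {σ : Type v} [Finite σ] {T : Set (σ → k)}
    (hT : Irr T) : ∃ (K : Type u) (_ : Field K) (_ : Algebra k K) (_ : IsAlgClosed K)
      (τ : σ → K), ∀ F : MvPolynomial σ k, aeval τ F = 0 ↔ ∀ s ∈ T, aeval s F = 0 := by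
  obtain ⟨N, ⟨e⟩⟩ := Finite.exists_equiv_fin σ
  let I : Ideal (MvPolynomial (Fin N) k) :=
    vanishingIdeal k ((fun s : σ → k => s ∘ e.symm) '' T)
  have hmem : ∀ F, F ∈ I ↔ ∀ s ∈ T, aeval (s ∘ e.symm) F = 0 := by
    intro F; simp [I, mem_vanishingIdeal_iff]
  have hI : I.IsPrime := by
    constructor
    · intro h
      have : (1 : MvPolynomial (Fin N) k) ∈ I := h ▸ Submodule.mem_top
      obtain ⟨s, hs⟩ := hT.1
      simpa using (hmem _).1 this s hs
    · intro F₁ F₂ h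
      have := hT.2 (rename e.symm F₁) (rename e.symm F₂) (fun s hs => by
        have := (hmem _).1 h s hs
        rw [← map_mul, aeval_rename]; exact this)
      simpa only [hmem, aeval_rename] using this
  let L := FractionRing (MvPolynomial (Fin N) k ⧸ I)
  let K := AlgebraicClosure L
  let f : MvPolynomial (Fin N) k →ₐ[k] K :=
    ((IsScalarTower.toAlgHom k (MvPolynomial (Fin N) k ⧸ I) K)).comp (Ideal.Quotient.mkₐ k I)
  have hf : ∀ F, f F = 0 ↔ F ∈ I := by
    intro F
    have hinj : Function.Injective (algebraMap (MvPolynomial (Fin N) k ⧸ I) K) := by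
      rw [IsScalarTower.algebraMap_eq (MvPolynomial (Fin N) k ⧸ I) L K]
      exact (algebraMap L K).injective.comp (IsFractionRing.injective _ L)
    change algebraMap (MvPolynomial (Fin N) k ⧸ I) K (Ideal.Quotient.mk I F) = 0 ↔ _
    rw [map_eq_zero_iff _ hinj, Ideal.Quotient.eq_zero_iff_mem]
  refine ⟨K, inferInstance, inferInstance, inferInstance, fun i => f (X (e i)), fun F => ?_⟩
  have : aeval (fun i => f (X (e i))) F = f (rename e F) := by
    have : (aeval fun i => f (X (e i))) = f.comp (rename e) := by
      ext i; simp
    rw [this]; rfl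
  rw [this, hf, hmem]
  simp [aeval_rename, Function.comp_def]

end ext
end Stein

namespace Stein

/-- A `k`-valued place of `K / k`, given by its graph. -/
structure Place (k K : Type*) [Field k] [Field K] [Algebra k K] where
  /-- graph of the place -/
  Γ : Subalgebra k (K × k)
  func : ∀ b, ((0 : K), b) ∈ Γ → b = 0
  val : ∀ x : K, (∃ a, (x, a) ∈ Γ) ∨ (x⁻¹, (0 : k)) ∈ Γ

section construct
variable {k K : Type*} [Field k] [Field K] [Algebra k K]

/-- functional graphs -/
def Fnl (Γ : Subalgebra k (K × k)) : Prop := ∀ b, ((0 : K), b) ∈ Γ → b = 0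

lemma Fnl.max {Γ₀ : Subalgebra k (K × k)} (h : Fnl Γ₀) :
    ∃ Γ, Γ₀ ≤ Γ ∧ Maximal Fnl Γ := by
  apply zorn_le_nonempty₀ {Γ | Fnl (k := k) (K := K) Γ}
  · intro c hc hchain Γ₁ hΓ₁
    have hdir : DirectedOn (· ≤ ·) c := hchain.directedOn
    refine ⟨sSup c, ?_, fun z hz => le_sSup hz⟩
    intro b hb
    haveI : Nonempty c := ⟨⟨Γ₁, hΓ₁⟩⟩
    rw [sSup_eq_iSup', ← SetLike.mem_coe,
      Subalgebra.coe_iSup_of_directed hdir.directed_val] at hb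
    simp only [Set.mem_iUnion] at hb
    obtain ⟨s, hb⟩ := hb
    exact hc s.2 b hb
  · exact h

/-- evaluate a `Γ`-polynomial at a point of `K × k` -/
lemma Fnl.extend {Γ : Subalgebra k (K × k)} (hΓ : Maximal Fnl Γ) (z : K × k)
    (h : ∀ p : Polynomial Γ, (Polynomial.aeval z p).1 = 0 → (Polynomial.aeval z p).2 = 0) :
    z ∈ Γ := by
  have h1 : Fnl ((Algebra.adjoin Γ {z}).restrictScalars k) := by
    intro b hb
    rw [Subalgebra.mem_restrictScalars, Algebra.adjoin_singleton_eq_range_aeval] at hb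
    obtain ⟨p, hp⟩ := hb
    have := h p (by simpa using congrArg Prod.fst hp)
    simpa [this] using (congrArg Prod.snd hp).symm
  have h2 := hΓ.2 h1 (fun x hx => by
    rw [Subalgebra.mem_restrictScalars]
    exact (Algebra.adjoin Γ {z}).algebraMap_mem ⟨x, hx⟩)
  exact h2 (by
    rw [Subalgebra.mem_restrictScalars]
    exact Algebra.self_mem_adjoin_singleton _ _)

/-- first component as a ring hom -/
def fstΓ (Γ : Subalgebra k (K × k)) : Γ →+* K := (RingHom.fst K k).comp Γ.val.toRingHom
/-- second component as a ring hom -/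
def sndΓ (Γ : Subalgebra k (K × k)) : Γ →+* k := (RingHom.snd K k).comp Γ.val.toRingHom

lemma aeval_fst (Γ : Subalgebra k (K × k)) (z : K × k) (p : Polynomial Γ) :
    (Polynomial.aeval z p).1 = (p.map (fstΓ Γ)).eval z.1 := by
  rw [Polynomial.eval_map, Polynomial.aeval_def]
  change RingHom.fst K k _ = _
  rw [Polynomial.hom_eval₂]; rfl

lemma aeval_snd (Γ : Subalgebra k (K × k)) (z : K × k) (p : Polynomial Γ) :
    (Polynomial.aeval z p).2 = (p.map (sndΓ Γ)).eval z.2 := by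
  rw [Polynomial.eval_map, Polynomial.aeval_def]
  change RingHom.snd K k _ = _
  rw [Polynomial.hom_eval₂]; rfl

lemma sndΓ_surj (Γ : Subalgebra k (K × k)) : Function.Surjective (sndΓ Γ) := fun c =>
  ⟨⟨algebraMap k (K × k) c, Γ.algebraMap_mem c⟩, rfl⟩

/-- If `x` is not in the ring of a maximal functional graph, there is a relation with residue 1 -/
lemma Fnl.rel [IsAlgClosed k] {Γ : Subalgebra k (K × k)} (hΓ : Maximal Fnl Γ) (x : K)
    (hx : ¬ ∃ a, (x, a) ∈ Γ) :
    ∃ p : Polynomial Γ, (p.map (fstΓ Γ)).eval x = 0 ∧ p.map (sndΓ Γ) = 1 := by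
  let I : Ideal (Polynomial Γ) := RingHom.ker (Polynomial.eval₂RingHom (fstΓ Γ) x)
  have hI : ∀ p, p ∈ I ↔ (p.map (fstΓ Γ)).eval x = 0 := by
    intro p; simp [I, RingHom.mem_ker, Polynomial.eval_map]
  let J : Ideal (Polynomial k) := I.map (Polynomial.mapRingHom (sndΓ Γ))
  have hsurj : Function.Surjective (Polynomial.mapRingHom (sndΓ Γ)) :=
    Polynomial.map_surjective _ (sndΓ_surj Γ)
  by_cases hJ : J = ⊤
  · have : (1 : Polynomial k) ∈ J := hJ ▸ Submodule.mem_top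
    rw [Ideal.mem_map_iff_of_surjective _ hsurj] at this
    obtain ⟨p, hp, h1⟩ := this
    exact ⟨p, (hI p).1 hp, h1⟩
  · exfalso
    obtain ⟨c, hc⟩ : ∃ c : k, ∀ q ∈ J, q.eval c = 0 := by
      obtain ⟨g, hg⟩ := IsPrincipalIdealRing.principal J
      have hgu : ¬ IsUnit g := by
        intro hu
        apply hJ
        rw [hg]; exact Ideal.span_singleton_eq_top.2 hu
      have : ∃ c, g.eval c = 0 := by
        by_cases hd : g.degree = 0
        · exact absurd (Polynomial.isUnit_iff_degree_eq_zero.2 hd) hgu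
        · exact IsAlgClosed.exists_root g hd
      obtain ⟨c, hc⟩ := this
      refine ⟨c, fun q hq => ?_⟩
      rw [hg] at hq
      obtain ⟨r, rfl⟩ := Ideal.mem_span_singleton'.1 hq
      simp [hc]
    apply hx
    refine ⟨c, Fnl.extend hΓ (x, c) fun p hp => ?_⟩
    rw [aeval_fst] at hp
    rw [aeval_snd]
    exact hc _ (Ideal.mem_map_of_mem _ ((hI p).2 hp))

lemma Fnl.contra {Γ : Subalgebra k (K × k)} (hΓ : Fnl Γ) (x : K) (p q : Polynomial Γ) (m n : ℕ)
    (hm : p.natDegree ≤ m) (hn : q.natDegree ≤ n) 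
    (hp : (p.map (fstΓ Γ)).eval x = 0) (hp1 : p.map (sndΓ Γ) = 1)
    (hq : (q.map (fstΓ Γ)).eval x = 0) (c : k) (hc : c ≠ 0)
    (hq1 : (q.map (sndΓ Γ)).coeff n = c) : False := by
  by_cases H : m ≠ 0 ∨ n ≠ 0
  · obtain ⟨a, b, -, -, hab⟩ := Polynomial.exists_mul_add_mul_eq_C_resultant p q hm hn H
    have h1 : fstΓ Γ (p.resultant q m n) = 0 := by
      have := congrArg (fun r => (r.map (fstΓ Γ)).eval x) hab
      simpa [hp, hq] using this.symm
    have h2 : sndΓ Γ (p.resultant q m n) ≠ 0 := by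
      rw [← Polynomial.resultant_map_map, hp1, Polynomial.resultant_one_left, hq1]
      have : (-1 : k) ^ (m * n) ≠ 0 := pow_ne_zero _ (by simp)
      exact mul_ne_zero this (pow_ne_zero _ hc)
    apply h2
    apply hΓ
    rw [← h1]
    exact (p.resultant q m n).2
  · push Not at H
    have h0 : p.natDegree = 0 := by omega
    rw [Polynomial.eq_C_of_natDegree_eq_zero h0] at hp hp1
    have h1 : fstΓ Γ (p.coeff 0) = 0 := by simpa using hp
    have h2 : sndΓ Γ (p.coeff 0) = 1 := by
      have := congrArg (fun r => r.coeff 0) hp1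
      simpa using this
    have := hΓ (sndΓ Γ (p.coeff 0)) (by rw [← h1]; exact (p.coeff 0).2)
    rw [h2] at this
    exact one_ne_zero this

/-- Existence of places. -/
lemma exists_place [IsAlgClosed k] {Γ₀ : Subalgebra k (K × k)} (h : Fnl Γ₀) :
    ∃ P : Place k K, Γ₀ ≤ P.Γ := by
  obtain ⟨Γ, hle, hΓ⟩ := h.max
  have hF : Fnl Γ := hΓ.1
  -- local
  have hloc : ∀ x a, (x, a) ∈ Γ → a ≠ 0 → ∃ b, (x⁻¹, b) ∈ Γ := by
    intro x a hxa ha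
    by_contra hcon
    have hx0 : x ≠ 0 := by
      rintro rfl
      exact ha (hF a hxa)
    obtain ⟨p, hp, hp1⟩ := Fnl.rel hΓ x⁻¹ hcon
    refine Fnl.contra hF x⁻¹ p (Polynomial.C ⟨(x, a), hxa⟩ * Polynomial.X - 1) _ 1 le_rfl ?_ hp hp1
      ?_ a ha ?_
    · compute_degree
    · have : fstΓ Γ ⟨(x, a), hxa⟩ = x := rfl
      simp [this, hx0]
    · have : sndΓ Γ ⟨(x, a), hxa⟩ = a := rfl
      simp [this, Polynomial.coeff_one]
  refine ⟨⟨Γ, hF, fun x => ?_⟩, hle⟩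
  by_contra hcon
  push Not at hcon
  obtain ⟨h1, h2⟩ := hcon
  have hx : ¬ ∃ a, (x, a) ∈ Γ := by push Not; exact h1
  have hx0 : x ≠ 0 := by
    rintro rfl; exact h1 0 Γ.zero_mem
  by_cases h3 : ∃ b, (x⁻¹, b) ∈ Γ
  · obtain ⟨b, hb⟩ := h3
    have hb0 : b ≠ 0 := by rintro rfl; exact h2 hb
    obtain ⟨c, hc⟩ := hloc _ _ hb hb0
    rw [inv_inv] at hc
    exact h1 c hc
  · obtain ⟨p, hp, hp1⟩ := Fnl.rel hΓ x hx
    obtain ⟨q, hq, hq1⟩ := Fnl.rel hΓ x⁻¹ h3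
    refine Fnl.contra hF x p q.reverse _ q.natDegree le_rfl (Polynomial.reverse_natDegree_le q)
      hp hp1 ?_ 1 one_ne_zero ?_
    · letI : Invertible x⁻¹ := invertibleOfNonzero (inv_ne_zero hx0)
      have := (Polynomial.eval₂_reverse_eq_zero_iff (fstΓ Γ) x⁻¹ q).2
        (by rwa [Polynomial.eval_map] at hq)
      rw [Polynomial.eval_map]
      simpa using this
    · have h0 := congrArg (fun r => r.coeff 0) hq1
      rw [Polynomial.coeff_map, Polynomial.coeff_reverse]
      simpa using h0

lemma exists_place_spec [IsAlgClosed k] {σ : Type*} (x : σ → K) (q : σ → k)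
    (h : ∀ F : MvPolynomial σ k, aeval x F = 0 → aeval q F = 0) :
    ∃ P : Place k K, ∀ i, (x i, q i) ∈ P.Γ := by
  have key : ∀ F : MvPolynomial σ k, aeval (fun i => (x i, q i)) F = (aeval x F, aeval q F) := by
    intro F
    ext
    · exact MvPolynomial.map_aeval (fun i => (x i, q i)) (RingHom.fst K k) F
    · exact MvPolynomial.map_aeval (fun i => (x i, q i)) (RingHom.snd K k) F
  obtain ⟨P, hP⟩ := exists_place (Γ₀ := (aeval (fun i => (x i, q i)) :
      MvPolynomial σ k →ₐ[k] K × k).range) (by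
    rintro b ⟨F, hF⟩
    have hF : aeval (fun i => (x i, q i)) F = (0, b) := hF
    rw [key] at hF
    have h2 : aeval q F = b := (Prod.ext_iff.1 hF).2
    rw [← h2]
    exact h F (Prod.ext_iff.1 hF).1)
  exact ⟨P, fun i => hP ⟨X i, by simp⟩⟩

end construct
end Stein

namespace Stein

namespace Place
variable {k K : Type*} [Field k] [Field K] [Algebra k K] (P : Place k K)

/-- `x` has residue `a`. -/
def Res (x : K) (a : k) : Prop := (x, a) ∈ P.Γ

variable {P}

lemma Res.add {x y : K} {a b : k} (h : P.Res x a) (h' : P.Res y b) : P.Res (x + y) (a + b) :=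
  P.Γ.add_mem h h'
lemma Res.mul {x y : K} {a b : k} (h : P.Res x a) (h' : P.Res y b) : P.Res (x * y) (a * b) :=
  P.Γ.mul_mem h h'
lemma Res.neg {x : K} {a : k} (h : P.Res x a) : P.Res (-x) (-a) :=
  P.Γ.neg_mem h
lemma Res.sub {x y : K} {a b : k} (h : P.Res x a) (h' : P.Res y b) : P.Res (x - y) (a - b) :=
  P.Γ.sub_mem h h'
lemma Res.pow {x : K} {a : k} (h : P.Res x a) (n : ℕ) : P.Res (x ^ n) (a ^ n) :=
  P.Γ.pow_mem h n
lemma res_zero : P.Res 0 0 := P.Γ.zero_mem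
lemma res_one : P.Res 1 1 := P.Γ.one_mem
lemma res_algebraMap (c : k) : P.Res (algebraMap k K c) c := P.Γ.algebraMap_mem c
lemma Res.sum {α : Type*} {s : Finset α} {f : α → K} {g : α → k} (h : ∀ i ∈ s, P.Res (f i) (g i)) :
    P.Res (∑ i ∈ s, f i) (∑ i ∈ s, g i) := by
  have := P.Γ.sum_mem (t := s) (f := fun i => (f i, g i)) h
  have h2 : ∑ i ∈ s, (f i, g i) = (∑ i ∈ s, f i, ∑ i ∈ s, g i) :=
    Prod.ext (by simp [Prod.fst_sum]) (by simp [Prod.snd_sum])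
  rwa [h2] at this
lemma Res.prod {α : Type*} {s : Finset α} {f : α → K} {g : α → k} (h : ∀ i ∈ s, P.Res (f i) (g i)) :
    P.Res (∏ i ∈ s, f i) (∏ i ∈ s, g i) := by
  have := P.Γ.prod_mem (t := s) (f := fun i => (f i, g i)) h
  have h2 : ∏ i ∈ s, (f i, g i) = (∏ i ∈ s, f i, ∏ i ∈ s, g i) :=
    Prod.ext (by simp [Prod.fst_prod]) (by simp [Prod.snd_prod])
  rwa [h2] at this
lemma Res.unique {x : K} {a b : k} (h : P.Res x a) (h' : P.Res x b) : a = b := by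
  have := h.sub h'
  rw [sub_self] at this
  exact sub_eq_zero.1 (P.func _ this)
lemma Res.ne_zero {x : K} {a : k} (h : P.Res x a) (ha : a ≠ 0) : x ≠ 0 := by
  rintro rfl
  exact ha (P.func _ h)
lemma Res.inv {x : K} {a : k} (h : P.Res x a) (ha : a ≠ 0) : P.Res x⁻¹ a⁻¹ := by
  have hx := h.ne_zero ha
  rcases P.val x⁻¹ with ⟨b, hb⟩ | h0
  · have hb : P.Res x⁻¹ b := hb
    have h1 := h.mul hb
    rw [mul_inv_cancel₀ hx] at h1
    have := h1.unique res_one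
    rwa [eq_inv_of_mul_eq_one_right this] at hb
  · rw [inv_inv] at h0
    exact absurd (h.unique h0) ha

lemma Res.aeval {σ : Type*} {x : σ → K} {q : σ → k} (h : ∀ i, P.Res (x i) (q i))
    (F : MvPolynomial σ k) : P.Res (aeval x F) (MvPolynomial.aeval q F) := by
  induction F using MvPolynomial.induction_on with
  | C a => simpa using res_algebraMap a
  | add p q hp hq => rw [map_add, map_add]; exact hp.add hq
  | mul_X p i hp => rw [map_mul, map_mul, aeval_X, aeval_X]; exact hp.mul (h i)

lemma mem_ext {σ : Type*} {S : Set (σ → k)} {x : σ → K} {q : σ → k} (hx : x ∈ ext K S)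
    (h : ∀ i, P.Res (x i) (q i)) : q ∈ ext k S := by
  intro F hF
  have := Res.aeval h F
  rw [hx F hF] at this
  exact P.func _ this

lemma poly_mem {z : K × k} (hz : z ∈ P.Γ) (p : Polynomial P.Γ) : Polynomial.aeval z p ∈ P.Γ := by
  rw [Polynomial.aeval_def, Polynomial.eval₂_eq_sum_range]
  exact P.Γ.sum_mem fun i _ => P.Γ.mul_mem (p.coeff i).2 (P.Γ.pow_mem hz i)

/-- integral elements are bounded -/
lemma res_of_root (p : Polynomial P.Γ) {x : K} (hx : (p.map (fstΓ P.Γ)).eval x = 0)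
    (hl : sndΓ P.Γ p.leadingCoeff ≠ 0) : ∃ a, P.Res x a := by
  by_cases hx0 : x = 0
  · exact ⟨0, hx0 ▸ res_zero⟩
  rcases P.val x with h | h
  · exact h
  · exfalso
    let : Invertible x := invertibleOfNonzero hx0
    have h1 := (Polynomial.eval₂_reverse_eq_zero_iff (fstΓ P.Γ) x p).2
      (by rwa [Polynomial.eval_map] at hx)
    have h2 := aeval_fst P.Γ (x⁻¹, (0 : k)) p.reverse
    rw [Polynomial.eval_map] at h2
    simp only [invOf_eq_inv] at h1
    rw [h1] at h2
    have h3 := aeval_snd P.Γ (x⁻¹, (0 : k)) p.reverse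
    rw [← Polynomial.coeff_zero_eq_eval_zero, Polynomial.coeff_map,
      Polynomial.coeff_zero_reverse] at h3
    apply hl
    rw [← h3]
    apply P.func
    rw [← h2]
    exact poly_mem h p.reverse

variable (P)

lemma exists_scale {ι : Type*} [Finite ι] (u : ι → K) (hu : u ≠ 0) :
    ∃ (s : K) (ub : ι → k), s ≠ 0 ∧ (∀ i, P.Res (s * u i) (ub i)) ∧ ub ≠ 0 := by
  classical
  cases nonempty_fintype ι
  have key : ∀ S : Finset ι, (∃ i ∈ S, u i ≠ 0) →
      ∃ i₀ ∈ S, u i₀ ≠ 0 ∧ ∀ j ∈ S, ∃ a, P.Res ((u i₀)⁻¹ * u j) a := by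
    intro S
    induction S using Finset.induction_on with
    | empty => simp
    | insert i S hi ih =>
      intro _
      by_cases hS : ∃ i ∈ S, u i ≠ 0
      · obtain ⟨i₀, hi₀, h0, hb⟩ := ih hS
        rcases P.val ((u i₀)⁻¹ * u i) with ⟨a, ha⟩ | h
        · refine ⟨i₀, Finset.mem_insert_of_mem hi₀, h0, fun j hj => ?_⟩
          rcases Finset.mem_insert.1 hj with rfl | hj
          · exact ⟨a, ha⟩
          · exact hb j hj
        · by_cases hui : u i = 0
          · refine ⟨i₀, Finset.mem_insert_of_mem hi₀, h0, fun j hj => ?_⟩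
            rcases Finset.mem_insert.1 hj with rfl | hj
            · exact ⟨0, by rw [hui, mul_zero]; exact res_zero⟩
            · exact hb j hj
          · have h : P.Res ((u i)⁻¹ * u i₀) 0 := by
              rwa [mul_inv_rev, inv_inv] at h
            refine ⟨i, Finset.mem_insert_self _ _, hui, fun j hj => ?_⟩
            rcases Finset.mem_insert.1 hj with rfl | hj
            · exact ⟨1, by rw [inv_mul_cancel₀ hui]; exact res_one⟩
            · obtain ⟨a, ha⟩ := hb j hj
              have := h.mul ha
              rw [mul_assoc, mul_inv_cancel_left₀ h0] at this
              exact ⟨_, this⟩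
      · push Not at hS
        rename_i h1
        obtain ⟨i', hi', h2⟩ := h1
        rcases Finset.mem_insert.1 hi' with rfl | hi'
        · refine ⟨i', hi', h2, fun j hj => ?_⟩
          rcases Finset.mem_insert.1 hj with rfl | hj
          · exact ⟨1, by rw [inv_mul_cancel₀ h2]; exact res_one⟩
          · exact ⟨0, by rw [hS j hj, mul_zero]; exact res_zero⟩
        · exact absurd (hS i' hi') h2
  obtain ⟨i₁, hi₁⟩ := Function.ne_iff.1 hu
  obtain ⟨i₀, -, h0, hb⟩ := key Finset.univ ⟨i₁, Finset.mem_univ _, hi₁⟩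
  choose ub hub using fun j => hb j (Finset.mem_univ j)
  refine ⟨(u i₀)⁻¹, ub, inv_ne_zero h0, hub, fun h => ?_⟩
  have h1 := hub i₀
  rw [inv_mul_cancel₀ h0] at h1
  have := h1.unique res_one
  rw [h] at this
  exact zero_ne_one this

end Place

/-- trivial place -/
def trivPlace (k : Type*) [Field k] : Place k k where
  Γ := (AlgHom.prod (AlgHom.id k k) (AlgHom.id k k)).range
  func := by
    rintro b ⟨c, hc⟩
    have h1 : c = 0 := congrArg Prod.fst hc
    have h2 : c = b := congrArg Prod.snd hc
    rw [← h2, h1]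
  val x := Or.inl ⟨x, x, rfl⟩

lemma trivPlace_res {k : Type*} [Field k] (x : k) : (trivPlace k).Res x x := ⟨x, rfl⟩

lemma trivPlace_eq {k : Type*} [Field k] {x a : k} (h : (trivPlace k).Res x a) : x = a :=
  (h.unique (trivPlace_res x)).symm

section
variable {k K : Type*} [Field k] [Field K] [Algebra k K] [IsAlgClosed k]

lemma mem_range_of_isAlgebraic {x : K} (hx : IsAlgebraic k x) : ∃ c, algebraMap k K c = x := by
  have hi := hx.isIntegral
  have := IsAlgClosed.degree_eq_one_of_irreducible k (minpoly.irreducible hi)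
  exact minpoly.mem_range_of_degree_eq_one k x this

lemma const_of_bounded (l : K) (h : ∀ P : Place k K, ∃ a, P.Res l a) :
    ∃ c, algebraMap k K c = l := by
  by_contra hcon
  have hl0 : l ≠ 0 := by rintro rfl; exact hcon ⟨0, map_zero _⟩
  have htr : ¬ IsAlgebraic k l⁻¹ := by
    intro ha
    obtain ⟨c, hc⟩ := mem_range_of_isAlgebraic ha
    exact hcon ⟨c⁻¹, by rw [map_inv₀, hc, inv_inv]⟩
  obtain ⟨P, hP⟩ := exists_place (Γ₀ := (Polynomial.aeval ((l⁻¹, 0) : K × k)).range) (by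
    rintro b ⟨F, hF⟩
    have h1 : Polynomial.aeval l⁻¹ F = 0 := by
      have : _ = (0 : K) := congrArg Prod.fst hF
      rw [← this]
      exact (Polynomial.aeval_algHom_apply (AlgHom.fst k K k) ((l⁻¹, 0) : K × k) F)
    have h2 : F = 0 := by
      by_contra hne
      exact htr ⟨F, hne, h1⟩
    have : _ = b := congrArg Prod.snd hF
    rw [← this, h2]
    simp)
  obtain ⟨a, ha⟩ := h P
  have h0 : P.Res l⁻¹ 0 := hP ⟨Polynomial.X, by simp⟩
  have := ha.mul h0
  rw [mul_inv_cancel₀ hl0, mul_zero] at this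
  exact one_ne_zero (Place.res_one.unique this)
end

end Stein

namespace Stein

section
variable {k K : Type*} [Field k] [Field K] [Algebra k K]

lemma eval₂_mem {A : Type*} [CommRing A] (P : Place k K) (φ : A →+* K × k) (hφ : ∀ a, φ a ∈ P.Γ)
    {δ : K × k} (hδ : δ ∈ P.Γ) (p : Polynomial A) : p.eval₂ φ δ ∈ P.Γ := by
  rw [Polynomial.eval₂_eq_sum_range]
  exact P.Γ.sum_mem fun i _ => P.Γ.mul_mem (hφ _) (P.Γ.pow_mem hδ i)
end

/-- existence of a constant multiple -/
lemma exists_const_multiple {A D : Type*} [CommRing A] [CommRing D] [IsDomain D] (f : A →+* D)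
    (t : D) (p₀ : Polynomial A) (h0 : p₀.map f ≠ 0) (h1 : p₀.eval₂ f t = 0)
    (e : Polynomial A) (he : e.eval₂ f t ≠ 0) :
    ∃ (b : A) (q : Polynomial A), f b ≠ 0 ∧ (e * q - Polynomial.C b).eval₂ f t = 0 := by
  have halg : IsAlgebraic f.range t := by
    refine ⟨p₀.map f.rangeRestrict, fun h => h0 ?_, ?_⟩
    · have := congrArg (Polynomial.map f.range.subtype) h
      rwa [Polynomial.map_map, Polynomial.map_zero] at this
    · rw [Polynomial.aeval_def, Polynomial.eval₂_map]; exact h1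
  have hlift : ∀ q : Polynomial f.range, ∃ q' : Polynomial A, q'.map f.rangeRestrict = q :=
    fun q => Polynomial.map_surjective _ f.rangeRestrict_surjective q
  have hev : ∀ (q : Polynomial A) (z : D),
      Polynomial.aeval z (q.map f.rangeRestrict) = q.eval₂ f z := by
    intro q z
    rw [Polynomial.aeval_def, Polynomial.eval₂_map]; rfl
  have hmem : e.eval₂ f t ∈ Algebra.adjoin f.range {t} := by
    rw [Algebra.adjoin_singleton_eq_range_aeval]
    exact ⟨e.map f.rangeRestrict, hev e t⟩
  have hS := Algebra.isAlgebraic_adjoin_singleton_iff.2 halg _ hmem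
  obtain ⟨t', ht', r, hr, heq⟩ :=
    hS.exists_nonzero_eq_adjoin_mul (mem_nonZeroDivisors_of_ne_zero he)
  obtain ⟨b, rfl⟩ := f.rangeRestrict_surjective r
  rw [Algebra.adjoin_singleton_eq_range_aeval] at ht'
  obtain ⟨Q, hQ⟩ := ht'
  obtain ⟨Q', rfl⟩ := hlift Q
  have hQ : Polynomial.aeval (e.eval₂ f t) (Q'.map f.rangeRestrict) = t' := hQ
  refine ⟨b, Q'.comp e, fun h => hr (Subtype.ext h), ?_⟩
  rw [hev] at hQ
  rw [Polynomial.eval₂_sub, Polynomial.eval₂_mul, Polynomial.eval₂_C, Polynomial.eval₂_comp, hQ]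
  exact sub_eq_zero.2 heq

universe u v

lemma ext_step {A D : Type*} [CommRing A] [CommRing D] [IsDomain D] (f : A →+* D) (t : D)
    (e : Polynomial A) (he : e.eval₂ f t ≠ 0) :
    ∃ a : A, f a ≠ 0 ∧ ∀ {k : Type u} {K : Type v} [Field k] [Field K] [Algebra k K]
      [IsAlgClosed k] [IsAlgClosed K] (P : Place k K) (φ : A →+* K × k), (∀ a, φ a ∈ P.Γ) →
      (∀ a, f a = 0 → φ a = 0) → (φ a).2 ≠ 0 →
      ∃ δ ∈ P.Γ, (∀ p : Polynomial A, p.eval₂ f t = 0 → p.eval₂ φ δ = 0) ∧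
        (e.eval₂ φ δ).2 ≠ 0 := by
  classical
  by_cases htr : ∀ p : Polynomial A, p.eval₂ f t = 0 → p.map f = 0
  · -- transcendental case
    have he0 : e.map f ≠ 0 := by
      intro h
      apply he
      rw [← Polynomial.eval_map, h, Polynomial.eval_zero]
    obtain ⟨i, hi⟩ : ∃ i, (e.map f).coeff i ≠ 0 := by
      by_contra hcon
      push Not at hcon
      exact he0 (Polynomial.ext fun i => by simpa using hcon i)
    rw [Polynomial.coeff_map] at hi
    refine ⟨e.coeff i, hi, ?_⟩
    intro k K _ _ _ _ _ P φ hφ hker ha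
    let g : Polynomial k := e.map ((RingHom.snd K k).comp φ)
    have hg : g ≠ 0 := by
      intro h
      apply ha
      have := congrArg (fun r => r.coeff i) h
      simpa [g] using this
    obtain ⟨c, hc⟩ : ∃ c, g.eval c ≠ 0 := by
      by_contra hcon
      push Not at hcon
      exact hg (Polynomial.funext fun c => by simpa using hcon c)
    refine ⟨algebraMap k (K × k) c, P.Γ.algebraMap_mem c, fun p hp => ?_, ?_⟩
    · have h1 := htr p hp
      have : p.map φ = 0 := by
        ext1 j
        have := congrArg (fun r => r.coeff j) h1
        simp only [Polynomial.coeff_map, Polynomial.coeff_zero] at this ⊢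
        exact hker _ this
      rw [← Polynomial.eval_map, this, Polynomial.eval_zero]
    · have : (e.eval₂ φ (algebraMap k (K × k) c)).2 = g.eval c := by
        change RingHom.snd K k _ = _
        rw [Polynomial.hom_eval₂, Polynomial.eval_map]; rfl
      rw [this]; exact hc
  · push Not at htr
    -- minimal relation
    let Q : ℕ → Prop := fun n => ∃ p : Polynomial A, p.natDegree = n ∧ p.eval₂ f t = 0 ∧ p.map f ≠ 0
    have hQ : ∃ n, Q n := by
      obtain ⟨p, hp, h⟩ := htr
      exact ⟨_, p, rfl, hp, h⟩
    obtain ⟨p₀, hn, hp0, hp0'⟩ := Nat.find_spec hQ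
    have hmin : ∀ p : Polynomial A, p.natDegree < p₀.natDegree → p.eval₂ f t = 0 → p.map f = 0 := by
      intro p hp h
      by_contra hne
      rw [hn] at hp
      exact Nat.find_min hQ hp ⟨p, rfl, h, hne⟩
    have hmin' : p₀.natDegree ≠ 0 := by
      intro h
      rw [Polynomial.eq_C_of_natDegree_eq_zero h] at hp0 hp0'
      rw [Polynomial.eval₂_C] at hp0
      rw [Polynomial.map_C, hp0] at hp0'
      simp at hp0'
    have hl : f p₀.leadingCoeff ≠ 0 := by
      intro h
      have h1 : p₀.eraseLead.map f = p₀.map f := by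
        conv_rhs => rw [← Polynomial.eraseLead_add_C_mul_X_pow p₀]
        rw [Polynomial.map_add, Polynomial.map_mul, Polynomial.map_C, h]
        simp
      have h2 : p₀.eraseLead.natDegree < p₀.natDegree := by
        have := Polynomial.eraseLead_natDegree_le p₀
        omega
      have h3 := hmin _ h2 (by rw [← Polynomial.eval_map, h1, Polynomial.eval_map, hp0])
      exact hp0' (h1 ▸ h3)
    obtain ⟨b, q, hb, hbq⟩ := exists_const_multiple f t p₀ hp0' hp0 e he
    refine ⟨p₀.leadingCoeff * b, by rw [map_mul]; exact mul_ne_zero hl hb, ?_⟩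
    intro k K _ _ _ _ _ P φ hφ hker ha
    rw [map_mul, Prod.snd_mul] at ha
    have hl2 : (φ p₀.leadingCoeff).2 ≠ 0 := left_ne_zero_of_mul ha
    have hb2 : (φ b).2 ≠ 0 := right_ne_zero_of_mul ha
    have hl1 : (φ p₀.leadingCoeff).1 ≠ 0 := Place.Res.ne_zero (P := P) (hφ _) hl2
    let φΓ : A →+* P.Γ := φ.codRestrict P.Γ hφ
    have hlead : (p₀.map φΓ).leadingCoeff = φΓ p₀.leadingCoeff := by
      apply Polynomial.leadingCoeff_map_of_leadingCoeff_ne_zero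
      intro h
      apply hl2
      have := congrArg (fun z : P.Γ => (z : K × k).2) h
      exact this
    have hcomp : (fstΓ P.Γ).comp φΓ = (RingHom.fst K k).comp φ := rfl
    obtain ⟨x, hx⟩ : ∃ x : K, (p₀.map ((RingHom.fst K k).comp φ)).eval x = 0 := by
      apply IsAlgClosed.exists_root
      rw [Polynomial.degree_map_eq_of_leadingCoeff_ne_zero _ hl1]
      intro h
      exact hmin' (Polynomial.natDegree_eq_zero_iff_degree_le_zero.2 h.le)
    obtain ⟨d, hd⟩ := Place.res_of_root (P := P) (p₀.map φΓ) (x := x)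
      (by rw [Polynomial.map_map, hcomp]; exact hx) (by rw [hlead]; exact hl2)
    have hroot : p₀.eval₂ φ (x, d) = 0 := by
      have h1 : (p₀.eval₂ φ (x, d)).1 = 0 := by
        change RingHom.fst K k _ = _
        rw [Polynomial.hom_eval₂, ← Polynomial.eval_map]; exact hx
      have h2 := P.func (p₀.eval₂ φ (x, d)).2 (by rw [← h1]; exact eval₂_mem P φ hφ hd p₀)
      exact Prod.ext h1 h2
    have hspec : ∀ n, ∀ p : Polynomial A, p.natDegree = n → p.eval₂ f t = 0 →
        p.eval₂ φ (x, d) = 0 := by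
      intro n
      induction n using Nat.strong_induction_on with
      | _ n ih =>
      intro p hpn hp
      by_cases hlt : p.natDegree < p₀.natDegree
      · have h1 := hmin p hlt hp
        have : p.map φ = 0 := by
          ext1 j
          have := congrArg (fun r => r.coeff j) h1
          simp only [Polynomial.coeff_map, Polynomial.coeff_zero] at this ⊢
          exact hker _ this
        rw [← Polynomial.eval_map, this, Polynomial.eval_zero]
      · push Not at hlt
        let r := Polynomial.C p₀.leadingCoeff * p - 
          Polynomial.C p.leadingCoeff * Polynomial.X ^ (p.natDegree - p₀.natDegree) * p₀
        have hr : r.natDegree < n := by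
          have hle : r.natDegree ≤ n := by
            refine (Polynomial.natDegree_sub_le _ _).trans (max_le ?_ ?_)
            · exact (Polynomial.natDegree_C_mul_le _ _).trans hpn.le
            · rw [mul_assoc]
              refine (Polynomial.natDegree_C_mul_le _ _).trans ?_
              refine Polynomial.natDegree_mul_le.trans ?_
              have := Polynomial.natDegree_X_pow_le (R := A) (p.natDegree - p₀.natDegree)
              omega
          have hc : r.coeff n = 0 := by
            have h1 : n = p₀.natDegree + (p.natDegree - p₀.natDegree) := by omega
            have h2 : (Polynomial.X ^ (p.natDegree - p₀.natDegree) * p₀).coeff n =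
                p₀.leadingCoeff := by
              conv_lhs => rw [h1]
              rw [Polynomial.coeff_X_pow_mul]; rfl
            have h3 : p.coeff n = p.leadingCoeff := by rw [← hpn]; rfl
            simp only [r, mul_assoc, Polynomial.coeff_sub, Polynomial.coeff_C_mul, h2, h3]
            ring
          refine lt_of_le_of_ne hle fun h => ?_
          rw [← h] at hc
          have : r = 0 := Polynomial.leadingCoeff_eq_zero.1 hc
          rw [this, Polynomial.natDegree_zero] at h
          omega
        have hrt : r.eval₂ f t = 0 := by
          simp [r, Polynomial.eval₂_sub, Polynomial.eval₂_mul, hp, hp0]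
        have := ih _ hr r rfl hrt
        simp only [r, Polynomial.eval₂_sub, Polynomial.eval₂_mul, hroot, mul_zero, sub_zero,
          Polynomial.eval₂_C] at this
        have h1 := congrArg Prod.fst this
        have h2 := congrArg Prod.snd this
        exact Prod.ext ((mul_eq_zero.1 h1).resolve_left hl1) ((mul_eq_zero.1 h2).resolve_left hl2)
    refine ⟨(x, d), hd, fun p hp => hspec _ p rfl hp, ?_⟩
    have := hspec _ _ rfl hbq
    intro h0
    apply hb2
    have h2 := congrArg Prod.snd this
    simp only [Polynomial.eval₂_sub, Polynomial.eval₂_mul, Polynomial.eval₂_C, Prod.snd_sub,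
      Prod.snd_mul, h0, zero_mul, zero_sub] at h2
    simpa using h2

lemma eval₂_option {A R α : Type*} [CommRing A] [CommRing R] (g : A →+* R) (s : Option α → R)
    (p : MvPolynomial (Option α) A) : p.eval₂ g s =
    (optionEquivLeft A α p).eval₂ (eval₂Hom g (fun i => s (some i))) (s none) := by
  induction p using MvPolynomial.induction_on with
  | C a => simp
  | add p q hp hq => simp [hp, hq]
  | mul_X p i hp =>
    rw [eval₂_mul, map_mul, Polynomial.eval₂_mul, hp]
    cases i <;> simp

lemma ext_multi {A D : Type*} [CommRing A] [CommRing D] [IsDomain D] (f : A →+* D)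
    {σ : Type*} [Finite σ] (t : σ → D)
    (e : MvPolynomial σ A) (he : e.eval₂ f t ≠ 0) :
    ∃ a : A, f a ≠ 0 ∧ ∀ {k : Type u} {K : Type v} [Field k] [Field K] [Algebra k K]
      [IsAlgClosed k] [IsAlgClosed K] (P : Place k K) (φ : A →+* K × k), (∀ a, φ a ∈ P.Γ) →
      (∀ a, f a = 0 → φ a = 0) → (φ a).2 ≠ 0 →
      ∃ δ : σ → K × k, (∀ i, δ i ∈ P.Γ) ∧
        (∀ p : MvPolynomial σ A, p.eval₂ f t = 0 → p.eval₂ φ δ = 0) ∧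
        (e.eval₂ φ δ).2 ≠ 0 := by
  induction σ using Finite.induction_empty_option with
  | of_equiv ε ih =>
    rename_i α β
    obtain ⟨a, ha, h⟩ := ih (t ∘ ε) (rename ε.symm e) (by
      rw [eval₂_rename]; simpa [Function.comp_assoc] using he)
    refine ⟨a, ha, ?_⟩
    intro k K _ _ _ _ _ P φ hφ hker h2
    obtain ⟨δ, h3, h4, h5⟩ := h P φ hφ hker h2
    refine ⟨δ ∘ ε.symm, fun i => h3 _, fun p hp => ?_, ?_⟩
    · rw [← eval₂_rename]
      apply h4
      rw [eval₂_rename]; simpa [Function.comp_assoc] using hp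
    · rwa [← eval₂_rename]
  | h_empty =>
    have hC : ∀ p : MvPolynomial PEmpty A, ∃ a, p = C a := fun p =>
      ⟨_, MvPolynomial.eq_C_of_isEmpty p⟩
    obtain ⟨a, rfl⟩ := hC e
    rw [eval₂_C] at he
    refine ⟨a, he, ?_⟩
    intro k K _ _ _ _ _ P φ hφ hker h2
    refine ⟨fun i => i.elim, fun i => i.elim, fun p hp => ?_, by rwa [eval₂_C]⟩
    obtain ⟨b, rfl⟩ := hC p
    rw [eval₂_C] at hp ⊢
    exact hker b hp
  | h_option ih =>
    rename_i α _
    obtain ⟨a', ha', h'⟩ := ext_step (eval₂Hom f (fun i => t (some i))) (t none)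
      (optionEquivLeft A α e) (by rwa [← eval₂_option])
    obtain ⟨a, ha, h⟩ := ih (fun i => t (some i)) a' ha'
    refine ⟨a, ha, ?_⟩
    intro k K _ _ _ _ _ P φ hφ hker h2
    obtain ⟨δ, h3, h4, h5⟩ := h P φ hφ hker h2
    obtain ⟨δ', h3', h4', h5'⟩ := h' P (eval₂Hom φ δ) (fun q => by
        change eval₂ φ δ q ∈ P.Γ
        induction q using MvPolynomial.induction_on with
        | C a => rw [eval₂_C]; exact hφ a
        | add p q hp hq => rw [eval₂_add]; exact P.Γ.add_mem hp hq
        | mul_X p i hp => rw [eval₂_mul, eval₂_X]; exact P.Γ.mul_mem hp (h3 i)) h4 h5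
    refine ⟨fun o => o.elim δ' δ, ?_, fun p hp => ?_, ?_⟩
    · rintro (_ | i)
      · exact h3'
      · exact h3 i
    · rw [eval₂_option] at hp ⊢
      exact h4' _ hp
    · rw [eval₂_option]; exact h5'

lemma lift_place {k : Type u} [Field k] [IsAlgClosed k] {σ ι : Type*} [Finite σ]
    {T : Set (σ → k)} (hT : Irr T) (Φ : ι → MvPolynomial σ k) (b : MvPolynomial σ k)
    (hb : ∃ t ∈ T, aeval t b ≠ 0) :
    ∃ a : MvPolynomial ι k, (∃ t ∈ T, aeval (pmap k Φ t) a ≠ 0) ∧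
      ∀ {K : Type v} [Field K] [Algebra k K] [IsAlgClosed K] (P : Place k K) (u : ι → K)
        (ub : ι → k), (∀ i, P.Res (u i) (ub i)) → u ∈ ext K (pmap k Φ '' T) → aeval ub a ≠ 0 →
        ∃ (t : σ → K) (tb : σ → k), (∀ i, P.Res (t i) (tb i)) ∧ t ∈ ext K T ∧ pmap K Φ t = u ∧
          aeval tb b ≠ 0 := by
  obtain ⟨L, _, _, _, τ, hτ⟩ := exists_generic hT
  have hcomp : ∀ {R : Type (max u v)} [CommRing R] [Algebra k R] (x : ι → R) (y : σ → R) 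
      (F : MvPolynomial σ k), eval₂ (aeval x : MvPolynomial ι k →ₐ[k] R).toRingHom y
        (MvPolynomial.map C F) = aeval y F := by
    intro R _ _ x y F
    rw [eval₂_map, aeval_def]
    congr 1
    ext c; simp
  have hcompL : ∀ (x : ι → L) (y : σ → L) 
      (F : MvPolynomial σ k), eval₂ (aeval x : MvPolynomial ι k →ₐ[k] L).toRingHom y
        (MvPolynomial.map C F) = aeval y F := by
    intro x y F
    rw [eval₂_map, aeval_def]
    congr 1
    ext c; simp
  have hbτ : aeval τ b ≠ 0 := by
    intro h
    obtain ⟨t, ht, h'⟩ := hb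
    exact h' ((hτ b).1 h t ht)
  obtain ⟨a, ha, h⟩ := ext_multi.{u, v} (aeval (pmap L Φ τ) : MvPolynomial ι k →ₐ[k] L).toRingHom τ
    (MvPolynomial.map C b) (by rw [hcompL]; exact hbτ)
  have hτ' : ∀ F : MvPolynomial ι k, aeval (pmap L Φ τ) F = 0 ↔
      ∀ s ∈ T, aeval (pmap k Φ s) F = 0 := by
    intro F
    simp only [aeval_pmap]
    exact hτ _
  refine ⟨a, ?_, ?_⟩
  · by_contra hcon
    push Not at hcon
    exact ha ((hτ' a).2 hcon)
  intro K _ _ _ P u ub hres hu hua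
  have key : ∀ F : MvPolynomial ι k, aeval (fun i => (u i, ub i)) F = (aeval u F, aeval ub F) := by
    intro F
    ext
    · exact MvPolynomial.map_aeval (fun i => (u i, ub i)) (RingHom.fst K k) F
    · exact MvPolynomial.map_aeval (fun i => (u i, ub i)) (RingHom.snd K k) F
  obtain ⟨δ, h1, h2, h3⟩ := h P (aeval (fun i => (u i, ub i)) :
      MvPolynomial ι k →ₐ[k] K × k).toRingHom (fun F => by
        change aeval (fun i => (u i, ub i)) F ∈ P.Γ
        rw [key]; exact Place.Res.aeval hres F) (fun F hF => by
        change aeval (fun i => (u i, ub i)) F = 0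
        have h0 : aeval u F = 0 := by
          apply hu
          rintro _ ⟨s, hs, rfl⟩
          exact (hτ' F).1 hF s hs
        have h0' : aeval ub F = 0 := by
          apply Place.mem_ext hu hres
          rintro _ ⟨s, hs, rfl⟩
          exact (hτ' F).1 hF s hs
        rw [key, h0, h0']; rfl) (by
        change (aeval (fun i => (u i, ub i)) a).2 ≠ 0
        rw [key]; exact hua)
  have keyδ : ∀ F : MvPolynomial σ k, aeval δ F =
      (aeval (fun i => (δ i).1) F, aeval (fun i => (δ i).2) F) := by
    intro F
    ext
    · exact MvPolynomial.map_aeval δ (RingHom.fst K k) F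
    · exact MvPolynomial.map_aeval δ (RingHom.snd K k) F
  refine ⟨fun i => (δ i).1, fun i => (δ i).2, h1, ?_, ?_, ?_⟩
  · intro F hF
    have := h2 (MvPolynomial.map C F) (by rw [hcompL]; exact (hτ F).2 hF)
    rw [hcomp, keyδ] at this
    exact congrArg Prod.fst this
  · funext i
    have := h2 (MvPolynomial.map C (Φ i) - C (X i)) (by
      rw [eval₂_sub, hcompL, eval₂_C]
      simp [pmap])
    rw [eval₂_sub, hcomp, eval₂_C, keyδ] at this
    have := congrArg Prod.fst this
    simpa [sub_eq_zero, pmap] using this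
  · rw [hcomp, keyδ] at h3
    exact h3

end Stein

namespace Stein

section comp
variable {P : Type*} [Group P] [TopologicalSpace P]

lemma preirr_mul (hl : ∀ a : P, Continuous fun x => a * x) (hr : ∀ a : P, Continuous fun x => x * a)
    {S C : Set P} (hS : IsPreirreducible S) (hC : IsPreirreducible C) :
    IsPreirreducible (Set.image2 (· * ·) S C) := by
  rintro u v hu hv ⟨_, ⟨s1, hs1, c1, hc1, rfl⟩, h1⟩ ⟨_, ⟨s2, hs2, c2, hc2, rfl⟩, h2⟩
  obtain ⟨s, hs, hsu, hsv⟩ := hS _ _ (hu.preimage (hr c1)) (hv.preimage (hr c2))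
    ⟨s1, hs1, h1⟩ ⟨s2, hs2, h2⟩
  obtain ⟨c, hc, hcu, hcv⟩ := hC _ _ (hu.preimage (hl s)) (hv.preimage (hl s))
    ⟨c1, hc1, hsu⟩ ⟨c2, hc2, hsv⟩
  exact ⟨s * c, ⟨s, hs, c, hc, rfl⟩, hcu, hcv⟩

lemma irr_sub_comp (hl : ∀ a : P, Continuous fun x => a * x)
    (hr : ∀ a : P, Continuous fun x => x * a) {S : Set P} (hS : IsPreirreducible S) (h1 : 1 ∈ S) :
    S ⊆ irreducibleComponent (1 : P) := by
  have hC : IsPreirreducible (irreducibleComponent (1 : P)) := isIrreducible_irreducibleComponent.2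
  have h := preirr_mul hl hr hS hC
  have hsub : irreducibleComponent (1 : P) ⊆ Set.image2 (· * ·) S (irreducibleComponent (1 : P)) :=
    fun c hc => ⟨1, h1, c, hc, one_mul c⟩
  rw [← eq_irreducibleComponent h hsub]
  exact fun s hs => ⟨s, hs, 1, mem_irreducibleComponent, mul_one s⟩

lemma exists_comp_top [TopologicalSpace.NoetherianSpace P] (hl : ∀ a : P, Continuous fun x => a * x)
    (hr : ∀ a : P, Continuous fun x => x * a) :
    ∃ C : Subgroup P, IsClosed (C : Set P) ∧ IsIrreducible (C : Set P) ∧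
      (∃ s : Set P, s.Finite ∧ ∀ p, ∃ c ∈ s, c⁻¹ * p ∈ C) ∧
      ∀ S : Set P, IsPreirreducible S → 1 ∈ S → S ⊆ C := by
  have hinv : ∀ x ∈ irreducibleComponent (1 : P), ∀ y ∈ irreducibleComponent (1 : P),
      x⁻¹ * y ∈ irreducibleComponent (1 : P) := by
    intro x hx y hy
    refine irr_sub_comp hl hr (S := (fun z => x⁻¹ * z) '' irreducibleComponent (1 : P)) ?_ ?_ ?_
    · exact isIrreducible_irreducibleComponent.2.image _ (hl _).continuousOn
    · exact ⟨x, hx, by simp⟩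
    · exact ⟨y, hy, rfl⟩
  have h1 : (1 : P) ∈ irreducibleComponent (1 : P) := mem_irreducibleComponent
  have hinv' : ∀ x ∈ irreducibleComponent (1 : P), x⁻¹ ∈ irreducibleComponent (1 : P) :=
    fun x hx => by simpa using hinv x hx 1 h1
  let C : Subgroup P :=
    { carrier := irreducibleComponent (1 : P)
      one_mem' := h1
      mul_mem' := fun {a b} ha hb => by simpa using hinv _ (hinv' a ha) b hb
      inv_mem' := fun {a} ha => hinv' a ha }
  refine ⟨C, isClosed_irreducibleComponent, isIrreducible_irreducibleComponent, ?_,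
    fun S hS h => irr_sub_comp hl hr hS h⟩
  have hfin := TopologicalSpace.NoetherianSpace.finite_irreducibleComponents (α := P)
  have key : ∀ g : P, irreducibleComponent g = (fun z => g * z) '' irreducibleComponent (1 : P) := by
    intro g
    have h2 : irreducibleComponent g ⊆ (fun z => g * z) '' irreducibleComponent (1 : P) := by
      intro e he
      refine ⟨g⁻¹ * e, ?_, by simp⟩
      refine irr_sub_comp hl hr (S := (fun z => g⁻¹ * z) '' irreducibleComponent g) ?_ ?_ ?_
      · exact isIrreducible_irreducibleComponent.2.image _ (hl _).continuousOn
      · exact ⟨g, mem_irreducibleComponent, by simp⟩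
      · exact ⟨e, he, rfl⟩
    exact (eq_irreducibleComponent
      (isIrreducible_irreducibleComponent.2.image (fun z => g * z) (hl g).continuousOn) h2).symm
  have hr : (Set.range (irreducibleComponent : P → Set P)).Finite :=
    hfin.subset (by
      rintro _ ⟨g, rfl⟩
      rw [irreducibleComponents_eq_maximals_closed]
      have := irreducibleComponent_mem_irreducibleComponents g
      rwa [irreducibleComponents_eq_maximals_closed] at this)
  have := hr.to_subtype
  refine ⟨Set.range (Set.rangeSplitting (irreducibleComponent : P → Set P)), Set.finite_range _,
    fun p => ⟨_, ⟨⟨irreducibleComponent p, p, rfl⟩, rfl⟩, ?_⟩⟩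
  set c := Set.rangeSplitting (irreducibleComponent : P → Set P) ⟨irreducibleComponent p, p, rfl⟩
  have hc : irreducibleComponent c = irreducibleComponent p :=
    Set.apply_rangeSplitting (irreducibleComponent : P → Set P) ⟨irreducibleComponent p, p, rfl⟩
  have : p ∈ irreducibleComponent c := by rw [hc]; exact mem_irreducibleComponent
  rw [key c] at this
  obtain ⟨z, hz, hzp⟩ := this
  have : c⁻¹ * p = z := by rw [← hzp]; simp
  rw [this]; exact hz

lemma eq_top_of_connected (hl : ∀ a : P, Continuous fun x => a * x) {C : Subgroup P}
    (hC : IsClosed (C : Set P)) (hs : ∃ s : Set P, s.Finite ∧ ∀ p, ∃ c ∈ s, c⁻¹ * p ∈ C)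
    (hP : IsPreconnected (Set.univ : Set P)) : C = ⊤ := by
  obtain ⟨s, hs, hs'⟩ := hs
  have : (C : Set P)ᶜ = ⋃ c ∈ s ∩ (C : Set P)ᶜ, (fun x => c⁻¹ * x) ⁻¹' (C : Set P) := by
    ext p
    simp only [Set.mem_compl_iff, SetLike.mem_coe, Set.mem_iUnion, Set.mem_preimage, Set.mem_inter_iff,
      exists_prop]
    constructor
    · intro hp
      obtain ⟨c, hc, h⟩ := hs' p
      refine ⟨c, ⟨hc, fun hcC => hp ?_⟩, h⟩
      simpa using C.mul_mem hcC h
    · rintro ⟨c, ⟨_, hc⟩, h⟩ hp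
      apply hc
      have := C.mul_mem hp (C.inv_mem h)
      simpa using this
  have hcl : IsClosed ((C : Set P)ᶜ) := by
    rw [this]
    exact (hs.subset Set.inter_subset_left).isClosed_biUnion fun c _ => hC.preimage (hl _)
  have hclopen : IsClopen (C : Set P) := ⟨hC, by simpa using hcl.isOpen_compl⟩
  have : PreconnectedSpace P := ⟨hP⟩
  rcases isClopen_iff.1 hclopen with h | h
  · exact absurd (C.one_mem) (by rw [← SetLike.mem_coe, h]; simp)
  · exact SetLike.coe_injective (by simpa using h)
end comp

section zar
variable {n : ℕ}

/-- matrix entries as a point -/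
def vec {R : Type*} (A : Matrix (Fin n) (Fin n) R) : Fin n × Fin n → R := fun q => A q.1 q.2

/-- the set of points of a subset of `GL_n` -/
def pts {k : Type*} [Field k] (S : Set (GL (Fin n) k)) : Set (Fin n × Fin n → k) :=
  (fun g : GL (Fin n) k => vec (g : Matrix (Fin n) (Fin n) k)) '' S

def Cl {k : Type*} [Field k] (S : Set (GL (Fin n) k)) : Prop :=
  ∀ g : GL (Fin n) k, vec (g : Matrix (Fin n) (Fin n) k) ∈ ext k (pts S) → g ∈ S

variable {k : Type*} [Field k]

lemma zar_open_iff (U : Set (GL (Fin n) k)) : @IsOpen _ (zariskiGL k n) U ↔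
    ∀ g ∈ U, ∃ p : MvPolynomial (Fin n × Fin n) k, aeval (vec g.val) p ≠ 0 ∧
      ∀ h : GL (Fin n) k, aeval (vec h.val) p ≠ 0 → h ∈ U := by
  let _ : TopologicalSpace (GL (Fin n) k) := zariskiGL k n
  let D : MvPolynomial (Fin n × Fin n) k → Set (GL (Fin n) k) := fun p =>
    {g | aeval (vec g.val) p ≠ 0}
  have hb : TopologicalSpace.IsTopologicalBasis (Set.range D) := by
    refine ⟨?_, ?_, ?_⟩
    · rintro _ ⟨p, rfl⟩ _ ⟨q, rfl⟩ x ⟨hp, hq⟩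
      refine ⟨D (p * q), ⟨_, rfl⟩, ?_, ?_⟩
      · change aeval (vec x.val) (p * q) ≠ 0
        rw [map_mul]; exact mul_ne_zero hp hq
      · intro y hy
        change aeval (vec y.val) (p * q) ≠ 0 at hy
        rw [map_mul] at hy
        exact ⟨left_ne_zero_of_mul hy, right_ne_zero_of_mul hy⟩
    · rw [Set.eq_univ_iff_forall]
      intro x
      refine ⟨D 1, ⟨1, rfl⟩, ?_⟩
      change aeval (vec x.val) 1 ≠ 0
      simp
    · change zariskiGL k n = _
      unfold zariskiGL zariskiMatrix
      rw [induced_generateFrom_eq]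
      congr 1
      ext V
      constructor
      · rintro ⟨_, ⟨p, rfl⟩, rfl⟩
        refine ⟨p, ?_⟩
        ext g
        simp only [D, aeval_eq_eval]
        rfl
      · rintro ⟨p, rfl⟩
        refine ⟨_, ⟨p, rfl⟩, ?_⟩
        ext g
        simp only [D, aeval_eq_eval]
        rfl
  rw [hb.isOpen_iff]
  constructor
  · intro h g hg
    obtain ⟨_, ⟨p, rfl⟩, hp, hs⟩ := h g hg
    exact ⟨p, hp, fun h hh => hs hh⟩
  · intro h g hg
    obtain ⟨p, hp, hs⟩ := h g hg
    exact ⟨_, ⟨p, rfl⟩, hp, fun h hh => hs h hh⟩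

lemma zar_closed_iff (Z : Set (GL (Fin n) k)) : @IsClosed _ (zariskiGL k n) Z ↔ Cl Z := by
  rw [← @isOpen_compl_iff _ _ (zariskiGL k n), zar_open_iff]
  constructor
  · intro h g hg
    by_contra hgZ
    obtain ⟨p, hp, hs⟩ := h g hgZ
    apply hp
    apply hg
    rintro _ ⟨z, hz, rfl⟩
    by_contra hne
    exact hs z hne hz
  · intro h g hg
    have : ¬ vec g.val ∈ ext k (pts Z) := fun h' => hg (h g h')
    simp only [ext, Set.mem_ofPred_eq, not_forall] at this
    obtain ⟨p, hp, hpg⟩ := this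
    exact ⟨p, hpg, fun h hh hZ => hh (hp _ ⟨h, hZ, rfl⟩)⟩

lemma irr_iff (S : Set (GL (Fin n) k)) : @IsIrreducible _ (zariskiGL k n) S ↔ Irr (pts S) := by
  let _ : TopologicalSpace (GL (Fin n) k) := zariskiGL k n
  constructor
  · rintro ⟨h1, h2⟩
    refine ⟨h1.image _, fun F₁ F₂ hF => ?_⟩
    by_contra hcon
    push Not at hcon
    obtain ⟨⟨_, ⟨s1, hs1, rfl⟩, h1⟩, ⟨_, ⟨s2, hs2, rfl⟩, h2'⟩⟩ := hcon
    have ho : ∀ p : MvPolynomial (Fin n × Fin n) k,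
        IsOpen {g : GL (Fin n) k | aeval (vec g.val) p ≠ 0} := fun p =>
      (zar_open_iff _).2 fun g hg => ⟨p, hg, fun h hh => hh⟩
    obtain ⟨s, hs, ha, hb⟩ := h2 _ _ (ho F₁) (ho F₂) ⟨s1, hs1, h1⟩ ⟨s2, hs2, h2'⟩
    have := hF _ ⟨s, hs, rfl⟩
    rw [map_mul] at this
    exact mul_ne_zero ha hb this
  · rintro ⟨h1, h2⟩
    refine ⟨by simpa [pts] using h1, ?_⟩
    rintro u v hu hv ⟨s1, hs1, h1⟩ ⟨s2, hs2, h2'⟩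
    obtain ⟨p, hp, hps⟩ := (zar_open_iff u).1 hu s1 h1
    obtain ⟨q, hq, hqs⟩ := (zar_open_iff v).1 hv s2 h2'
    by_contra hcon
    have := h2 p q (by
      rintro _ ⟨s, hs, rfl⟩
      by_contra hne
      rw [map_mul] at hne
      exact hcon ⟨s, hs, hps s (left_ne_zero_of_mul hne), hqs s (right_ne_zero_of_mul hne)⟩)
    rcases this with h | h
    · exact hp (h _ ⟨s1, hs1, rfl⟩)
    · exact hq (h _ ⟨s2, hs2, rfl⟩)

lemma zar_noeth : @TopologicalSpace.NoetherianSpace _ (zariskiGL k n) := by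
  let _ : TopologicalSpace (GL (Fin n) k) := zariskiGL k n
  let J : TopologicalSpace.Opens (GL (Fin n) k) → Ideal (MvPolynomial (Fin n × Fin n) k) := fun U =>
    vanishingIdeal k (pts (U : Set (GL (Fin n) k))ᶜ)
  have hJ : StrictMono J := by
    intro U V hUV
    have hle : J U ≤ J V := by
      intro p hp
      rw [mem_vanishingIdeal_iff] at hp ⊢
      rintro _ ⟨g, hg, rfl⟩
      exact hp _ ⟨g, fun h => hg (hUV.le h), rfl⟩
    refine lt_of_le_of_ne hle fun heq => hUV.not_ge ?_
    intro g hg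
    by_contra hgU
    obtain ⟨p, hp, hs⟩ := (zar_open_iff _).1 V.2 g hg
    have : p ∈ J V := by
      rw [mem_vanishingIdeal_iff]
      rintro _ ⟨h, hh, rfl⟩
      by_contra hne
      exact hh (hs h hne)
    rw [← heq, mem_vanishingIdeal_iff] at this
    exact hp (this _ ⟨g, hgU, rfl⟩)
  exact hJ.wellFoundedGT

lemma zar_cont {m : ℕ} (f : GL (Fin n) k → GL (Fin m) k)
    (Φ : Fin m × Fin m → MvPolynomial (Fin n × Fin n) k)
    (h : ∀ g, vec (f g).val = pmap k Φ (vec g.val)) :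
    @Continuous _ _ (zariskiGL k n) (zariskiGL k m) f := by
  let _ : TopologicalSpace (GL (Fin n) k) := zariskiGL k n
  let _ : TopologicalSpace (GL (Fin m) k) := zariskiGL k m
  rw [continuous_def]
  intro U hU
  refine (zar_open_iff _).2 fun g hg => ?_
  obtain ⟨p, hp, hs⟩ := (zar_open_iff _).1 hU (f g) hg
  refine ⟨bind₁ Φ p, ?_, fun g' hg' => hs _ ?_⟩
  · rwa [← aeval_pmap, ← h]
  · rwa [← aeval_pmap, ← h] at hg'

noncomputable def mulΦ {k : Type*} [Field k] (A B : Matrix (Fin n) (Fin n) k) :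
    Fin n × Fin n → MvPolynomial (Fin n × Fin n) k :=
  fun q => ∑ i, ∑ j, C (A q.1 i * B j q.2) * X (i, j)

lemma pmap_mulΦ {K : Type*} [Field K] [Algebra k K] (A B : Matrix (Fin n) (Fin n) k)
    (M : Matrix (Fin n) (Fin n) K) : pmap K (mulΦ A B) (vec M) =
      vec (A.map (algebraMap k K) * M * B.map (algebraMap k K)) := by
  ext ⟨a, b⟩
  simp only [pmap, mulΦ, vec, map_sum, map_mul, aeval_C, aeval_X, Matrix.mul_apply, Finset.sum_mul,
    Matrix.map_apply]
  rw [Finset.sum_comm]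
  refine Finset.sum_congr rfl fun i _ => Finset.sum_congr rfl fun j _ => by ring

lemma pmap_mulΦ_self (A B : Matrix (Fin n) (Fin n) k)
    (M : Matrix (Fin n) (Fin n) k) : pmap k (mulΦ A B) (vec M) = vec (A * M * B) := by
  rw [pmap_mulΦ]; simp

lemma exists_comp (P : Subgroup (GL (Fin n) k)) (hP : Cl (P : Set (GL (Fin n) k))) :
    ∃ P0 : Subgroup (GL (Fin n) k), P0 ≤ P ∧ Cl (P0 : Set (GL (Fin n) k)) ∧
      Irr (pts (P0 : Set (GL (Fin n) k))) ∧
      (∃ s : Set (GL (Fin n) k), s.Finite ∧ s ⊆ P ∧ ∀ p ∈ P, ∃ c ∈ s, c⁻¹ * p ∈ P0) ∧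
      (∀ S : Set (GL (Fin n) k), S ⊆ P → 1 ∈ S → Irr (pts S) → S ⊆ P0) ∧
      (@IsConnected _ (zariskiGL k n) (P : Set (GL (Fin n) k)) → P0 = P) := by
  let _ : TopologicalSpace (GL (Fin n) k) := zariskiGL k n
  have := zar_noeth (k := k) (n := n)
  have hN : TopologicalSpace.NoetherianSpace P :=
    Topology.IsInducing.subtypeVal.noetherianSpace
  have hl0 : ∀ a : GL (Fin n) k, Continuous fun x => a * x := fun a =>
    zar_cont _ (mulΦ a.val 1) (fun g => by rw [pmap_mulΦ_self]; simp)
  have hr0 : ∀ a : GL (Fin n) k, Continuous fun x => x * a := fun a =>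
    zar_cont _ (mulΦ 1 a.val) (fun g => by rw [pmap_mulΦ_self]; simp)
  have hl : ∀ a : P, Continuous fun x => a * x := fun a =>
    ((hl0 a).comp continuous_subtype_val).subtype_mk _
  have hr : ∀ a : P, Continuous fun x => x * a := fun a =>
    ((hr0 a).comp continuous_subtype_val).subtype_mk _
  obtain ⟨C, hC1, hC2, hC3, hC4⟩ := exists_comp_top hl hr
  have hcoe : ((C.map P.subtype : Subgroup (GL (Fin n) k)) : Set (GL (Fin n) k)) =
    Subtype.val '' (C : Set P) := by simp
  refine ⟨C.map P.subtype, ?_, ?_, ?_, ?_, ?_, ?_⟩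
  · exact Subgroup.map_subtype_le C
  · rw [← zar_closed_iff, hcoe]
    exact ((zar_closed_iff _).2 hP).isClosedMap_subtype_val _ hC1
  · rw [← irr_iff, hcoe]
    exact hC2.image _ continuous_subtype_val.continuousOn
  · obtain ⟨s, hs, hs'⟩ := hC3
    refine ⟨Subtype.val '' s, hs.image _, by rintro _ ⟨x, -, rfl⟩; exact x.2, fun p hp => ?_⟩
    obtain ⟨c, hc, h⟩ := hs' ⟨p, hp⟩
    exact ⟨c, ⟨c, hc, rfl⟩, ⟨_, h, rfl⟩⟩
  · intro S hS h1 hirr x hx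
    rw [← irr_iff] at hirr
    have hpre : IsPreirreducible (Subtype.val ⁻¹' S : Set P) := by
      rintro u v ⟨u', hu', rfl⟩ ⟨v', hv', rfl⟩ ⟨a, ha, ha'⟩ ⟨b, hb, hb'⟩
      obtain ⟨c, hc, hc1, hc2⟩ := hirr.2 u' v' hu' hv' ⟨a, ha, ha'⟩ ⟨b, hb, hb'⟩
      exact ⟨⟨c, hS hc⟩, hc, hc1, hc2⟩
    exact ⟨⟨x, hS hx⟩, hC4 _ hpre h1 hx, rfl⟩
  · intro hconn
    have : C = ⊤ := eq_top_of_connected hl hC1 hC3 (by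
      have := isConnected_iff_connectedSpace.1 hconn
      exact isPreconnected_univ)
    rw [this, ← MonoidHom.range_eq_map]; exact P.range_subtype

lemma irr_of_connected (P : Subgroup (GL (Fin n) k))
    (hP : @IsClosed _ (zariskiGL k n) (P : Set (GL (Fin n) k)))
    (hc : @IsConnected _ (zariskiGL k n) (P : Set (GL (Fin n) k))) :
    Irr (pts (P : Set (GL (Fin n) k))) := by
  obtain ⟨P0, -, -, h, -, -, h'⟩ := exists_comp P ((zar_closed_iff _).1 hP)
  rwa [h' hc] at h

lemma connected_of_irr (S : Set (GL (Fin n) k)) (hS : Irr (pts S)) :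
    @IsConnected _ (zariskiGL k n) S := by
  let _ : TopologicalSpace (GL (Fin n) k) := zariskiGL k n
  exact ((irr_iff S).2 hS).isConnected

end zar

end Stein

set_option linter.unusedSectionVars false

namespace Stein

section resm
variable {k K : Type*} [Field k] [Field K] [Algebra k K] (P : Place k K)

/-- entrywise residue of a matrix -/
def Place.ResM {m n : Type*} (A : Matrix m n K) (a : Matrix m n k) : Prop :=
  ∀ i j, P.Res (A i j) (a i j)

variable {P}
variable {l m n : Type*}

lemma Place.ResM.mul [Fintype m] {A : Matrix l m K} {a : Matrix l m k} {B : Matrix m n K}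
    {b : Matrix m n k} (hA : P.ResM A a) (hB : P.ResM B b) : P.ResM (A * B) (a * b) := fun i j => by
  rw [Matrix.mul_apply, Matrix.mul_apply]
  exact Place.Res.sum fun x _ => (hA i x).mul (hB x j)

lemma Place.ResM.mulVec [Fintype n] {A : Matrix m n K} {a : Matrix m n k} {u : n → K} {v : n → k}
    (hA : P.ResM A a) (hB : ∀ i, P.Res (u i) (v i)) (i : m) :
    P.Res (A.mulVec u i) (a.mulVec v i) := by
  simp only [Matrix.mulVec, dotProduct]
  exact Place.Res.sum fun x _ => (hA i x).mul (hB x)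

lemma Place.ResM.det [Fintype n] [DecidableEq n] {A : Matrix n n K} {a : Matrix n n k}
    (hA : P.ResM A a) : P.Res A.det a.det := by
  rw [Matrix.det_apply', Matrix.det_apply']
  refine Place.Res.sum fun σ _ => Place.Res.mul ?_ (Place.Res.prod fun i _ => hA _ _)
  have := Place.res_algebraMap (P := P) (((Equiv.Perm.sign σ : ℤ) : k))
  simpa using this

lemma Place.resM_one [DecidableEq n] : P.ResM (1 : Matrix n n K) 1 := fun i j => by
  rw [Matrix.one_apply, Matrix.one_apply]
  split_ifs
  · exact Place.res_one
  · exact Place.res_zero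

lemma Place.resM_map (A : Matrix m n k) : P.ResM (A.map (algebraMap k K)) A := fun _ _ =>
  Place.res_algebraMap _

lemma Place.ResM.unique {A : Matrix m n K} {a b : Matrix m n k} (h : P.ResM A a)
    (h' : P.ResM A b) : a = b := by
  ext i j; exact (h i j).unique (h' i j)

lemma Place.ResM.inv [Fintype n] [DecidableEq n] {A : Matrix n n K} {a : Matrix n n k}
    (hA : P.ResM A a) (ha : a.det ≠ 0) : P.ResM A⁻¹ a⁻¹ := by
  intro i j
  rw [Matrix.inv_def, Matrix.inv_def]
  simp only [Matrix.smul_apply, smul_eq_mul, Ring.inverse_eq_inv']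
  refine (hA.det.inv ha).mul ?_
  rw [Matrix.adjugate_apply, Matrix.adjugate_apply]
  refine Place.ResM.det fun i' j' => ?_
  simp only [Matrix.updateRow_apply]
  split_ifs
  · rw [Pi.single_apply, Pi.single_apply]
    split_ifs
    · exact Place.res_one
    · exact Place.res_zero
  · exact hA _ _

/-- finite sets of elements have a place at which they are all finite and nonzero ones stay so -/
lemma exists_place_fin [IsAlgClosed k] (s : Set K) (hs : s.Finite) :
    ∃ P : Place k K, ∀ x ∈ s, ∃ a, P.Res x a ∧ (x ≠ 0 → a ≠ 0) := by
  classical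
  have := hs.to_subtype
  have := Fintype.ofFinite s
  obtain ⟨t, ht, htF⟩ := exists_kpoint (k := k) (fun i : s => (i : K))
    (∏ i : s, if (i : K) ≠ 0 then X i else 1) (by
      rw [map_prod, Finset.prod_ne_zero_iff]
      intro i _
      split_ifs with h
      · rwa [aeval_X]
      · simp)
  obtain ⟨P, hP⟩ := exists_place_spec (fun i : s => (i : K)) t ht
  refine ⟨P, fun x hx => ⟨t ⟨x, hx⟩, hP ⟨x, hx⟩, fun hx0 => ?_⟩⟩
  rw [map_prod, Finset.prod_ne_zero_iff] at htF
  have := htF ⟨x, hx⟩ (Finset.mem_univ _)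
  rwa [if_pos (by exact hx0), aeval_X] at this

end resm

section GK
variable {k : Type*} [Field k] {n : ℕ}

/-- `K`-points of a subset of `GL_n`. -/
def GKs (G : Set (GL (Fin n) k)) (K : Type*) [Field K] [Algebra k K] : Set (GL (Fin n) K) :=
  {x | vec x.val ∈ ext K (pts G)}

variable {K : Type*} [Field K] [Algebra k K]

lemma resM_aeval {P : Place k K} {A : Matrix (Fin n) (Fin n) K} {a : Matrix (Fin n) (Fin n) k}
    (h : P.ResM A a) (F : MvPolynomial (Fin n × Fin n) k) :
    P.Res (aeval (vec A) F) (aeval (vec a) F) := by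
  have h' : ∀ q, P.Res (vec A q) (vec a q) := fun q => h q.1 q.2
  exact Place.Res.aeval h' F

lemma GL_res (P : Place k K) (x : GL (Fin n) K) (a : Matrix (Fin n) (Fin n) k)
    (h : P.ResM x.val a) (ha : a.det ≠ 0) :
    ∃ g : GL (Fin n) k, g.val = a ∧ P.ResM x.val g.val ∧ P.ResM (x⁻¹).val (g⁻¹).val := by
  refine ⟨Matrix.GeneralLinearGroup.mkOfDetNeZero a ha, rfl, h, ?_⟩
  rw [Matrix.coe_units_inv, Matrix.coe_units_inv]
  exact Place.ResM.inv h ha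

lemma GKs_res {G : Set (GL (Fin n) k)} (hG : Cl G) {P : Place k K} {x : GL (Fin n) K}
    (hx : x ∈ GKs G K) {g : GL (Fin n) k} (h : P.ResM x.val g.val) : g ∈ G :=
  hG g (Place.mem_ext hx fun q => h q.1 q.2)

lemma exists_place_GL [IsAlgClosed k] (x y : GL (Fin n) K) (r : K) (hr : r ≠ 0) :
    ∃ (P : Place k K) (a b : GL (Fin n) k) (rb : k), P.ResM x.val a.val ∧
      P.ResM (x⁻¹).val (a⁻¹).val ∧ P.ResM y.val b.val ∧ P.ResM (y⁻¹).val (b⁻¹).val ∧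
      P.Res r rb ∧ rb ≠ 0 := by
  obtain ⟨P, hP⟩ := exists_place_fin (k := k)
    (Set.range (vec x.val) ∪ Set.range (vec y.val) ∪ {r, x.val.det, y.val.det})
    (((Set.finite_range _).union (Set.finite_range _)).union (by simp))
  choose! f hf hf' using hP
  have hx : P.ResM x.val (x.val.map f) := fun i j => hf _ (by left; left; exact ⟨(i, j), rfl⟩)
  have hy : P.ResM y.val (y.val.map f) := fun i j => hf _ (by left; right; exact ⟨(i, j), rfl⟩)
  have dx : x.val.det ≠ 0 := by
    have := x.isUnit
    exact ((Matrix.isUnit_iff_isUnit_det _).1 this).ne_zero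
  have dy : y.val.det ≠ 0 := by
    have := y.isUnit
    exact ((Matrix.isUnit_iff_isUnit_det _).1 this).ne_zero
  have hdx : (x.val.map f).det ≠ 0 := by
    rw [hx.det.unique (hf x.val.det (by simp))]
    exact hf' _ (by simp) dx
  have hdy : (y.val.map f).det ≠ 0 := by
    rw [hy.det.unique (hf y.val.det (by simp))]
    exact hf' _ (by simp) dy
  obtain ⟨a, -, ha, ha'⟩ := GL_res P x _ hx hdx
  obtain ⟨b, -, hb, hb'⟩ := GL_res P y _ hy hdy
  exact ⟨P, a, b, f r, ha, ha', hb, hb', hf r (by simp), hf' r (by simp) hr⟩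

variable {G : Subgroup (GL (Fin n) k)}

lemma GKs_mul [IsAlgClosed k] (hG : Cl (G : Set (GL (Fin n) k))) {x y : GL (Fin n) K} (hx : x ∈ GKs (G : Set (GL (Fin n) k)) K)
    (hy : y ∈ GKs (G : Set (GL (Fin n) k)) K) : x * y ∈ GKs (G : Set (GL (Fin n) k)) K := by
  intro F hF
  by_contra hne
  obtain ⟨P, a, b, rb, ha, -, hb, -, hr, hrb⟩ := exists_place_GL (k := k) x y _ hne
  have h1 := GKs_res hG hx ha
  have h2 := GKs_res hG hy hb
  have h3 := hF _ ⟨a * b, G.mul_mem h1 h2, rfl⟩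
  have h4 : P.Res (aeval (vec (x * y).val) F) (aeval (vec (a * b).val) F) :=
    resM_aeval (ha.mul hb) F
  exact hrb ((hr.unique h4).trans h3)

lemma GKs_inv [IsAlgClosed k] (hG : Cl (G : Set (GL (Fin n) k))) {x : GL (Fin n) K} (hx : x ∈ GKs (G : Set (GL (Fin n) k)) K) :
    x⁻¹ ∈ GKs (G : Set (GL (Fin n) k)) K := by
  intro F hF
  by_contra hne
  obtain ⟨P, a, b, rb, ha, ha', hb, -, hr, hrb⟩ := exists_place_GL (k := k) x 1 _ hne
  have h1 := GKs_res hG hx ha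
  have h3 := hF _ ⟨a⁻¹, G.inv_mem h1, rfl⟩
  have h4 : P.Res (aeval (vec (x⁻¹).val) F) (aeval (vec (a⁻¹).val) F) :=
    resM_aeval ha' F
  exact hrb ((hr.unique h4).trans h3)

lemma GKs_map {g : GL (Fin n) k} (hg : g ∈ G) :
    Matrix.GeneralLinearGroup.map (algebraMap k K) g ∈ GKs (G : Set (GL (Fin n) k)) K := by
  have : vec g.val ∈ ext k (pts (G : Set (GL (Fin n) k))) := subset_ext ⟨g, hg, rfl⟩
  exact algebraMap_mem_ext this

lemma GKs_self (hG : Cl (G : Set (GL (Fin n) k))) {g : GL (Fin n) k} :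
    g ∈ GKs (G : Set (GL (Fin n) k)) k ↔ g ∈ G :=
  ⟨fun h => hG g h, fun h => subset_ext ⟨g, h, rfl⟩⟩

end GK

section rep
variable {k : Type*} [Field k] {n : ℕ} {N : Type*} [Fintype N] [DecidableEq N]
  {K : Type*} [Field K] [Algebra k K]

/-- evaluation of a polynomial representation -/
noncomputable def ev (ψ : Matrix N N (MvPolynomial (Fin n × Fin n) k))
    (A : Matrix (Fin n) (Fin n) K) : Matrix N N K := ψ.map (aeval (vec A))

lemma ev_map (ψ : Matrix N N (MvPolynomial (Fin n × Fin n) k)) (A : Matrix (Fin n) (Fin n) k) :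
    ev ψ (A.map (algebraMap k K)) = (ev ψ A).map (algebraMap k K) := by
  ext i j
  exact aeval_algebraMap_pt (vec A) (ψ i j)

lemma ev_res {P : Place k K} (ψ : Matrix N N (MvPolynomial (Fin n × Fin n) k))
    {A : Matrix (Fin n) (Fin n) K} {a : Matrix (Fin n) (Fin n) k} (h : P.ResM A a) :
    P.ResM (ev ψ A) (ev ψ a) := fun i j => resM_aeval h (ψ i j)

/-- polynomial representation of a subgroup -/
def IsRep (ψ : Matrix N N (MvPolynomial (Fin n × Fin n) k)) (G : Subgroup (GL (Fin n) k)) : Prop :=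
  ev ψ (1 : Matrix (Fin n) (Fin n) k) = 1 ∧
    ∀ g ∈ G, ∀ h ∈ G, ev ψ (g.val * h.val) = ev ψ g.val * ev ψ h.val

variable {ψ : Matrix N N (MvPolynomial (Fin n × Fin n) k)} {G : Subgroup (GL (Fin n) k)}

lemma IsRep.mulK [IsAlgClosed k] (hψ : IsRep ψ G) (hG : Cl (G : Set (GL (Fin n) k)))
    {x y : GL (Fin n) K} (hx : x ∈ GKs (G : Set (GL (Fin n) k)) K)
    (hy : y ∈ GKs (G : Set (GL (Fin n) k)) K) :
    ev ψ (x * y).val = ev ψ x.val * ev ψ y.val := by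
  ext i j
  by_contra hne
  obtain ⟨P, a, b, rb, ha, -, hb, -, hr, hrb⟩ := exists_place_GL (k := k) x y _ (sub_ne_zero.2 hne)
  have h1 := GKs_res hG hx ha
  have h2 := GKs_res hG hy hb
  have h4 := (ev_res ψ (ha.mul hb) i j).sub (((ev_res ψ ha).mul (ev_res ψ hb)) i j)
  have h5 := hr.unique h4
  rw [hψ.2 a h1 b h2, sub_self] at h5
  exact hrb h5

lemma IsRep.oneK (hψ : IsRep ψ G) : ev ψ (1 : Matrix (Fin n) (Fin n) K) = 1 := by
  have := ev_map (K := K) ψ 1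
  rw [hψ.1] at this
  simpa using this

lemma IsRep.invK [IsAlgClosed k] (hψ : IsRep ψ G) (hG : Cl (G : Set (GL (Fin n) k)))
    {x : GL (Fin n) K} (hx : x ∈ GKs (G : Set (GL (Fin n) k)) K) :
    ev ψ (x⁻¹).val * ev ψ x.val = 1 := by
  rw [← hψ.mulK hG (GKs_inv hG hx) hx, inv_mul_cancel]
  exact hψ.oneK

lemma IsRep.inv (hψ : IsRep ψ G) {x : GL (Fin n) k} (hx : x ∈ G) :
    ev ψ (x⁻¹).val * ev ψ x.val = 1 := by
  rw [← hψ.2 _ (G.inv_mem hx) _ hx, ← Units.val_mul, inv_mul_cancel]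
  exact hψ.1

lemma irr_option {ι : Type*} [Infinite k] {S : Set (ι → k)} (hS : Irr S) :
    Irr {t : Option ι → k | (fun i => t (some i)) ∈ S} := by
  obtain ⟨⟨s0, hs0⟩, hS⟩ := hS
  refine ⟨⟨fun o => o.elim 0 s0, hs0⟩, fun F₁ F₂ hF => ?_⟩
  by_contra hcon
  push Not at hcon
  obtain ⟨⟨t1, ht1, h1⟩, ⟨t2, ht2, h2⟩⟩ := hcon
  let Ψ : k → Option ι → MvPolynomial ι k := fun c o => o.elim (C c) X
  have hΨ : ∀ c (s : ι → k), pmap k (Ψ c) s = fun o => o.elim c s := by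
    intro c s; ext o
    cases o <;> simp [pmap, Ψ]
  have he : ∀ t : Option ι → k, (fun o => o.elim (t none) (fun i => t (some i))) = t := by
    intro t; ext o; cases o <;> rfl
  have : ∃ s ∈ S, aeval s (bind₁ (Ψ (t1 none)) F₁) ≠ 0 ∧ aeval s (bind₁ (Ψ (t2 none)) F₂) ≠ 0 := by
    by_contra hcon
    push Not at hcon
    rcases hS (bind₁ (Ψ (t1 none)) F₁) (bind₁ (Ψ (t2 none)) F₂) (fun s hs => by
      rw [map_mul, mul_eq_zero]
      by_cases h : aeval s (bind₁ (Ψ (t1 none)) F₁) = 0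
      · exact Or.inl h
      · exact Or.inr (hcon s hs h)) with h | h
    · have := h _ ht1
      rw [← aeval_pmap, hΨ, he] at this
      exact h1 this
    · have := h _ ht2
      rw [← aeval_pmap, hΨ, he] at this
      exact h2 this
  obtain ⟨s, hs, hs1, hs2⟩ := this
  rw [← aeval_pmap, hΨ] at hs1 hs2
  let q : Option ι → Polynomial k := fun o => o.elim Polynomial.X (fun i => Polynomial.C (s i))
  have hq : ∀ (F : MvPolynomial (Option ι) k) (c : k), (aeval q F).eval c = aeval (fun o : Option ι => o.elim c s) F := by
    intro F c
    rw [← Polynomial.coe_aeval_eq_eval]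
    rw [← AlgHom.comp_apply, comp_aeval]
    congr 2
    ext o
    cases o <;> simp [q]
  have hne : aeval q F₁ * aeval q F₂ ≠ 0 := by
    apply mul_ne_zero
    · intro h; apply hs1; rw [← hq, h]; simp
    · intro h; apply hs2; rw [← hq, h]; simp
  apply hne
  apply Polynomial.funext
  intro c
  rw [← map_mul, hq, Polynomial.eval_zero]
  exact hF _ hs

end rep

end Stein

namespace Stein
set_option linter.unusedSectionVars false
universe u v

section L
variable {k : Type u} [Field k] {n : ℕ} {N : Type*} [Fintype N] [DecidableEq N]
  {K : Type v} [Field K] [Algebra k K]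

/-- cone over an orbit -/
def orb (ψ : Matrix N N (MvPolynomial (Fin n × Fin n) k)) (G : Subgroup (GL (Fin n) k))
    (z : N → k) : Set (N → k) :=
  {v | ∃ c : k, ∃ g ∈ G, v = c • (ev ψ g.val).mulVec z}

/-- linear polynomial map -/
noncomputable def linΦ {M : Type*} (A : Matrix M N k) : M → MvPolynomial N k :=
  fun i => ∑ j, C (A i j) * X j

lemma pmap_linΦ {M : Type*} (A : Matrix M N k) (u : N → K) :
    pmap K (linΦ A) u = (A.map (algebraMap k K)).mulVec u := by
  ext i
  simp [pmap, linΦ, Matrix.mulVec, dotProduct]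

lemma pmap_linΦ_self {M : Type*} (A : Matrix M N k) (u : N → k) :
    pmap k (linΦ A) u = A.mulVec u := by
  rw [pmap_linΦ]; simp

lemma mulVec_mem_ext {M : Type*} (A : Matrix M N k) {S : Set (N → k)} {S' : Set (M → k)}
    (h : ∀ s ∈ S, A.mulVec s ∈ ext k S') {u : N → K} (hu : u ∈ ext K S) :
    (A.map (algebraMap k K)).mulVec u ∈ ext K S' := by
  rw [← pmap_linΦ]
  exact pmap_mem_ext _ (fun s hs => by rw [pmap_linΦ_self]; exact h s hs) hu

lemma mulVec_mem_ext_self {M : Type*} (A : Matrix M N k) {S : Set (N → k)} {S' : Set (M → k)}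
    (h : ∀ s ∈ S, A.mulVec s ∈ ext k S') {u : N → k} (hu : u ∈ ext k S) :
    A.mulVec u ∈ ext k S' := by
  simpa using mulVec_mem_ext A h hu

variable {ψ : Matrix N N (MvPolynomial (Fin n × Fin n) k)} {G : Subgroup (GL (Fin n) k)}

lemma orb_smul (hψ : IsRep ψ G) {z u : N → k} (hu : u ∈ orb ψ G z) {g : GL (Fin n) k} (hg : g ∈ G)
    (c : k) : (c • ev ψ g.val).mulVec u ∈ orb ψ G z := by
  obtain ⟨d, h, hh, rfl⟩ := hu
  refine ⟨c * d, g * h, G.mul_mem hg hh, ?_⟩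
  rw [Units.val_mul, hψ.2 _ hg _ hh, Matrix.smul_mulVec, Matrix.mulVec_smul, Matrix.mulVec_mulVec,
    smul_smul]

lemma mem_orb_self (hψ : IsRep ψ G) (z : N → k) : z ∈ orb ψ G z :=
  ⟨1, 1, G.one_mem, by rw [Units.val_one, hψ.1]; simp⟩

/-- If `z` is in the closure of the orbit of `u` then so is the orbit of `z`. -/
lemma orb_sub_of_mem (hψ : IsRep ψ G) {z u : N → k} (hz : z ∈ ext k (orb ψ G u)) :
    orb ψ G z ⊆ ext k (orb ψ G u) := by
  rintro _ ⟨c, g, hg, rfl⟩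
  rw [← Matrix.smul_mulVec]
  exact mulVec_mem_ext_self _ (fun s hs => subset_ext (orb_smul hψ hs hg c)) hz

/-- the parametrisation of the orbit cone -/
noncomputable def orbΦ (ψ : Matrix N N (MvPolynomial (Fin n × Fin n) k)) (z : N → k) :
    N → MvPolynomial (Option (Fin n × Fin n)) k :=
  fun i => X none * ∑ j, rename some (ψ i j) * C (z j)

lemma pmap_orbΦ (z : N → k) (t : Option (Fin n × Fin n) → K) :
    pmap K (orbΦ ψ z) t = t none •
      (ev ψ (Matrix.of fun i j => t (some (i, j)))).mulVec (fun i => algebraMap k K (z i)) := by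
  ext i
  simp only [pmap, orbΦ, map_mul, aeval_X, map_sum, aeval_rename, aeval_C, Pi.smul_apply, smul_eq_mul,
    Matrix.mulVec, dotProduct, ev, Matrix.map_apply]
  rfl

lemma orb_eq (z : N → k) : orb ψ G z = pmap k (orbΦ ψ z) ''
    {t : Option (Fin n × Fin n) → k | (fun i => t (some i)) ∈ pts (G : Set (GL (Fin n) k))} := by
  ext v
  constructor
  · rintro ⟨c, g, hg, rfl⟩
    refine ⟨fun o => o.elim c (vec g.val), ⟨g, hg, rfl⟩, ?_⟩
    rw [pmap_orbΦ]
    rfl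
  · rintro ⟨t, ⟨g, hg, hgt⟩, rfl⟩
    refine ⟨t none, g, hg, ?_⟩
    rw [pmap_orbΦ]
    have : (Matrix.of fun i j => t (some (i, j))) = g.val := by
      ext i j
      exact (congrFun hgt (i, j)).symm
    rw [this]
    rfl

theorem lemmaL [IsAlgClosed k] (hG : Cl (G : Set (GL (Fin n) k)))
    (hirr : Irr (pts (G : Set (GL (Fin n) k)))) (hψ : IsRep ψ G) (z : N → k) (hz : z ≠ 0)
    (hmin : ∀ u ∈ ext k (orb ψ G z), u ≠ 0 → z ∈ ext k (orb ψ G u))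
    [IsAlgClosed K] (P : Place k K) (u : N → K) (ub : N → k) (hu : ∀ i, P.Res (u i) (ub i))
    (hub : ub ≠ 0) (huX : u ∈ ext K (orb ψ G z)) :
    ∃ x ∈ GKs (G : Set (GL (Fin n) k)) K, ∃ g ∈ G, P.ResM x.val g.val ∧
      P.ResM (x⁻¹).val (g⁻¹).val ∧ ∃ c cb,
      P.Res c cb ∧ cb ≠ 0 ∧ u = c • (ev ψ x.val).mulVec (fun i => algebraMap k K (z i)) := by
  have hinf : Infinite k := IsAlgClosed.instInfinite
  set T := {t : Option (Fin n × Fin n) → k | (fun i => t (some i)) ∈ pts (G : Set (GL (Fin n) k))}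
    with hT
  have hTirr : Irr T := irr_option hirr
  let dt : MvPolynomial (Fin n × Fin n) k := (Matrix.of fun i j => X (i, j)).det
  have hdt : ∀ {R : Type v} [Field R] [Algebra k R] (A : Matrix (Fin n) (Fin n) R),
      aeval (vec A) dt = A.det := by
    intro R _ _ A
    simp only [dt]
    rw [AlgHom.map_det]
    congr 1
    ext i j
    simp [vec]
  have hdt' : ∀ (A : Matrix (Fin n) (Fin n) k),
      aeval (vec A) dt = A.det := by
    intro A
    simp only [dt]
    rw [AlgHom.map_det]
    congr 1
    ext i j
    simp [vec]
  obtain ⟨a, ⟨t0, ht0, ha0⟩, ha⟩ := lift_place.{u, v} hTirr (orbΦ ψ z) (X none * rename some dt) (by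
    obtain ⟨t, ht⟩ := hirr.1
    obtain ⟨g, hg, rfl⟩ := ht
    refine ⟨fun o => o.elim 1 (vec g.val), ⟨g, hg, rfl⟩, ?_⟩
    rw [map_mul, aeval_X, aeval_rename]
    refine mul_ne_zero one_ne_zero ?_
    change aeval (vec g.val) dt ≠ 0
    rw [hdt']
    exact ((Matrix.isUnit_iff_isUnit_det _).1 g.isUnit).ne_zero)
  rw [← orb_eq] at ha
  have hubX : ub ∈ ext k (orb ψ G z) := Place.mem_ext huX hu
  have hzu := hmin ub hubX hub
  -- find the translate
  have h0 : ∃ v ∈ orb ψ G ub, aeval v a ≠ 0 := by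
    by_contra hcon
    push Not at hcon
    apply ha0
    have : pmap k (orbΦ ψ z) t0 ∈ orb ψ G z := by rw [orb_eq]; exact ⟨t0, ht0, rfl⟩
    exact orb_sub_of_mem hψ hzu this a hcon
  obtain ⟨_, ⟨c0, g0, hg0, rfl⟩, hv⟩ := h0
  have hu' : ((c0 • ev ψ g0.val).map (algebraMap k K)).mulVec u ∈ ext K (orb ψ G z) :=
    mulVec_mem_ext _ (fun s hs => subset_ext (orb_smul hψ hs hg0 c0)) huX
  obtain ⟨t, tb, hres, htT, htu, hb⟩ := ha P _ ((c0 • ev ψ g0.val).mulVec ub)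
    (Place.ResM.mulVec (Place.resM_map _) hu) hu' (by rwa [Matrix.smul_mulVec])
  rw [map_mul, aeval_X, aeval_rename] at hb
  set x' : Matrix (Fin n) (Fin n) K := Matrix.of fun i j => t (some (i, j)) with hx'
  set b' : Matrix (Fin n) (Fin n) k := Matrix.of fun i j => tb (some (i, j)) with hb'
  have hdet : b'.det ≠ 0 := by
    rw [← hdt']; exact right_ne_zero_of_mul hb
  have hc : tb none ≠ 0 := left_ne_zero_of_mul hb
  have hxb : P.ResM x' b' := fun i j => hres _
  have hxdet : x'.det ≠ 0 := hxb.det.ne_zero hdet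
  let x : GL (Fin n) K := Matrix.GeneralLinearGroup.mkOfDetNeZero x' hxdet
  have hxv : x.val = x' := rfl
  have hxG : x ∈ GKs (G : Set (GL (Fin n) k)) K := by
    change vec x' ∈ ext K (pts (G : Set (GL (Fin n) k)))
    have : vec x' = pmap K (fun i => (X (some i) : MvPolynomial (Option (Fin n × Fin n)) k)) t := by
      ext q; simp [pmap, vec, hx']
    rw [this]
    refine pmap_mem_ext _ ?_ htT
    intro s hs
    have : pmap k (fun i => (X (some i) : MvPolynomial (Option (Fin n × Fin n)) k)) s = fun i => s (some i) := by ext; simp [pmap]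
    rw [this]
    exact subset_ext hs
  obtain ⟨g, hgb, hxg, hxg'⟩ := GL_res P x b' hxb hdet
  have hgG : g ∈ G := GKs_res hG hxG hxg
  rw [pmap_orbΦ, ← hx'] at htu
  have hzK : (fun i => algebraMap k K (z i)) ≠ 0 := by
    intro h
    apply hz
    ext i
    have := congrFun h i
    simpa using this
  have hc0 : c0 ≠ 0 := by
    rintro rfl
    have h1 : t none • (ev ψ x').mulVec (fun i => algebraMap k K (z i)) = 0 := by
      rw [htu, zero_smul]
      ext i
      simp [Matrix.mulVec, dotProduct]
    have h2 := (smul_eq_zero.1 h1).resolve_left ((hres none).ne_zero hc)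
    have h3 := hψ.invK hG hxG
    rw [hxv] at h3
    apply hzK
    rw [← Matrix.one_mulVec (fun i => algebraMap k K (z i)), ← h3, ← Matrix.mulVec_mulVec, h2,
      Matrix.mulVec_zero]
  let g0K := Matrix.GeneralLinearGroup.map (algebraMap k K) g0
  have hg0K : g0K ∈ GKs (G : Set (GL (Fin n) k)) K := GKs_map hg0
  have hg0v : g0K.val = g0.val.map (algebraMap k K) := rfl
  have hr1 : P.ResM g0K.val g0.val := Place.resM_map _
  have hr2 : P.ResM (g0K⁻¹).val (g0⁻¹).val := by
    have : g0K⁻¹ = Matrix.GeneralLinearGroup.map (algebraMap k K) g0⁻¹ := (map_inv _ _).symm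
    rw [this]; exact Place.resM_map _
  refine ⟨g0K⁻¹ * x, GKs_mul hG (GKs_inv hG hg0K) hxG, g0⁻¹ * g, G.mul_mem (G.inv_mem hg0) hgG,
    hr2.mul hxg, ?_, algebraMap k K c0⁻¹ * t none, c0⁻¹ * tb none,
    (Place.res_algebraMap _).mul (hres none), mul_ne_zero (inv_ne_zero hc0) hc, ?_⟩
  · rw [mul_inv_rev, mul_inv_rev, inv_inv, inv_inv]
    exact hxg'.mul hr1
  · rw [hψ.mulK hG (GKs_inv hG hg0K) hxG, ← Matrix.mulVec_mulVec, ← Matrix.mulVec_smul, mul_smul, hxv,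
      htu]
    have : ((c0 • ev ψ g0.val).map (algebraMap k K)) = algebraMap k K c0 • ev ψ g0K.val := by
      rw [hg0v, ev_map]
      ext i j
      simp
    rw [this, Matrix.smul_mulVec, smul_smul, ← map_mul, inv_mul_cancel₀ hc0, map_one, one_smul,
      Matrix.mulVec_mulVec, hψ.invK hG hg0K, Matrix.one_mulVec]

/-- minimal orbits exist in every nonzero closed stable set -/
lemma exists_min_orb (hψ : IsRep ψ G) [Nonempty N] (Y : Set (N → k)) (hY : ∃ y ∈ Y, y ≠ 0)
    (hYs : ∀ y ∈ Y, ∀ u ∈ ext k (orb ψ G y), u ∈ Y) :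
    ∃ z ∈ Y, z ≠ 0 ∧ ∀ u ∈ ext k (orb ψ G z), u ≠ 0 → z ∈ ext k (orb ψ G u) := by
  let I : (N → k) → Ideal (MvPolynomial N k) := fun u => vanishingIdeal k (orb ψ G u)
  obtain ⟨y, hy, hy0⟩ := hY
  obtain ⟨J, ⟨z, ⟨hz, hz0⟩, rfl⟩, hJ⟩ := set_has_maximal_iff_noetherian.2
    (inferInstance : IsNoetherian (MvPolynomial N k) (MvPolynomial N k))
    (I '' {u | u ∈ Y ∧ u ≠ 0}) ⟨I y, y, ⟨hy, hy0⟩, rfl⟩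
  refine ⟨z, hz, hz0, fun u hu hu0 => ?_⟩
  have hle : I z ≤ I u := by
    intro F hF
    rw [mem_vanishingIdeal_iff] at hF ⊢
    intro v hv
    exact orb_sub_of_mem hψ hu hv F hF
  have := hJ (I u) ⟨u, ⟨hYs z hz u hu, hu0⟩, rfl⟩
  have heq : I z = I u := eq_of_le_of_not_lt hle this
  intro F hF
  have hF' : F ∈ I u := by rw [mem_vanishingIdeal_iff]; exact hF
  rw [← heq, mem_vanishingIdeal_iff] at hF'
  exact hF' z (mem_orb_self hψ z)

end L
end Stein

namespace Stein
open scoped commutatorElement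
set_option linter.unusedSectionVars false

/-- an algebra of regular functions on a group -/
structure RegAlg (k Γ : Type*) [Field k] [Group Γ] where
  A : Subalgebra k (Γ → k)
  left : ∀ g, ∀ a ∈ A, (fun x => a (g * x)) ∈ A
  right : ∀ g, ∀ a ∈ A, (fun x => a (x * g)) ∈ A
  inv : ∀ a ∈ A, (fun x => a x⁻¹) ∈ A
  conj : ∀ g, ∀ a ∈ A, (fun x => a (x * g * x⁻¹)) ∈ A

section LK
variable {k Γ : Type*} [Field k] [Group Γ] (R : RegAlg k Γ)

/-- irreducibility with respect to regular functions -/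
def RegAlg.IrrOn (S : Set Γ) : Prop := ∀ a ∈ R.A, ∀ b ∈ R.A, (∀ s ∈ S, a s * b s = 0) →
  (∀ s ∈ S, a s = 0) ∨ (∀ s ∈ S, b s = 0)

variable {R}

lemma RegAlg.IrrOn.common {S : Set Γ} (hS : R.IrrOn S) {a b : Γ → k} (ha : a ∈ R.A) (hb : b ∈ R.A)
    {s t : Γ} (hs : s ∈ S) (ht : t ∈ S) (has : a s ≠ 0) (hbt : b t ≠ 0) :
    ∃ x ∈ S, a x ≠ 0 ∧ b x ≠ 0 := by
  by_contra hcon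
  push Not at hcon
  rcases hS a ha b hb (fun s hs => by
    by_cases h : a s = 0
    · rw [h, zero_mul]
    · rw [hcon s hs h, mul_zero]) with h | h
  · exact has (h s hs)
  · exact hbt (h t ht)

lemma irrOn_of_common {S : Set Γ} (h : ∀ a ∈ R.A, ∀ b ∈ R.A, ∀ s ∈ S, ∀ t ∈ S, a s ≠ 0 → b t ≠ 0 →
    ∃ x ∈ S, a x ≠ 0 ∧ b x ≠ 0) : R.IrrOn S := by
  intro a ha b hb hab
  by_contra hcon
  push Not at hcon
  obtain ⟨⟨s, hs, hsa⟩, ⟨t, ht, htb⟩⟩ := hcon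
  obtain ⟨x, hx, h1, h2⟩ := h a ha b hb s hs t ht hsa htb
  exact mul_ne_zero h1 h2 (hab x hx)

lemma irrOn_mul {S T : Set Γ} (hS : R.IrrOn S) (hT : R.IrrOn T) :
    R.IrrOn (Set.image2 (· * ·) S T) := by
  apply irrOn_of_common
  rintro a ha b hb _ ⟨s1, hs1, t1, ht1, rfl⟩ _ ⟨s2, hs2, t2, ht2, rfl⟩ h1 h2
  obtain ⟨s, hs, hsa, hsb⟩ := hS.common (R.right t1 a ha) (R.right t2 b hb) hs1 hs2 h1 h2
  obtain ⟨t, ht, hta, htb⟩ := hT.common (R.left s a ha) (R.left s b hb) ht1 ht2 hsa hsb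
  exact ⟨s * t, ⟨s, hs, t, ht, rfl⟩, hta, htb⟩

lemma irrOn_image {S : Set Γ} (hS : R.IrrOn S) (φ : Γ → Γ)
    (hφ : ∀ a ∈ R.A, (fun x => a (φ x)) ∈ R.A) : R.IrrOn (φ '' S) := by
  apply irrOn_of_common
  rintro a ha b hb _ ⟨s, hs, rfl⟩ _ ⟨t, ht, rfl⟩ h1 h2
  obtain ⟨x, hx, h⟩ := hS.common (hφ a ha) (hφ b hb) hs ht h1 h2
  exact ⟨_, ⟨x, hx, rfl⟩, h⟩

lemma irrOn_commutator {H : Subgroup Γ} (hH : R.IrrOn (H : Set Γ)) :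
    R.IrrOn ((⁅H, H⁆ : Subgroup Γ) : Set Γ) := by
  have key : ∀ d ∈ ⁅H, H⁆, ∃ S : Set Γ, R.IrrOn S ∧ 1 ∈ S ∧ S ⊆ (⁅H, H⁆ : Subgroup Γ) ∧ d ∈ S := by
    intro d hd
    rw [Subgroup.commutator_def] at hd
    induction hd using Subgroup.closure_induction with
    | mem d hd =>
      obtain ⟨b, hb, c, hc, rfl⟩ := hd
      refine ⟨(fun x => x * c * x⁻¹ * c⁻¹) '' (H : Set Γ), ?_, ⟨1, H.one_mem, by simp⟩, ?_,
        ⟨b, hb, rfl⟩⟩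
      · exact irrOn_image hH _ fun a ha => R.conj c _ (R.right c⁻¹ a ha)
      · rintro _ ⟨x, hx, rfl⟩
        exact Subgroup.commutator_mem_commutator hx hc
    | one => exact ⟨{1}, fun a _ b _ h => by simpa using h, rfl, by simp, rfl⟩
    | mul x y _ _ hx hy =>
      obtain ⟨S, h1, h2, h3, h4⟩ := hx
      obtain ⟨T, h1', h2', h3', h4'⟩ := hy
      refine ⟨_, irrOn_mul h1 h1', ⟨1, h2, 1, h2', mul_one 1⟩, ?_, ⟨x, h4, y, h4', rfl⟩⟩
      rintro _ ⟨s, hs, t, ht, rfl⟩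
      exact Subgroup.mul_mem _ (h3 hs) (h3' ht)
    | inv x _ hx =>
      obtain ⟨S, h1, h2, h3, h4⟩ := hx
      refine ⟨_, irrOn_image h1 (fun x => x⁻¹) R.inv, ⟨1, h2, inv_one⟩, ?_, ⟨x, h4, rfl⟩⟩
      rintro _ ⟨s, hs, rfl⟩
      exact Subgroup.inv_mem _ (h3 hs)
  apply irrOn_of_common
  intro a ha b hb s hs t ht h1 h2
  obtain ⟨S, hS1, hS2, hS3, hS4⟩ := key s hs
  obtain ⟨T, hT1, hT2, hT3, hT4⟩ := key t ht
  obtain ⟨x, hx, h⟩ := (irrOn_mul hS1 hT1).common ha hb (s := s) (t := t)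
    ⟨s, hS4, 1, hT2, mul_one s⟩ ⟨1, hS2, t, hT4, one_mul t⟩ h1 h2
  refine ⟨x, ?_, h⟩
  obtain ⟨s, hs, t, ht, rfl⟩ := hx
  exact Subgroup.mul_mem _ (hS3 hs) (hT3 ht)

lemma const_of_finite {S : Set Γ} (hS : R.IrrOn S) {a : Γ → k} (ha : a ∈ R.A) (E : Set k)
    (hE : E.Finite) (h : ∀ s ∈ S, a s ∈ E) (s t : Γ) (hs : s ∈ S) (ht : t ∈ S) : a s = a t := by
  classical
  have key : ∀ E : Finset k, (∀ s ∈ S, ∏ e ∈ E, (a s - e) = 0) → ∃ e, ∀ s ∈ S, a s = e := by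
    intro E
    induction E using Finset.induction_on with
    | empty => intro h; exact absurd (h s hs) (by simp)
    | insert e E he ih =>
      intro h
      have hmem : ∀ c : k, (fun x => a x - c) ∈ R.A := fun c =>
        R.A.sub_mem ha (R.A.algebraMap_mem c)
      rcases hS (fun x => a x - e) (hmem e) (fun x => ∏ e ∈ E, (a x - e)) (by
        have : (fun x => ∏ e ∈ E, (a x - e)) = ∏ e ∈ E, (fun x => a x - e) := by
          ext x; simp
        rw [this]
        exact R.A.prod_mem fun c _ => hmem c) (fun s hs => by
          have := h s hs
          rwa [Finset.prod_insert he] at this) with h' | h'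
      · exact ⟨e, fun s hs => sub_eq_zero.1 (h' s hs)⟩
      · exact ih h'
  obtain ⟨e, he⟩ := key hE.toFinset (fun s hs => Finset.prod_eq_zero
    ((hE.mem_toFinset).2 (h s hs)) (sub_self _))
  rw [he s hs, he t ht]

variable {V : Type*} [AddCommGroup V] [Module k V] [FiniteDimensional k V]
  {ρ : Representation k Γ V}

lemma reg_conj (hρ : ∀ (f : Module.Dual k V) (v : V), (fun g => f (ρ g v)) ∈ R.A)
    (f : Module.Dual k V) (L : V →ₗ[k] V) (v : V) :
    (fun h => f (ρ h⁻¹ (L (ρ h v)))) ∈ R.A := by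
  let b := Module.finBasis k V
  have : (fun h => f (ρ h⁻¹ (L (ρ h v)))) =
      ∑ i, (fun h => (b.coord i ∘ₗ L) (ρ h v)) * (fun h => f (ρ h⁻¹ (b i))) := by
    ext h
    conv_lhs => rw [← b.sum_repr (L (ρ h v)), map_sum, map_sum]
    simp
  rw [this]
  exact R.A.sum_mem fun i _ => R.A.mul_mem (hρ _ _) (R.inv _ (hρ f (b i)))

lemma lk_step {H : Subgroup Γ} (hH : R.IrrOn (H : Set Γ)) {W : Submodule k V}
    (hWH : ∀ h ∈ H, ∀ w ∈ W, ρ h w ∈ W)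
    (hWmin : ∀ W' ≤ W, (∀ h ∈ H, ∀ w ∈ W', ρ h w ∈ W') → W' ≠ ⊥ → W' = W)
    {v : V} (hv : v ∈ W) (hv0 : v ≠ 0) (c : Γ) (a : Γ → k) (ha : a ∈ R.A)
    (h : ∀ h ∈ H, ρ c (ρ h v) = a h • ρ h v) : ∀ w ∈ W, ρ c w = a 1 • w := by
  have hne : ∀ h, ρ h v ≠ 0 := by
    intro h h0
    apply hv0
    have : ρ h⁻¹ (ρ h v) = v := by simp
    rw [← this, h0, map_zero]
  have hconst : ∀ h ∈ H, a h = a 1 := fun x hx =>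
    const_of_finite hH ha {μ | Module.End.HasEigenvalue (ρ c) μ}
      (Module.End.finite_hasEigenvalue (ρ c)) (fun s hs =>
        Module.End.hasEigenvalue_of_hasEigenvector (x := ρ s v)
          ⟨Module.End.mem_eigenspace_iff.2 (h s hs), hne s⟩) x 1 hx H.one_mem
  let W' := Submodule.span k ((fun h => ρ h v) '' (H : Set Γ))
  have hW' : W' = W := by
    apply hWmin
    · rw [Submodule.span_le]
      rintro _ ⟨h, hh, rfl⟩
      exact hWH h hh v hv
    · intro g hg w hw
      have : Submodule.map (ρ g) W' ≤ W' := by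
        rw [Submodule.map_span, Submodule.span_le]
        rintro _ ⟨_, ⟨h, hh, rfl⟩, rfl⟩
        refine Submodule.subset_span ⟨g * h, H.mul_mem hg hh, ?_⟩
        simp
      exact this ⟨w, hw, rfl⟩
    · intro h0
      apply hv0
      have : v ∈ W' := Submodule.subset_span ⟨1, H.one_mem, by simp⟩
      rw [h0] at this
      exact (Submodule.mem_bot k).1 this
  have hle : W ≤ LinearMap.ker (ρ c - a 1 • LinearMap.id) := by
    rw [← hW', Submodule.span_le]
    rintro _ ⟨x, hx, rfl⟩
    simp only [SetLike.mem_coe, LinearMap.mem_ker, LinearMap.sub_apply, LinearMap.smul_apply,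
      LinearMap.id_apply]
    rw [h x hx, hconst x hx, sub_self]
  intro w hw
  have := hle hw
  simpa [sub_eq_zero] using this

/-- iterated derived subgroups -/
def Dn (H : Subgroup Γ) : ℕ → Subgroup Γ
  | 0 => H
  | m + 1 => Dn ⁅H, H⁆ m

/-- Lie-Kolchin -/
lemma lie_kolchin_aux [IsAlgClosed k]
    (hρ : ∀ (f : Module.Dual k V) (v : V), (fun g => f (ρ g v)) ∈ R.A) (m : ℕ) :
    ∀ (H : Subgroup Γ), R.IrrOn (H : Set Γ) → Dn H m = ⊥ → ∀ W : Submodule k V, W ≠ ⊥ →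
    (∀ h ∈ H, ∀ w ∈ W, ρ h w ∈ W) → ∃ w ∈ W, w ≠ 0 ∧ ∀ h ∈ H, ∃ c : k, ρ h w = c • w := by
  induction m with
  | zero =>
    intro H _ hD W hW _
    obtain ⟨w, hw, hw0⟩ := (Submodule.ne_bot_iff W).1 hW
    refine ⟨w, hw, hw0, fun h hh => ⟨1, ?_⟩⟩
    have : h ∈ (⊥ : Subgroup Γ) := by rw [← hD]; exact hh
    rw [Subgroup.mem_bot.1 this]
    simp
  | succ m ih =>
    intro H hH hD W₀ hW₀ hW₀H
    -- choose a minimal stable subspace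
    obtain ⟨W, ⟨hWle, hW0, hWH⟩, hWmin'⟩ := (wellFounded_lt : WellFounded
      ((· < ·) : Submodule k V → Submodule k V → Prop)).has_min
      {W | W ≤ W₀ ∧ W ≠ ⊥ ∧ ∀ h ∈ H, ∀ w ∈ W, ρ h w ∈ W} ⟨W₀, le_rfl, hW₀, hW₀H⟩
    have hWmin : ∀ W' ≤ W, (∀ h ∈ H, ∀ w ∈ W', ρ h w ∈ W') → W' ≠ ⊥ → W' = W := by
      intro W' hle hs h0
      exact eq_of_le_of_not_lt hle (hWmin' W' ⟨hle.trans hWle, h0, hs⟩)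
    have hDH : ⁅H, H⁆ ≤ H := Subgroup.commutator_le_self H
    obtain ⟨w, hw, hw0, hwD⟩ := ih ⁅H, H⁆ (irrOn_commutator hH) hD W hW0
      (fun h hh => hWH h (hDH hh))
    -- functional with f w = 1
    obtain ⟨f, hf⟩ : ∃ f : Module.Dual k V, f w = 1 := Module.Projective.exists_dual_eq_one k hw0
    have hχ : ∀ d ∈ ⁅H, H⁆, ρ d w = f (ρ d w) • w := by
      intro d hd
      obtain ⟨c, hc⟩ := hwD d hd
      rw [hc]; simp [hf]
    have hDscal : ∀ d ∈ ⁅H, H⁆, ∀ v ∈ W, ρ d v = f (ρ d w) • v := by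
      intro d hd
      have := lk_step hH hWH hWmin hw hw0 d (fun h => f (ρ h⁻¹ (ρ d (ρ h w))))
        (reg_conj hρ f (ρ d) w) (by
          intro h hh
          have hd' : h⁻¹ * d * h ∈ ⁅H, H⁆ := by
            have : h⁻¹ * d * h = ⁅h⁻¹, d⁆ * d := by rw [commutatorElement_def]; group
            rw [this]
            exact Subgroup.mul_mem _ (Subgroup.commutator_mem_commutator (H.inv_mem hh) (hDH hd)) hd
          have h1 := hχ _ hd'
          have h2 : ρ (h⁻¹ * d * h) w = ρ h⁻¹ (ρ d (ρ h w)) := by simp [map_mul]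
          rw [h2] at h1
          have h3 := congrArg (ρ h) h1
          rw [map_smul] at h3
          simpa using h3)
      simpa using this
    have hscal : ∀ c ∈ H, ∃ μ : k, ∀ v ∈ W, ρ c v = μ • v := by
      intro c hc
      have : Nontrivial W := Submodule.nontrivial_iff_ne_bot.2 hW0
      obtain ⟨μ, hμ⟩ := Module.End.exists_eigenvalue ((ρ c).restrict (hWH c hc))
      obtain ⟨v, hv⟩ := hμ.exists_hasEigenvector
      have hv1 : ρ c v = μ • (v : V) := by
        have := congrArg Subtype.val hv.apply_eq_smul
        simpa using this
      have hv0 : (v : V) ≠ 0 := by simpa using hv.2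
      have hreg : (fun h => μ * (f ∘ₗ ρ c⁻¹) (ρ h⁻¹ (ρ c (ρ h w)))) ∈ R.A :=
        R.A.smul_mem (reg_conj hρ (f ∘ₗ ρ c⁻¹) (ρ c) w) μ
      have := lk_step hH hWH hWmin v.2 hv0 c _ hreg (by
        intro b hb
        have hd : c⁻¹ * b⁻¹ * c * b ∈ ⁅H, H⁆ := by
          have : c⁻¹ * b⁻¹ * c * b = ⁅c⁻¹, b⁻¹⁆ := by rw [commutatorElement_def]; group
          rw [this]
          exact Subgroup.commutator_mem_commutator (H.inv_mem hc) (H.inv_mem hb)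
        have h1 := hDscal _ hd v v.2
        have h2 : ρ c (ρ b v) = ρ b (ρ c (ρ (c⁻¹ * b⁻¹ * c * b) v)) := by
          simp only [map_mul, Module.End.mul_apply, Representation.self_inv_apply]
        have h4 : (f ∘ₗ ρ c⁻¹) (ρ b⁻¹ (ρ c (ρ b w))) = f (ρ (c⁻¹ * b⁻¹ * c * b) w) := by
          simp [map_mul]
        rw [h2, h1, map_smul, map_smul, hv1, map_smul, smul_smul, h4, mul_comm])
      exact ⟨_, this⟩
    exact ⟨w, hWle hw, hw0, fun h hh => by
      obtain ⟨μ, hμ⟩ := hscal h hh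
      exact ⟨μ, hμ w hw⟩⟩

lemma Dn_derived (m j : ℕ) : Dn (derivedSeries Γ j) m = derivedSeries Γ (j + m) := by
  induction m generalizing j with
  | zero => rfl
  | succ m ih =>
    have := ih (j + 1)
    rw [derivedSeries_succ] at this
    rw [Dn, this]
    congr 1
    omega

lemma lie_kolchin [IsAlgClosed k] [Group.IsSolvable Γ] (hΓ : R.IrrOn Set.univ)
    (hρ : ∀ (f : Module.Dual k V) (v : V), (fun g => f (ρ g v)) ∈ R.A) (hV : Nontrivial V) :
    ∃ w : V, w ≠ 0 ∧ ∀ h, ∃ c : k, ρ h w = c • w := by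
  obtain ⟨m, hm⟩ := Group.IsSolvable.solvable (G := Γ)
  have h := Dn_derived (Γ := Γ) m 0
  rw [zero_add, hm, derivedSeries_zero] at h
  obtain ⟨w, -, hw, hw'⟩ := lie_kolchin_aux hρ m ⊤ (by simpa using hΓ) h ⊤ (by simp) (by simp)
  exact ⟨w, hw, fun h => hw' h (by simp)⟩

lemma smul_mem_ext [IsAlgClosed k] {K : Type*} [Field K] [Algebra k K] {N : Type*} [Finite N]
    {C : Set (N → k)} (hC : ext k C ⊆ C) (hs : ∀ u ∈ C, ∀ c : k, c • u ∈ C) {u : N → K}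
    (hu : u ∈ ext K C) (s : K) : s • u ∈ ext K C := by
  intro F hF
  by_contra hne
  obtain ⟨P, hP⟩ := exists_place_fin (k := k) (Set.range u ∪ {s, aeval (s • u) F})
    ((Set.finite_range _).union (by simp))
  choose! f hf hf' using hP
  have hub : ∀ i, P.Res (u i) (f (u i)) := fun i => hf _ (Or.inl ⟨i, rfl⟩)
  have h1 : (fun i => f (u i)) ∈ C := hC (Place.mem_ext hu hub)
  have h2 := hF _ (hs _ h1 (f s))
  have h3 : ∀ i, P.Res ((s • u) i) ((f s • fun i => f (u i)) i) := fun i =>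
    (hf s (by simp)).mul (hub i)
  have h4 := Place.Res.aeval h3 F
  rw [h2] at h4
  exact hf' _ (by simp) hne ((hf _ (by simp)).unique h4)

/-- linear form as a polynomial -/
noncomputable def linF {N : Type*} [Fintype N] [DecidableEq N] (f : Module.Dual k (N → k)) :
    MvPolynomial N k := ∑ i, MvPolynomial.C (f (Pi.single i 1)) * MvPolynomial.X i

lemma aeval_linF {N : Type*} [Fintype N] [DecidableEq N] (f : Module.Dual k (N → k)) (s : N → k) :
    aeval s (linF f) = f s := by
  conv_rhs => rw [LinearMap.pi_apply_eq_sum_univ f s]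
  simp only [linF, map_sum, map_mul, aeval_X, aeval_C, smul_eq_mul]
  refine Finset.sum_congr rfl fun i _ => ?_
  rw [mul_comm]
  congr 1
  have : (Pi.single i 1 : N → k) = fun j => if i = j then 1 else 0 := by
    funext j
    simp [Pi.single_apply, eq_comm]
  rw [this]
  rfl

lemma irr_orbit {N : Type*} [Fintype N] [DecidableEq N] {ρ : Representation k Γ (N → k)}
    (hΓ : R.IrrOn Set.univ)
    (hρ : ∀ (f : Module.Dual k (N → k)) (v : N → k), (fun g => f (ρ g v)) ∈ R.A) (u : N → k) :
    Irr (Set.range fun g => ρ g u) := by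
  have hreg : ∀ F : MvPolynomial N k, (fun g => aeval (ρ g u) F) ∈ R.A := by
    intro F
    induction F using MvPolynomial.induction_on with
    | C a =>
      simp only [aeval_C]
      exact R.A.algebraMap_mem a
    | add p q hp hq =>
      simp only [map_add]
      exact R.A.add_mem hp hq
    | mul_X p i hp =>
      simp only [map_mul, aeval_X]
      exact R.A.mul_mem hp (hρ (LinearMap.proj i) u)
  refine ⟨Set.range_nonempty _, fun F₁ F₂ h => ?_⟩
  rcases hΓ _ (hreg F₁) _ (hreg F₂) (fun g _ => by
    have := h _ ⟨g, rfl⟩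
    rwa [map_mul] at this) with h | h
  · left; rintro _ ⟨g, rfl⟩; exact h g trivial
  · right; rintro _ ⟨g, rfl⟩; exact h g trivial

/-- Borel fixed point theorem for closed cones -/
theorem borel_fixed [IsAlgClosed k] [Group.IsSolvable Γ] (hΓ : R.IrrOn Set.univ)
    {N : Type*} [Fintype N] [DecidableEq N] {ρ : Representation k Γ (N → k)}
    (hρ : ∀ (f : Module.Dual k (N → k)) (v : N → k), (fun g => f (ρ g v)) ∈ R.A)
    (C : Set (N → k)) (hC : ext k C ⊆ C) (hs : ∀ u ∈ C, ∀ c : k, c • u ∈ C)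
    (hCΓ : ∀ g, ∀ u ∈ C, ρ g u ∈ C) (hne : ∃ u ∈ C, u ≠ 0) :
    ∃ z ∈ C, z ≠ 0 ∧ ∀ g, ∃ c : k, ρ g z = c • z := by
  obtain ⟨W, ⟨hW, u, huC, huW, hu0⟩, hWmin⟩ := (wellFounded_lt : WellFounded
      ((· < ·) : Submodule k (N → k) → Submodule k (N → k) → Prop)).has_min
      {W | (∀ g, W ≤ W.comap (ρ g)) ∧ ∃ u ∈ C, u ∈ W ∧ u ≠ 0}
      ⟨⊤, by simp, by simpa using hne⟩
  let σ := ρ.subrepresentation W hW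
  have hσ : ∀ (f : Module.Dual k W) (v : W), (fun g => f (σ g v)) ∈ R.A := by
    intro f v
    obtain ⟨f', hf'⟩ := LinearMap.exists_extend f
    have : (fun g => f (σ g v)) = fun g => f' (ρ g v) := by
      ext g
      rw [← hf']
      rfl
    rw [this]
    exact hρ f' v
  have hσd : ∀ (f : Module.Dual k (Module.Dual k W)) (v : Module.Dual k W),
      (fun g => f (σ.dual g v)) ∈ R.A := by
    intro φ f
    obtain ⟨v, rfl⟩ := (Module.evalEquiv k W).surjective φ
    exact R.inv _ (hσ f v)
  have hnt : Nontrivial W := ⟨⟨u, huW⟩, 0, fun h => hu0 (by simpa using congrArg Subtype.val h)⟩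
  obtain ⟨f, hf0, hf⟩ := lie_kolchin hΓ hσd inferInstance
  have hfσ : ∀ g, ∃ c : k, ∀ w, f (σ g w) = c * f w := by
    intro g
    obtain ⟨c, hc⟩ := hf g⁻¹
    refine ⟨c, fun w => ?_⟩
    have := LinearMap.congr_fun hc w
    rw [Representation.dual_apply, inv_inv] at this
    exact this
  let W' : Submodule k (N → k) := (LinearMap.ker f).map W.subtype
  have hW'lt : W' < W := by
    refine lt_of_le_of_ne (Submodule.map_subtype_le _ _) fun heq => hf0 ?_
    ext w
    have : (w : N → k) ∈ W' := by rw [heq]; exact w.2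
    obtain ⟨w', hw', h⟩ := this
    rw [Subtype.ext h] at hw'
    exact hw'
  have hW's : ∀ g, W' ≤ W'.comap (ρ g) := by
    rintro g _ ⟨w, hw, rfl⟩
    refine ⟨σ g w, ?_, rfl⟩
    obtain ⟨c, hc⟩ := hfσ g
    have hw : f w = 0 := hw
    simp [hc, hw]
  have hfne : ∀ v (hv : v ∈ W), v ∈ C → v ≠ 0 → f ⟨v, hv⟩ ≠ 0 := by
    intro v hv hvC hv0 h0
    exact hWmin W' ⟨hW's, v, hvC, ⟨⟨v, hv⟩, h0, rfl⟩, hv0⟩ hW'lt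
  obtain ⟨f', hf'⟩ := LinearMap.exists_extend f
  have hf'' : ∀ w : W, f' w = f w := fun w => by rw [← hf']; rfl
  refine ⟨u, huC, hu0, fun b => ?_⟩
  obtain ⟨χ, hχ⟩ := hfσ b
  refine ⟨χ, ?_⟩
  -- generic point of the orbit
  have hirr := irr_orbit hΓ hρ u
  obtain ⟨K, _, _, _, τ, hτ⟩ := exists_generic hirr
  have hTC : ∀ g, ρ g u ∈ C := fun g => hCΓ g u huC
  have hTW : ∀ g, ρ g u ∈ W := fun g => hW g huW
  have hτf : aeval τ (linF f') ≠ 0 := by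
    intro h
    have := (hτ _).1 h _ ⟨1, rfl⟩
    rw [aeval_linF] at this
    simp only [map_one, Module.End.one_apply] at this
    exact hfne u huW huC hu0 (by rw [← hf'']; exact this)
  have hτ0 : τ ≠ 0 := by
    rintro rfl
    apply hτf
    simp [linF]
  have hτC : τ ∈ ext K C := fun F hF => (hτ F).2 (by rintro _ ⟨g, rfl⟩; exact hF _ (hTC g))
  have hτW : ∀ (P : Place k K) (s : K) (ub : N → k), (∀ i, P.Res (s * τ i) (ub i)) → ub ∈ W := by
    intro P s ub hub
    have hWK : s • τ ∈ ext K (W : Set (N → k)) := by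
      refine smul_mem_ext ?_ (fun u hu c => W.smul_mem c hu) ?_ s
      · intro v hv
        by_contra hvW
        obtain ⟨φ, hφ, hφW⟩ := Submodule.exists_le_ker_of_notMem hvW
        have := hv (linF φ) (fun s hs => by rw [aeval_linF]; exact hφW hs)
        rw [aeval_linF] at this
        exact hφ this
      · exact fun F hF => (hτ F).2 (by rintro _ ⟨g, rfl⟩; exact hF _ (hTW g))
    exact (by
      have h5 := Place.mem_ext hWK hub
      by_contra hvW
      obtain ⟨φ, hφ, hφW⟩ := Submodule.exists_le_ker_of_notMem hvW
      have := h5 (linF φ) (fun s hs => by rw [aeval_linF]; exact hφW hs)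
      rw [aeval_linF] at this
      exact hφ this)
  have hlin : ∀ (φ : Module.Dual k (N → k)) (s : K), aeval (s • τ) (linF φ) =
      s * aeval τ (linF φ) := by
    intro φ s
    simp only [linF, map_sum, map_mul, aeval_X, aeval_C, Pi.smul_apply, smul_eq_mul, Finset.mul_sum]
    refine Finset.sum_congr rfl fun i _ => by ring
  have hconst : ∀ φ : Module.Dual k (N → k), ∃ c : k, ∀ g, φ (ρ g u) = c * f' (ρ g u) := by
    intro φ
    obtain ⟨c, hc⟩ := const_of_bounded (k := k) (aeval τ (linF φ) / aeval τ (linF f')) (by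
      intro P
      obtain ⟨s, ub, hs0, hub, hub0⟩ := P.exists_scale τ hτ0
      have hubC : ub ∈ C := hC (Place.mem_ext (smul_mem_ext hC hs hτC s) hub)
      have hubW := hτW P s ub hub
      have h1 := Place.Res.aeval (x := s • τ) hub (linF φ)
      have h2 := Place.Res.aeval (x := s • τ) hub (linF f')
      rw [hlin, aeval_linF] at h1 h2
      have hne : f' ub ≠ 0 := by
        rw [hf'' ⟨ub, hubW⟩]
        exact hfne ub hubW hubC hub0
      have h3 := h1.mul (h2.inv hne)
      rw [mul_inv, mul_mul_mul_comm, mul_inv_cancel₀ hs0, one_mul, ← div_eq_mul_inv] at h3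
      exact ⟨_, h3⟩)
    refine ⟨c, fun g => ?_⟩
    have h1 : aeval τ (linF φ - MvPolynomial.C c * linF f') = 0 := by
      rw [map_sub, map_mul, aeval_C, hc, div_mul_cancel₀ _ hτf, sub_self]
    have := (hτ _).1 h1 _ ⟨g, rfl⟩
    rw [map_sub, map_mul, aeval_linF, aeval_linF, aeval_C, sub_eq_zero] at this
    exact this
  have hφ : ∀ φ : Module.Dual k (N → k), φ (ρ b u) = φ (χ • u) := by
    intro φ
    obtain ⟨c, hc⟩ := hconst φ
    have h1 := hc 1
    simp only [map_one, Module.End.one_apply] at h1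
    have h2 : f' (ρ b u) = χ * f' u := by
      have h3 := hχ ⟨u, huW⟩
      rw [← hf'', ← hf''] at h3
      exact h3
    rw [hc b, h2, map_smul, h1, smul_eq_mul]
    ring
  ext i
  exact hφ (LinearMap.proj i)

end LK
end Stein

namespace Stein
open scoped commutatorElement
set_option linter.unusedSectionVars false

section regB
variable {k : Type*} [Field k] {n : ℕ} (B : Subgroup (GL (Fin n) k))

/-- entry functions -/
def ent (i j : Fin n) : B → k := fun b => b.1.val i j

/-- entry functions of the inverse -/
def enti (i j : Fin n) : B → k := fun b => (b⁻¹).1.val i j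

/-- regular functions on `B` -/
noncomputable def regA : Subalgebra k (B → k) :=
  Algebra.adjoin k ({a | ∃ i j, a = ent B i j} ∪ {a | ∃ i j, a = enti B i j})

lemma ent_mem (i j : Fin n) : (fun b : B => b.1.val i j) ∈ regA B :=
  Algebra.subset_adjoin (Or.inl ⟨i, j, rfl⟩)

lemma enti_mem (i j : Fin n) : (fun b : B => (b⁻¹).1.val i j) ∈ regA B :=
  Algebra.subset_adjoin (Or.inr ⟨i, j, rfl⟩)

lemma regA_comp (φ : B → B) (h1 : ∀ i j, (fun b => (φ b).1.val i j) ∈ regA B)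
    (h2 : ∀ i j, (fun b => ((φ b)⁻¹).1.val i j) ∈ regA B) :
    ∀ a ∈ regA B, (fun b => a (φ b)) ∈ regA B := by
  intro a ha
  induction ha using Algebra.adjoin_induction with
  | mem a ha =>
    rcases ha with ⟨i, j, rfl⟩ | ⟨i, j, rfl⟩
    · exact h1 i j
    · exact h2 i j
  | algebraMap r => exact (regA B).algebraMap_mem r
  | add x y _ _ hx hy => exact (regA B).add_mem hx hy
  | mul x y _ _ hx hy => exact (regA B).mul_mem hx hy

lemma regA_sum {ι : Type*} (s : Finset ι) (f : ι → B → k) (h : ∀ i ∈ s, f i ∈ regA B) :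
    (fun b => ∑ i ∈ s, f i b) ∈ regA B := by
  have := (regA B).sum_mem h
  convert this using 1
  ext b; simp

lemma const_mem (c : k) : (fun _ : B => c) ∈ regA B := (regA B).algebraMap_mem c

lemma mulc_mem (c : k) {f : B → k} (hf : f ∈ regA B) : (fun b : B => c * f b) ∈ regA B :=
  (regA B).mul_mem (const_mem B c) hf

lemma cmul_mem (c : k) {f : B → k} (hf : f ∈ regA B) : (fun b : B => f b * c) ∈ regA B :=
  (regA B).mul_mem hf (const_mem B c)

/-- the algebra of regular functions -/
noncomputable def regB : RegAlg k B where
  A := regA B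
  left g := regA_comp B (fun b => g * b)
    (fun i j => by
      simp only [Subgroup.coe_mul, Units.val_mul, Matrix.mul_apply]
      exact regA_sum B _ _ fun l _ => mulc_mem B _ (ent_mem B l j))
    (fun i j => by
      simp only [mul_inv_rev, Subgroup.coe_mul, Units.val_mul, Matrix.mul_apply]
      exact regA_sum B _ _ fun l _ => cmul_mem B _ (enti_mem B i l))
  right g := regA_comp B (fun b => b * g)
    (fun i j => by
      simp only [Subgroup.coe_mul, Units.val_mul, Matrix.mul_apply]
      exact regA_sum B _ _ fun l _ => cmul_mem B _ (ent_mem B i l))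
    (fun i j => by
      simp only [mul_inv_rev, Subgroup.coe_mul, Units.val_mul, Matrix.mul_apply]
      exact regA_sum B _ _ fun l _ => mulc_mem B _ (enti_mem B l j))
  inv := regA_comp B (fun b => b⁻¹) (fun i j => enti_mem B i j)
    (fun i j => by simp only [inv_inv]; exact ent_mem B i j)
  conj g := regA_comp B (fun b => b * g * b⁻¹)
    (fun i j => by
      simp only [Subgroup.coe_mul, Units.val_mul, Matrix.mul_apply]
      exact regA_sum B _ _ fun l _ => (regA B).mul_mem
        (regA_sum B _ _ fun l' _ => cmul_mem B _ (ent_mem B i l')) (enti_mem B l j))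
    (fun i j => by
      simp only [mul_inv_rev, inv_inv, Subgroup.coe_mul, Units.val_mul, Matrix.mul_apply]
      exact regA_sum B _ _ fun l _ => (regA B).mul_mem (ent_mem B i l)
        (regA_sum B _ _ fun l' _ => mulc_mem B _ (enti_mem B l' j)))

lemma poly_mem (F : MvPolynomial (Fin n × Fin n) k) :
    (fun b : B => aeval (vec b.1.val) F) ∈ regA B := by
  induction F using MvPolynomial.induction_on with
  | C a =>
    simp only [aeval_C]
    exact (regA B).algebraMap_mem a
  | add p q hp hq =>
    simp only [map_add]
    exact (regA B).add_mem hp hq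
  | mul_X p i hp =>
    simp only [map_mul, aeval_X]
    exact (regA B).mul_mem hp (ent_mem B i.1 i.2)

lemma aeval_det (A : Matrix (Fin n) (Fin n) k) :
    aeval (vec A) (Matrix.det (Matrix.mvPolynomialX (Fin n) (Fin n) k)) = A.det := by
  rw [AlgHom.map_det]
  congr 1
  ext i j
  simp [Matrix.mvPolynomialX, vec]

lemma regA_poly (a : B → k) (ha : a ∈ regA B) :
    ∃ (m : ℕ) (q : MvPolynomial (Fin n × Fin n) k), ∀ b : B,
      aeval (vec b.1.val) q = b.1.val.det ^ m * a b := by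
  induction ha using Algebra.adjoin_induction with
  | mem a ha =>
    rcases ha with ⟨i, j, rfl⟩ | ⟨i, j, rfl⟩
    · exact ⟨0, X (i, j), fun b => by rw [aeval_X, pow_zero, one_mul]; rfl⟩
    · refine ⟨1, (Matrix.mvPolynomialX (Fin n) (Fin n) k).adjugate i j, fun b => ?_⟩
      have h1 : aeval (vec b.1.val) ((Matrix.mvPolynomialX (Fin n) (Fin n) k).adjugate i j) =
          b.1.val.adjugate i j := by
        have h2 := AlgHom.map_adjugate (aeval (vec b.1.val) : MvPolynomial (Fin n × Fin n) k →ₐ[k] k)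
          (Matrix.mvPolynomialX (Fin n) (Fin n) k)
        have h3 : (aeval (vec b.1.val) : MvPolynomial (Fin n × Fin n) k →ₐ[k] k).mapMatrix
          (Matrix.mvPolynomialX (Fin n) (Fin n) k) = b.1.val := by
          ext i j
          simp [Matrix.mvPolynomialX, vec]
        rw [h3] at h2
        exact congrFun (congrFun h2 i) j
      have hd : b.1.val.det ≠ 0 := ((Matrix.isUnit_iff_isUnit_det _).1 b.1.isUnit).ne_zero
      rw [h1, pow_one]
      simp only [enti, Subgroup.coe_inv]
      rw [Matrix.coe_units_inv, Matrix.inv_def]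
      simp only [Matrix.smul_apply, smul_eq_mul, Ring.inverse_eq_inv']
      rw [mul_inv_cancel_left₀ hd]
  | algebraMap r => exact ⟨0, C r, fun b => by rw [aeval_C, pow_zero, one_mul]; rfl⟩
  | add x y _ _ hx hy =>
    obtain ⟨m1, q1, h1⟩ := hx
    obtain ⟨m2, q2, h2⟩ := hy
    refine ⟨m1 + m2, (Matrix.det (Matrix.mvPolynomialX (Fin n) (Fin n) k)) ^ m2 * q1 +
      (Matrix.det (Matrix.mvPolynomialX (Fin n) (Fin n) k)) ^ m1 * q2, fun b => ?_⟩
    rw [map_add, map_mul, map_mul, map_pow, map_pow, aeval_det, h1, h2, Pi.add_apply]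
    ring
  | mul x y _ _ hx hy =>
    obtain ⟨m1, q1, h1⟩ := hx
    obtain ⟨m2, q2, h2⟩ := hy
    refine ⟨m1 + m2, q1 * q2, fun b => ?_⟩
    rw [map_mul, h1, h2, Pi.mul_apply]
    ring

lemma regB_irr (hB : Irr (pts (B : Set (GL (Fin n) k)))) : (regB B).IrrOn Set.univ := by
  intro a ha b hb hab
  obtain ⟨m1, q1, h1⟩ := regA_poly B a ha
  obtain ⟨m2, q2, h2⟩ := regA_poly B b hb
  have hd : ∀ x : B, x.1.val.det ≠ 0 := fun x =>
    ((Matrix.isUnit_iff_isUnit_det _).1 x.1.isUnit).ne_zero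
  rcases hB.2 q1 q2 (by
    rintro _ ⟨g, hg, rfl⟩
    have := hab ⟨g, hg⟩ trivial
    change aeval (vec g.val) (q1 * q2) = 0
    rw [map_mul, h1 ⟨g, hg⟩, h2 ⟨g, hg⟩, mul_mul_mul_comm, this, mul_zero]) with h | h
  · left
    intro s _
    have := h _ ⟨s.1, s.2, rfl⟩
    have h3 := (h1 s).symm.trans this
    exact (mul_eq_zero.1 h3).resolve_left (pow_ne_zero _ (hd s))
  · right
    intro s _
    have := h _ ⟨s.1, s.2, rfl⟩
    have h3 := (h2 s).symm.trans this
    exact (mul_eq_zero.1 h3).resolve_left (pow_ne_zero _ (hd s))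

end regB

section nonsolv
variable {k : Type*} [Field k] {n : ℕ} (G : Subgroup (GL (Fin n) k))

/-- action of `G` on vectors -/
def act (g : G) (v : Fin n → k) : Fin n → k := g.1.val.mulVec v

lemma act_mul (g h : G) (v : Fin n → k) : act G (g * h) v = act G g (act G h v) := by
  simp [act, Matrix.mulVec_mulVec]

lemma act_one (v : Fin n → k) : act G 1 v = v := by simp [act]

lemma act_add (g : G) (v w : Fin n → k) : act G g (v + w) = act G g v + act G g w := by
  simp [act, Matrix.mulVec_add]

lemma act_sub (g : G) (v w : Fin n → k) : act G g (v - w) = act G g v - act G g w := by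
  simp [act, Matrix.mulVec_sub]

lemma act_smul (g : G) (c : k) (v : Fin n → k) : act G g (c • v) = c • act G g v := by
  simp [act, Matrix.mulVec_smul]

lemma act_inv (g : G) (v : Fin n → k) : act G g⁻¹ (act G g v) = v := by
  rw [← act_mul, inv_mul_cancel, act_one]

lemma act_inv' (g : G) (v : Fin n → k) : act G g (act G g⁻¹ v) = v := by
  rw [← act_mul, mul_inv_cancel, act_one]

lemma triv_ext (W L : Submodule k (Fin n → k)) (hW : ∀ g, ∀ v ∈ W, act G g v ∈ W)
    (hL : ∀ g, ∀ v ∈ L, act G g v ∈ L) (hWL : W ≤ L) (v : Fin n → k)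
    (hv : ∀ u ∈ L, ∃ c : k, ∃ w ∈ W, u = c • v + w) (hvL : v ∈ L)
    (m : ℕ) (hm : ∀ d ∈ derivedSeries G m, ∀ v ∈ W, act G d v = v) :
    ∀ d ∈ derivedSeries G (m + 2), ∀ v ∈ L, act G d v = v := by
  let K1 : Subgroup G :=
    { carrier := {g | ∀ u ∈ L, act G g u - u ∈ W}
      one_mem' := fun u _ => by rw [act_one, sub_self]; exact W.zero_mem
      mul_mem' := fun {g h} hg hh u hu => by
        have : act G (g * h) u - u = act G g (act G h u - u) + (act G g u - u) := by
          rw [act_mul, act_sub]; abel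
        rw [this]
        exact W.add_mem (hW g _ (hh u hu)) (hg u hu)
      inv_mem' := fun {g} hg u hu => by
        have : act G g⁻¹ u - u = - act G g⁻¹ (act G g u - u) := by
          rw [act_sub, act_inv]; abel
        rw [this]
        exact W.neg_mem (hW _ _ (hg u hu)) }
  let K2 : Subgroup G :=
    { carrier := {g | ∀ u ∈ L, act G g u = u}
      one_mem' := fun u _ => act_one G u
      mul_mem' := fun {g h} hg hh u hu => by
        rw [act_mul, hh u hu, hg u hu]
      inv_mem' := fun {g} hg u hu => by
        conv_lhs => rw [← hg u hu, act_inv] }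
  have hcomm : ∀ g h : G, ∀ u, act G ⁅g, h⁆ (act G (h * g) u) = act G (g * h) u := by
    intro g h u
    rw [← act_mul]; congr 1; rw [commutatorElement_def]; group
  have h1 : derivedSeries G (m + 1) ≤ K1 := by
    rw [derivedSeries_succ, Subgroup.commutator_le]
    intro g hg h hh u hu
    have key : ∀ u ∈ L, act G (g * h) u - act G (h * g) u ∈ W := by
      intro u hu
      obtain ⟨c, w, hw, rfl⟩ := hv u hu
      obtain ⟨a, w1, hw1, ha⟩ := hv _ (hL g v hvL)
      obtain ⟨b, w2, hw2, hb⟩ := hv _ (hL h v hvL)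
      have : act G (g * h) (c • v + w) - act G (h * g) (c • v + w) =
        c • (a • 0 + b • w1 + act G g w2 - (a • w2 + act G h w1)) +
          (act G (g * h) w - act G (h * g) w) := by
        simp only [act_mul, act_add, act_smul, ha, hb]
        module
      rw [this]
      refine W.add_mem (W.smul_mem _ (W.sub_mem (W.add_mem (W.add_mem ?_ ?_) ?_) (W.add_mem ?_ ?_)))
        (W.sub_mem (hW _ _ hw) (hW _ _ hw))
      · rw [smul_zero]; exact W.zero_mem
      · exact W.smul_mem _ hw1
      · exact hW _ _ hw2
      · exact W.smul_mem _ hw2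
      · exact hW _ _ hw1
    have h2 := key (act G (h * g)⁻¹ u) (hL _ _ hu)
    rwa [← hcomm, act_inv'] at h2
  have h2 : derivedSeries G (m + 2) ≤ K2 := by
    rw [show m + 2 = (m + 1) + 1 from rfl, derivedSeries_succ, Subgroup.commutator_le]
    intro g hg h hh u hu
    have key : ∀ u ∈ L, act G (g * h) u = act G (h * g) u := by
      intro u hu
      have e1 : ∀ g ∈ derivedSeries G (m + 1), ∀ w ∈ W, act G g w = w := fun g hg =>
        hm g (derivedSeries_antitone _ (Nat.le_succ m) hg)
      have a1 := e1 g hg _ (h1 hh u hu)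
      have a2 := e1 h hh _ (h1 hg u hu)
      rw [act_sub] at a1 a2
      rw [act_mul, act_mul]
      rw [sub_eq_iff_eq_add] at a1 a2
      rw [a1, a2]; abel
    have h2 := key (act G (h * g)⁻¹ u) (hL _ _ hu)
    rw [← hcomm, act_inv'] at h2
    exact h2
  exact fun d hd => h2 hd

lemma exists_quot (hG : ¬ Group.IsSolvable G) : ∃ W : Submodule k (Fin n → k), W ≠ ⊤ ∧
    (∀ g, ∀ v ∈ W, act G g v ∈ W) ∧
    ∀ v ∉ W, ¬ ∀ g, ∃ c : k, act G g v - c • v ∈ W := by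
  obtain ⟨W, ⟨hW, m, hm⟩, hmax⟩ := (wellFounded_gt : WellFounded
      ((· > ·) : Submodule k (Fin n → k) → Submodule k (Fin n → k) → Prop)).has_min
      {W | (∀ g, ∀ v ∈ W, act G g v ∈ W) ∧ ∃ m, ∀ d ∈ derivedSeries G m, ∀ v ∈ W, act G d v = v}
      ⟨⊥, fun g v hv => by
        rw [Submodule.mem_bot] at hv; subst hv; simp [act], 0, fun d _ v hv => by
        rw [Submodule.mem_bot] at hv; subst hv; simp [act]⟩
  refine ⟨W, ?_, hW, ?_⟩
  · rintro rfl
    apply hG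
    refine ⟨m, (Subgroup.eq_bot_iff_forall _).2 fun d hd => ?_⟩
    apply Subtype.ext
    apply Units.ext
    have : d.1.val = 1 := by
      apply Matrix.ext_of_mulVec_single
      intro i
      rw [Matrix.one_mulVec]
      exact hm d hd _ trivial
    exact this
  · intro v hv hcon
    have hdesc : ∀ u ∈ W ⊔ Submodule.span k {v}, ∃ c : k, ∃ w ∈ W, u = c • v + w := by
      intro u hu
      obtain ⟨w, hw, y, hy, rfl⟩ := Submodule.mem_sup.1 hu
      obtain ⟨c, rfl⟩ := Submodule.mem_span_singleton.1 hy
      exact ⟨c, w, hw, add_comm _ _⟩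
    have hvL : v ∈ W ⊔ Submodule.span k {v} :=
      Submodule.mem_sup_right (Submodule.mem_span_singleton_self v)
    have hL : ∀ g, ∀ u ∈ W ⊔ Submodule.span k {v}, act G g u ∈ W ⊔ Submodule.span k {v} := by
      intro g u hu
      obtain ⟨c, w, hw, rfl⟩ := hdesc u hu
      obtain ⟨a, ha⟩ := hcon g
      rw [act_add, act_smul]
      refine Submodule.add_mem _ (Submodule.smul_mem _ _ ?_) (Submodule.mem_sup_left (hW g w hw))
      rw [← sub_add_cancel (act G g v) (a • v)]
      exact Submodule.add_mem _ (Submodule.mem_sup_left ha) (Submodule.smul_mem _ _ hvL)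
    refine hmax (W ⊔ Submodule.span k {v}) ⟨hL, m + 2,
      triv_ext G W _ hW hL le_sup_left v hdesc hvL m hm⟩ ?_
    exact lt_of_le_of_ne le_sup_left fun h => hv (by rw [h]; exact hvL)

lemma exists_rep (hG : ¬ Group.IsSolvable G) : ∃ (N : ℕ) (_ : Nonempty (Fin N))
    (ψ : Matrix (Fin N) (Fin N) (MvPolynomial (Fin n × Fin n) k)), IsRep ψ G ∧
      ∀ z : Fin N → k, z ≠ 0 → ¬ ∀ g ∈ G, ∃ c : k, (ev ψ g.val).mulVec z = c • z := by
  obtain ⟨W, hWt, hW, hline⟩ := exists_quot G hG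
  let e := (Module.finBasis k ((Fin n → k) ⧸ W)).equivFun
  have hnt : Nontrivial ((Fin n → k) ⧸ W) := Submodule.Quotient.nontrivial_iff.2 hWt
  let N := Module.finrank k ((Fin n → k) ⧸ W)
  let ql : (Fin n → k) →ₗ[k] (Fin N → k) := e.toLinearMap ∘ₗ W.mkQ
  have hql : Function.Surjective ql := e.surjective.comp W.mkQ_surjective
  have hker : ∀ v, ql v = 0 ↔ v ∈ W := by
    intro v
    simp [ql]
  obtain ⟨sl, hsl⟩ := ql.exists_rightInverse_of_surjective (LinearMap.range_eq_top.2 hql)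
  let q := LinearMap.toMatrix' ql
  let s := LinearMap.toMatrix' sl
  have hq : ∀ v, q.mulVec v = ql v := fun v => LinearMap.toMatrix'_mulVec ql v
  have hs : ∀ v, s.mulVec v = sl v := fun v => LinearMap.toMatrix'_mulVec sl v
  have hqs : ∀ v, ql (sl v) = v := fun v => LinearMap.congr_fun hsl v
  let ψ : Matrix (Fin N) (Fin N) (MvPolynomial (Fin n × Fin n) k) :=
    (q.map C : Matrix (Fin N) (Fin n) (MvPolynomial (Fin n × Fin n) k)) *
      Matrix.mvPolynomialX (Fin n) (Fin n) k *
      (s.map C : Matrix (Fin n) (Fin N) (MvPolynomial (Fin n × Fin n) k))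
  have hψ : ∀ A : Matrix (Fin n) (Fin n) k, ev ψ A = q * A * s := by
    intro A
    ext i j
    simp only [ev, ψ, Matrix.map_apply, Matrix.mul_apply, map_sum, map_mul, aeval_C,
      Matrix.mvPolynomialX_apply, aeval_X]
    rfl
  have hψv : ∀ (A : Matrix (Fin n) (Fin n) k) v, (ev ψ A).mulVec v = ql (A.mulVec (sl v)) := by
    intro A v
    rw [hψ, ← Matrix.mulVec_mulVec, ← Matrix.mulVec_mulVec, hs, hq]
  refine ⟨N, ⟨⟨0, Module.finrank_pos⟩⟩, ψ, ⟨?_, ?_⟩, ?_⟩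
  · apply Matrix.ext_of_mulVec_single
    intro i
    rw [hψv, Matrix.one_mulVec, Matrix.one_mulVec, hqs]
  · intro g hg h hh
    apply Matrix.ext_of_mulVec_single
    intro i
    rw [← Matrix.mulVec_mulVec, hψv, hψv, hψv, ← Matrix.mulVec_mulVec]
    set x := h.val.mulVec (sl (Pi.single i 1))
    rw [← sub_eq_zero, ← map_sub, hker, ← Matrix.mulVec_sub]
    refine hW ⟨g, hg⟩ _ ?_
    rw [← hker, map_sub, hqs, sub_self]
  · intro z hz hcon
    refine hline (sl z) (fun h => hz ?_) fun g => ?_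
    · rw [← hqs z]; exact (hker _).2 h
    · obtain ⟨c, hc⟩ := hcon g.1 g.2
      refine ⟨c, ?_⟩
      rw [hψv] at hc
      rw [← hker, map_sub, map_smul, hqs, act, hc, sub_self]

end nonsolv

end Stein

namespace Stein
set_option linter.unusedSectionVars false
universe u v

section iwa
variable {k : Type u} [Field k] {n : ℕ}

/-- maximal closed irreducible solvable subgroup -/
def IsBor (B G : Subgroup (GL (Fin n) k)) : Prop :=
  B ≤ G ∧ Cl (B : Set (GL (Fin n) k)) ∧ Irr (pts (B : Set (GL (Fin n) k))) ∧ Group.IsSolvable B ∧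
    ∀ B' : Subgroup (GL (Fin n) k), B' ≤ G → Cl (B' : Set (GL (Fin n) k)) →
      Irr (pts (B' : Set (GL (Fin n) k))) → Group.IsSolvable B' → B ≤ B' → B' = B

def Par {N R : Type*} [CommRing R] (v z : N → R) : Prop := ∀ i j, v i * z j = v j * z i

lemma par_iff {N : Type*} {v z : N → k} (hz : z ≠ 0) : Par v z ↔ ∃ c : k, v = c • z := by
  constructor
  · intro h
    obtain ⟨j, hj⟩ := Function.ne_iff.1 hz
    refine ⟨v j / z j, funext fun i => ?_⟩
    have := h i j
    simp only [Pi.smul_apply, smul_eq_mul, Pi.zero_apply] at *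
    field_simp
    exact this
  · rintro ⟨c, rfl⟩ i j
    simp only [Pi.smul_apply, smul_eq_mul]; ring

variable {N : Type*} [Fintype N] [DecidableEq N]
  {ψ : Matrix N N (MvPolynomial (Fin n × Fin n) k)} {G : Subgroup (GL (Fin n) k)}
  {K : Type v} [Field K] [Algebra k K]

/-- stabiliser of a line -/
def stab (hψ : IsRep ψ G) (z : N → k) : Subgroup (GL (Fin n) k) where
  carrier := {g | g ∈ G ∧ ∃ c : k, (ev ψ g.val).mulVec z = c • z}
  one_mem' := ⟨G.one_mem, 1, by rw [Units.val_one, hψ.1]; simp⟩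
  mul_mem' := by
    rintro g h ⟨hg, c, hc⟩ ⟨hh, d, hd⟩
    refine ⟨G.mul_mem hg hh, c * d, ?_⟩
    rw [Units.val_mul, hψ.2 g hg h hh, ← Matrix.mulVec_mulVec, hd, Matrix.mulVec_smul, hc, smul_smul,
      mul_comm]
  inv_mem' := by
    rintro g ⟨hg, c, hc⟩
    refine ⟨G.inv_mem hg, c⁻¹, ?_⟩
    have h1 : (ev ψ (g⁻¹).val).mulVec ((ev ψ g.val).mulVec z) = z := by
      rw [Matrix.mulVec_mulVec, hψ.inv hg, Matrix.one_mulVec]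
    rw [hc, Matrix.mulVec_smul] at h1
    by_cases h0 : c = 0
    · rw [h0, zero_smul] at h1
      rw [← h1]; simp
    · conv_rhs => rw [← h1]
      rw [smul_smul, inv_mul_cancel₀ h0, one_smul]

lemma mem_stab {hψ : IsRep ψ G} {z : N → k} {g : GL (Fin n) k} :
    g ∈ stab hψ z ↔ g ∈ G ∧ ∃ c : k, (ev ψ g.val).mulVec z = c • z := Iff.rfl

/-- polynomial entries of `g z` -/
noncomputable def colP (ψ : Matrix N N (MvPolynomial (Fin n × Fin n) k)) (z : N → k) (i : N) :
    MvPolynomial (Fin n × Fin n) k := ∑ j, ψ i j * C (z j)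

lemma aeval_colP (z : N → k) (i : N) (A : Matrix (Fin n) (Fin n) K) :
    aeval (vec A) (colP ψ z i) = (ev ψ A).mulVec (fun j => algebraMap k K (z j)) i := by
  simp only [colP, map_sum, map_mul, aeval_C]
  rfl

lemma aeval_colP_self (z : N → k) (i : N) (A : Matrix (Fin n) (Fin n) k) :
    aeval (vec A) (colP ψ z i) = (ev ψ A).mulVec z i := aeval_colP z i A

lemma stab_cl (hG : Cl (G : Set (GL (Fin n) k))) (hψ : IsRep ψ G) {z : N → k} (hz : z ≠ 0) :
    Cl (stab hψ z : Set (GL (Fin n) k)) := by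
  intro g hg
  have hgG : g ∈ G := hG g (ext_mono (by
    rintro _ ⟨h, hh, rfl⟩
    exact subset_ext ⟨h, hh.1, rfl⟩) hg)
  refine ⟨hgG, (par_iff hz).1 fun i j => ?_⟩
  have := hg (colP ψ z i * C (z j) - colP ψ z j * C (z i)) (by
    rintro _ ⟨h, hh, rfl⟩
    have := (par_iff hz).2 hh.2 i j
    rw [map_sub, map_mul, map_mul, aeval_C, aeval_C]
    rw [aeval_colP_self, aeval_colP_self, sub_eq_zero]
    exact this)
  rw [map_sub, map_mul, map_mul, aeval_C, aeval_C, aeval_colP_self, aeval_colP_self,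
    sub_eq_zero] at this
  exact this

lemma stab_K [IsAlgClosed k] (hG : Cl (G : Set (GL (Fin n) k))) (hψ : IsRep ψ G) {z : N → k} (hz : z ≠ 0)
    {x : GL (Fin n) K} (hx : x ∈ GKs (G : Set (GL (Fin n) k)) K)
    (h : Par ((ev ψ x.val).mulVec fun i => algebraMap k K (z i)) (fun i => algebraMap k K (z i))) :
    x ∈ GKs (stab hψ z : Set (GL (Fin n) k)) K := by
  intro F hF
  by_contra hne
  obtain ⟨P, a, b, rb, ha, -, hb, -, hr, hrb⟩ := exists_place_GL (k := k) x 1 _ hne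
  have h1 := GKs_res hG hx ha
  have hz' : ∀ i, P.Res (algebraMap k K (z i)) (z i) := fun i => Place.res_algebraMap _
  have hpar : Par ((ev ψ a.val).mulVec z) z := by
    intro i j
    have e1 := ((ev_res ψ ha).mulVec hz' i).mul (hz' j)
    have e2 := ((ev_res ψ ha).mulVec hz' j).mul (hz' i)
    rw [h i j] at e1
    exact e1.unique e2
  have h3 := hF _ ⟨a, ⟨h1, (par_iff hz).1 hpar⟩, rfl⟩
  exact hrb ((hr.unique (resM_aeval ha F)).trans h3)

lemma ext_ext {S : Set (N → k)} : ext K (ext k S) ⊆ ext K S := ext_mono subset_rfl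

lemma ext_orb_act (hψ : IsRep ψ G) {z u : N → k} (hu : u ∈ ext k (orb ψ G z)) {g : GL (Fin n) k}
    (hg : g ∈ G) (c : k) : c • (ev ψ g.val).mulVec u ∈ ext k (orb ψ G z) := by
  rw [← Matrix.smul_mulVec]
  exact mulVec_mem_ext_self _ (fun s hs => subset_ext (orb_smul hψ hs hg c)) hu

lemma ext_orb_smul (hψ : IsRep ψ G) {z u : N → k} (hu : u ∈ ext k (orb ψ G z)) (c : k) :
    c • u ∈ ext k (orb ψ G z) := by
  have := ext_orb_act hψ hu G.one_mem c
  rwa [Units.val_one, hψ.1, Matrix.one_mulVec] at this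

lemma orb_K [IsAlgClosed k] (hψ : IsRep ψ G) {z : N → k} {x : GL (Fin n) K}
    (hx : x ∈ GKs (G : Set (GL (Fin n) k)) K) (s : K) :
    s • (ev ψ x.val).mulVec (fun i => algebraMap k K (z i)) ∈ ext K (orb ψ G z) := by
  have h := pmap_mem_ext (K := K) (S := pts (G : Set (GL (Fin n) k))) (S' := orb ψ G z) (colP ψ z)
    (by
      rintro _ ⟨g, hg, rfl⟩
      refine subset_ext ⟨1, g, hg, ?_⟩
      rw [one_smul]
      exact funext fun i => aeval_colP_self z i g.val) hx
  have e : pmap K (colP ψ z) (vec x.val) = (ev ψ x.val).mulVec (fun i => algebraMap k K (z i)) :=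
    funext fun i => aeval_colP z i x.val
  rw [e] at h
  have hC : ext k (ext k (orb ψ G z)) ⊆ ext k (orb ψ G z) := ext_ext
  exact ext_ext (smul_mem_ext hC (fun u hu c => ext_orb_smul hψ hu c)
    (ext_mono (fun s hs => subset_ext (subset_ext hs)) h) s)

lemma min_of_mem (hψ : IsRep ψ G) {z0 z : N → k} (hz : z ∈ ext k (orb ψ G z0))
    (hmin : ∀ u ∈ ext k (orb ψ G z0), u ≠ 0 → z0 ∈ ext k (orb ψ G u)) :
    ∀ u ∈ ext k (orb ψ G z), u ≠ 0 → z ∈ ext k (orb ψ G u) := by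
  intro u hu hu0
  have h1 : u ∈ ext k (orb ψ G z0) := ext_mono (orb_sub_of_mem hψ hz) hu
  exact ext_mono (orb_sub_of_mem hψ (hmin u h1 hu0)) hz

/-- representation of a subgroup -/
noncomputable def repB (hψ : IsRep ψ G) (B : Subgroup (GL (Fin n) k)) (hB : B ≤ G) :
    Representation k B (N → k) where
  toFun b := (ev ψ b.1.val).mulVecLin
  map_one' := by
    ext1 v
    change (ev ψ (1 : Matrix (Fin n) (Fin n) k)).mulVecLin ∘ₗ _ = _
    rw [hψ.1]; simp; rfl
  map_mul' a b := by
    change (ev ψ (a.1.val * b.1.val)).mulVecLin = _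
    rw [hψ.2 _ (hB a.2) _ (hB b.2), Matrix.mulVecLin_mul]
    rfl

lemma repB_apply (hψ : IsRep ψ G) (B : Subgroup (GL (Fin n) k)) (hB : B ≤ G) (b : B) (v : N → k) :
    repB hψ B hB b v = (ev ψ b.1.val).mulVec v := rfl

lemma repB_reg (hψ : IsRep ψ G) (B : Subgroup (GL (Fin n) k)) (hB : B ≤ G)
    (f : Module.Dual k (N → k)) (v : N → k) : (fun g => f (repB hψ B hB g v)) ∈ (regB B).A := by
  have : (fun g => f (repB hψ B hB g v)) = fun b : B => aeval (vec b.1.val)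
      (∑ i, C (f (Pi.single i 1)) * colP ψ v i) := by
    ext b
    rw [repB_apply, ← aeval_linF, linF, map_sum, map_sum]
    refine Finset.sum_congr rfl fun i _ => ?_
    rw [map_mul, map_mul, aeval_X, aeval_colP_self, aeval_C, aeval_C]
  rw [this]
  exact poly_mem B _

lemma ext_biUnion {ι τ : Type*} {s : Set τ} (hs : s.Finite) (S : τ → Set (ι → k)) :
    ext K (⋃ c ∈ s, S c) ⊆ ⋃ c ∈ s, ext K (S c) := by
  induction s, hs using Set.Finite.induction_on with
  | empty =>
    intro u hu
    have := hu 1 (by simp)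
    simp at this
  | insert ha hs ih =>
    intro u hu
    rw [Set.biUnion_insert] at hu ⊢
    rcases ext_union hu with h | h
    · exact Or.inl h
    · exact Or.inr (ih h)

/-- integral elements -/
def Integral (P : Place k K) (G : Subgroup (GL (Fin n) k)) (y : GL (Fin n) K) : Prop :=
  y ∈ GKs (G : Set (GL (Fin n) k)) K ∧ ∃ g ∈ G, P.ResM y.val g.val ∧ P.ResM (y⁻¹).val (g⁻¹).val

lemma Integral.mul [IsAlgClosed k] (hG : Cl (G : Set (GL (Fin n) k))) {P : Place k K}
    {x y : GL (Fin n) K} (hx : Integral P G x) (hy : Integral P G y) : Integral P G (x * y) := by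
  obtain ⟨hx, a, ha, h1, h2⟩ := hx
  obtain ⟨hy, b, hb, h3, h4⟩ := hy
  refine ⟨GKs_mul hG hx hy, a * b, G.mul_mem ha hb, h1.mul h3, ?_⟩
  rw [mul_inv_rev, mul_inv_rev]
  exact h4.mul h2

lemma Integral.mono {P : Place k K} {G' : Subgroup (GL (Fin n) k)} (h : G' ≤ G)
    {x : GL (Fin n) K} (hx : Integral P G' x) : Integral P G x := by
  obtain ⟨hx, a, ha, h1⟩ := hx
  refine ⟨ext_mono (fun s hs => ?_) hx, a, h ha, h1⟩
  obtain ⟨g, hg, rfl⟩ := hs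
  exact subset_ext ⟨g, h hg, rfl⟩

lemma Integral.const (P : Place k K) {g : GL (Fin n) k} (hg : g ∈ G) :
    Integral P G (Matrix.GeneralLinearGroup.map (algebraMap k K) g) := by
  refine ⟨GKs_map hg, g, hg, Place.resM_map _, ?_⟩
  rw [← map_inv]
  exact Place.resM_map _

theorem iwasawa [IsAlgClosed k] [IsAlgClosed K] (P : Place k K) (B : Subgroup (GL (Fin n) k)) :
    ∀ G : Subgroup (GL (Fin n) k), Cl (G : Set (GL (Fin n) k)) →
      Irr (pts (G : Set (GL (Fin n) k))) → IsBor B G →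
      ∀ x ∈ GKs (G : Set (GL (Fin n) k)) K, ∃ y, Integral P G y ∧
        ∃ b ∈ GKs (B : Set (GL (Fin n) k)) K, x = y * b := by
  intro G
  induction hI : vanishingIdeal k (pts (G : Set (GL (Fin n) k))) using
    (wellFounded_gt (α := Ideal (MvPolynomial (Fin n × Fin n) k))).induction generalizing G with
  | _ I ih =>
  subst hI
  intro hG hirr hB x hx
  by_cases hsol : Group.IsSolvable G
  · have := hB.2.2.2.2 G le_rfl hG hirr hsol hB.1
    subst this
    refine ⟨1, ?_, x, hx, by simp⟩
    have := Integral.const (G := G) P G.one_mem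
    rwa [map_one] at this
  obtain ⟨N, hN, ψ, hψ, hline⟩ := exists_rep G hsol
  obtain ⟨z0, -, hz0, hmin0⟩ := exists_min_orb hψ Set.univ
    ⟨fun _ => 1, trivial, fun h => one_ne_zero (congrFun h hN.some)⟩ (fun _ _ _ _ => trivial)
  obtain ⟨hBG, hBcl, hBirr, hBsol, hBmax⟩ := hB
  obtain ⟨z, hzX, hz, hzB⟩ := borel_fixed (regB_irr B hBirr) (repB_reg hψ B hBG)
    (ext k (orb ψ G z0)) ext_ext (fun u hu c => ext_orb_smul hψ hu c)
    (fun g u hu => by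
      have := ext_orb_act hψ hu (hBG g.2) 1
      rwa [one_smul] at this) ⟨z0, subset_ext (mem_orb_self hψ z0), hz0⟩
  have hmin := min_of_mem hψ hzX hmin0
  obtain ⟨Q, hQle, hQcl, hQirr, ⟨s, hsfin, hsP, hs⟩, hQmax, -⟩ :=
    exists_comp (stab hψ z) (stab_cl hG hψ hz)
  have hQG : Q ≤ G := hQle.trans fun g hg => hg.1
  have hBQ : B ≤ Q := hQmax B (fun b hb => ⟨hBG hb, hzB ⟨b, hb⟩⟩) B.one_mem hBirr
  have hlt : vanishingIdeal k (pts (Q : Set (GL (Fin n) k))) >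
      vanishingIdeal k (pts (G : Set (GL (Fin n) k))) := by
    refine lt_of_le_of_ne ?_ fun heq => ?_
    · intro p hp
      rw [mem_vanishingIdeal_iff] at hp ⊢
      rintro _ ⟨g, hg, rfl⟩
      exact hp _ ⟨g, hQG hg, rfl⟩
    · refine hline z hz fun g hg => ?_
      have : g ∈ Q := hQcl g fun F hF => by
        have : F ∈ vanishingIdeal k (pts (Q : Set (GL (Fin n) k))) := by
          rw [mem_vanishingIdeal_iff]; exact hF
        rw [← heq, mem_vanishingIdeal_iff] at this
        exact this _ ⟨g, hg, rfl⟩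
      exact (hQle this).2
  have hQB : IsBor B Q := ⟨hBQ, hBcl, hBirr, hBsol, fun B' h => hBmax B' (h.trans hQG)⟩
  -- the vector
  have hzK : (fun i => algebraMap k K (z i)) ≠ 0 := fun h => hz (funext fun i => by
    have := congrFun h i
    simpa using this)
  have hu0 : (ev ψ x.val).mulVec (fun i => algebraMap k K (z i)) ≠ 0 := fun h => hzK (by
    have h2 := congrArg (ev ψ (x⁻¹).val).mulVec h
    rwa [Matrix.mulVec_mulVec, hψ.invK hG hx, Matrix.one_mulVec, Matrix.mulVec_zero] at h2)
  obtain ⟨t, ub, ht, htu, hub⟩ := P.exists_scale _ hu0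
  obtain ⟨y, hy, g, hg, hyg, hyg', c, cb, hc, hcb, heq⟩ := lemmaL hG hirr hψ z hz hmin P
    (t • (ev ψ x.val).mulVec (fun i => algebraMap k K (z i))) ub htu hub (orb_K hψ hx t)
  have hyI : Integral P G y := ⟨hy, g, hg, hyg, hyg'⟩
  have hp := GKs_mul hG (GKs_inv hG hy) hx
  have hpz : (ev ψ (y⁻¹ * x).val).mulVec (fun i => algebraMap k K (z i)) =
      (t⁻¹ * c) • fun i => algebraMap k K (z i) := by
    rw [hψ.mulK hG (GKs_inv hG hy) hx, ← Matrix.mulVec_mulVec]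
    have h2 : (ev ψ x.val).mulVec (fun i => algebraMap k K (z i)) =
        (t⁻¹ * c) • (ev ψ y.val).mulVec (fun i => algebraMap k K (z i)) := by
      rw [mul_smul, ← heq, smul_smul, inv_mul_cancel₀ ht, one_smul]
    rw [h2, Matrix.mulVec_smul, Matrix.mulVec_mulVec, hψ.invK hG hy, Matrix.one_mulVec]
  have hpS := stab_K hG hψ hz hp ((par_iff hzK).2 ⟨_, hpz⟩)
  have hcov : pts (stab hψ z : Set (GL (Fin n) k)) ⊆
      ⋃ c ∈ s, pts ((fun q => c * q) '' (Q : Set (GL (Fin n) k))) := by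
    rintro _ ⟨p, hp, rfl⟩
    obtain ⟨c, hc, h⟩ := hs p hp
    exact Set.mem_biUnion hc ⟨p, ⟨_, h, by simp⟩, rfl⟩
  have h3 := ext_biUnion (K := K) hsfin _ (ext_mono (fun s hs => subset_ext (hcov hs)) hpS)
  simp only [Set.mem_iUnion] at h3
  obtain ⟨d, hd, h3⟩ := h3
  have hdG : d ∈ G := (hsP hd).1
  have h4 : (Matrix.GeneralLinearGroup.map (algebraMap k K) d)⁻¹ * (y⁻¹ * x) ∈
      GKs (Q : Set (GL (Fin n) k)) K := by
    have h5 := pmap_mem_ext (S' := pts (Q : Set (GL (Fin n) k))) (mulΦ (d⁻¹).val 1) (by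
      rintro _ ⟨_, ⟨q, hq, rfl⟩, rfl⟩
      refine subset_ext ⟨q, hq, ?_⟩
      change vec q.val = pmap k (mulΦ (d⁻¹).val 1) (vec (d * q).val)
      rw [pmap_mulΦ_self, mul_one, ← Units.val_mul, inv_mul_cancel_left]) h3
    rw [pmap_mulΦ] at h5
    rw [← map_inv]
    rw [show ((1 : Matrix (Fin n) (Fin n) k).map (algebraMap k K)) = 1 by simp, mul_one] at h5
    exact h5
  obtain ⟨y', hy', b, hb, heq'⟩ := ih _ hlt Q rfl hQcl hQirr hQB _ h4
  refine ⟨y * Matrix.GeneralLinearGroup.map (algebraMap k K) d * y',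
    ((hyI.mul hG (Integral.const P hdG)).mul hG (hy'.mono hQG)), b, hb, ?_⟩
  rw [mul_assoc _ y' b, ← heq']
  group

end iwa

end Stein

namespace Stein
open scoped Kronecker
set_option linter.unusedSectionVars false

section tn
variable {R : Type*} [CommRing R] {ι : Type*} [Fintype ι] [DecidableEq ι]

/-- tensor power of a matrix -/
def Tn (D : ℕ) (A : Matrix ι ι R) : Matrix (Fin D → ι) (Fin D → ι) R :=
  Matrix.of fun I J => ∏ a, A (I a) (J a)

lemma Tn_mul (D : ℕ) (A B : Matrix ι ι R) : Tn D (A * B) = Tn D A * Tn D B := by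
  ext I J
  simp only [Tn, Matrix.of_apply, Matrix.mul_apply]
  rw [Finset.prod_univ_sum, Fintype.piFinset_univ]
  exact Finset.sum_congr rfl fun L _ => Finset.prod_mul_distrib

lemma Tn_one (D : ℕ) : Tn D (1 : Matrix ι ι R) = 1 := by
  ext I J
  simp only [Tn, Matrix.of_apply, Matrix.one_apply]
  split_ifs with h
  · subst h; simp
  · obtain ⟨a, ha⟩ := Function.ne_iff.1 h
    exact Finset.prod_eq_zero (Finset.mem_univ a) (if_neg ha)

lemma Tn_map {S : Type*} [CommRing S] (f : R →+* S) (D : ℕ) (A : Matrix ι ι R) :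
    (Tn D A).map f = Tn D (A.map f) := by
  ext I J
  simp [Tn]

/-- Plücker coordinates -/
def plu {d : ℕ} (M : Matrix ι (Fin d) R) : (Fin d → ι) → R := fun I => (M.submatrix I id).det

lemma det_expand {d : ℕ} {τ : Type*} (A : Matrix τ ι R) (M : Matrix ι (Fin d) R) (I : Fin d → τ) :
    ((A * M).submatrix I id).det = ∑ J : Fin d → ι, (∏ a, A (I a) (J a)) * plu M J := by
  have h1 : (A * M).submatrix I id = fun a => ∑ j, A (I a) j • M j := by
    ext a b
    simp [Matrix.mul_apply]
  rw [h1]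
  have h2 := (Matrix.detRowAlternating (n := Fin d) (R := R)).toMultilinearMap.map_sum
    (fun a j => A (I a) j • M j)
  change (Matrix.detRowAlternating (n := Fin d) (R := R)) _ = _ at h2
  refine (h2.trans ?_)
  refine Finset.sum_congr rfl fun J _ => ?_
  have h3 := (Matrix.detRowAlternating (n := Fin d) (R := R)).toMultilinearMap.map_smul_univ
    (fun a => A (I a) (J a)) (fun a => M (J a))
  exact h3

lemma Tn_plu {d : ℕ} (A : Matrix ι ι R) (M : Matrix ι (Fin d) R) :
    (Tn d A).mulVec (plu M) = plu (A * M) := by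
  ext I
  rw [plu, det_expand]
  rfl

lemma plu_mul {d : ℕ} (M : Matrix ι (Fin d) R) (Q : Matrix (Fin d) (Fin d) R) :
    plu (M * Q) = Q.det • plu M := by
  ext I
  have : (M * Q).submatrix I id = M.submatrix I id * Q := by
    ext a b; simp [Matrix.mul_apply]
  simp only [plu, Pi.smul_apply, smul_eq_mul]
  rw [this, Matrix.det_mul, mul_comm]

lemma plu_recover {d : ℕ} (M : Matrix ι (Fin d) R) (I : Fin d → ι) (j : ι) (b : Fin d) :
    (M * (M.submatrix I id).adjugate) j b = plu M (Function.update I b j) := by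
  have h1 : M.submatrix (Function.update I b j) id = (M.submatrix I id).updateRow b (M j) := by
    ext a c
    by_cases h : a = b
    · subst h; simp
    · simp [h, Function.update_of_ne]
  rw [plu, h1, ← Matrix.cramer_transpose_apply, Matrix.cramer_eq_adjugate_mulVec,
    ← Matrix.adjugate_transpose, Matrix.mulVec_transpose]
  simp [Matrix.mul_apply, Matrix.vecMul, dotProduct]

end tn

section plf
variable {k : Type*} [Field k] {ι : Type*} [Fintype ι] [DecidableEq ι]

lemma plu_ne_zero {d : ℕ} (M : Matrix ι (Fin d) k) (L : Matrix (Fin d) ι k) (h : L * M = 1) :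
    plu M ≠ 0 := by
  intro h0
  have := det_expand L M id
  rw [h, h0] at this
  simp at this

lemma plu_eq {d : ℕ} (M M1 : Matrix ι (Fin d) k) (h0 : plu M ≠ 0) (c : k) (hc : c ≠ 0)
    (h : plu M1 = c • plu M) : ∃ Q : Matrix (Fin d) (Fin d) k, M1 = M * Q := by
  obtain ⟨I, hI⟩ := Function.ne_iff.1 h0
  have h1 : M1 * (M1.submatrix I id).adjugate = c • (M * (M.submatrix I id).adjugate) := by
    ext j b
    rw [plu_recover, h, Matrix.smul_apply, plu_recover]
    rfl
  have hd : (M1.submatrix I id).det ≠ 0 := by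
    have := congrFun h I
    change (M1.submatrix I id).det = _ at this
    rw [this]
    exact mul_ne_zero hc hI
  have h2 : (M1.submatrix I id).adjugate * (M1.submatrix I id) = (M1.submatrix I id).det • 1 :=
    Matrix.adjugate_mul _
  refine ⟨((M1.submatrix I id).det⁻¹ * c) • ((M.submatrix I id).adjugate * M1.submatrix I id), ?_⟩
  have h3 := congrArg (fun Z => Z * M1.submatrix I id) h1
  simp only [Matrix.mul_assoc, h2, Matrix.smul_mul] at h3
  rw [Matrix.mul_smul, Matrix.mul_one] at h3
  rw [Matrix.mul_smul, mul_smul, ← h3, smul_smul, inv_mul_cancel₀ hd, one_smul]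

end plf

section kap
variable {R : Type*} [CommRing R] {n : ℕ}

/-- index type of affine coordinates -/
abbrev Sg (n : ℕ) := Unit ⊕ (Fin n × Fin n)

/-- the linear map `x ↦ P x Q` on affine coordinates, transposed -/
def kap (P Q : Matrix (Fin n) (Fin n) R) : Matrix (Sg n) (Sg n) R :=
  (Matrix.fromBlocks 1 0 0 (P ⊗ₖ Q.transpose)).transpose

lemma kap_mul (P Q P' Q' : Matrix (Fin n) (Fin n) R) :
    kap P Q * kap P' Q' = kap (P' * P) (Q * Q') := by
  simp only [kap]
  rw [← Matrix.transpose_mul, Matrix.fromBlocks_multiply]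
  simp [Matrix.mul_kronecker_mul, Matrix.transpose_mul]

lemma kap_one : kap (1 : Matrix (Fin n) (Fin n) R) 1 = 1 := by
  simp [kap]

lemma kap_map {S : Type*} [CommRing S] (f : R →+* S) (P Q : Matrix (Fin n) (Fin n) R) :
    (kap P Q).map f = kap (P.map f) (Q.map f) := by
  ext a b
  rcases a with a | a <;> rcases b with b | b <;>
    simp [kap, Matrix.one_apply]

/-- affine coordinates -/
def aff (x : Matrix (Fin n) (Fin n) R) : Sg n → R := Sum.elim (fun _ => 1) (vec x)

lemma aff_kap (P Q x : Matrix (Fin n) (Fin n) R) (a : Sg n) :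
    aff (P * x * Q) a = ∑ b, kap P Q b a * aff x b := by
  rcases a with a | ⟨i, j⟩
  · simp [aff, kap, Matrix.one_apply]
  · simp only [aff, kap, Sum.elim_inr, vec, Fintype.sum_sum_type, Matrix.transpose_apply,
      Matrix.fromBlocks_apply₂₁, Matrix.fromBlocks_apply₂₂, Matrix.zero_apply, zero_mul,
      Finset.sum_const_zero, zero_add, Fintype.sum_prod_type, Matrix.kroneckerMap_apply,
      Matrix.mul_apply, Finset.sum_mul]
    rw [Finset.sum_comm]
    exact Finset.sum_congr rfl fun l _ => Finset.sum_congr rfl fun p _ => by ring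

/-- polynomial functions of bounded degree -/
def pf {D : ℕ} (a : (Fin D → Sg n) → R) (x : Matrix (Fin n) (Fin n) R) : R :=
  ∑ I, a I * ∏ i, aff x (I i)

lemma pf_kap {D : ℕ} (a : (Fin D → Sg n) → R) (P Q x : Matrix (Fin n) (Fin n) R) :
    pf ((Tn D (kap P Q)).mulVec a) x = pf a (P * x * Q) := by
  simp only [pf, Matrix.mulVec, dotProduct, Finset.sum_mul, Tn, Matrix.of_apply]
  rw [Finset.sum_comm]
  refine Finset.sum_congr rfl fun J _ => ?_
  simp only [aff_kap]
  rw [Finset.prod_univ_sum, Fintype.piFinset_univ, Finset.mul_sum]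
  refine Finset.sum_congr rfl fun I _ => ?_
  rw [Finset.prod_mul_distrib]
  ring

end kap

section rp
variable {k : Type*} [Field k] {n : ℕ}

lemma pf_repr (F : MvPolynomial (Fin n × Fin n) k) : ∃ D0 : ℕ, ∀ D ≥ D0,
    ∃ a : (Fin D → Sg n) → k, ∀ x, pf a x = aeval (vec x) F := by
  induction F using MvPolynomial.induction_on with
  | C c =>
    refine ⟨0, fun D _ => ⟨Pi.single (fun _ => Sum.inl ()) c, fun x => ?_⟩⟩
    rw [pf, Finset.sum_eq_single (fun _ => Sum.inl ())]
    · rw [aeval_C]; simp [aff]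
    · intro I _ hI
      rw [Pi.single_eq_of_ne hI, zero_mul]
    · simp
  | add p q hp hq =>
    obtain ⟨D1, h1⟩ := hp
    obtain ⟨D2, h2⟩ := hq
    refine ⟨max D1 D2, fun D hD => ?_⟩
    obtain ⟨a, ha⟩ := h1 D (le_trans (le_max_left _ _) hD)
    obtain ⟨b, hb⟩ := h2 D (le_trans (le_max_right _ _) hD)
    refine ⟨a + b, fun x => ?_⟩
    rw [map_add, ← ha, ← hb]
    simp only [pf, Pi.add_apply, add_mul, Finset.sum_add_distrib]
  | mul_X p q hp =>
    obtain ⟨D1, h1⟩ := hp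
    refine ⟨D1 + 1, fun D hD => ?_⟩
    obtain ⟨D, rfl⟩ : ∃ D', D = D' + 1 := ⟨D - 1, by omega⟩
    obtain ⟨a, ha⟩ := h1 D (by omega)
    refine ⟨fun I => if I 0 = Sum.inr q then a (Fin.tail I) else 0, fun x => ?_⟩
    rw [map_mul, aeval_X, ← ha, pf, pf]
    rw [← (Fin.consEquiv (fun _ => Sg n)).sum_comp, Fintype.sum_prod_type]
    rw [Finset.sum_eq_single (Sum.inr q)]
    · rw [Finset.sum_mul]
      refine Finset.sum_congr rfl fun I _ => ?_
      have ht : Fin.tail ((Fin.consEquiv (fun _ => Sg n)) (Sum.inr q, I)) = I := rfl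
      rw [ht]
      simp only [Fin.consEquiv_apply, Fin.cons_zero, if_true, Fin.tail_cons, Fin.prod_univ_succ,
        Fin.cons_succ]
      simp only [aff, Sum.elim_inr]
      ring
    · intro b _ hb
      refine Finset.sum_eq_zero fun I _ => ?_
      simp only [Fin.consEquiv_apply, Fin.cons_zero, if_neg hb, zero_mul]
    · simp

lemma exists_D (B : Set (GL (Fin n) k)) (hB : Cl B) : ∃ D : ℕ, ∀ g : GL (Fin n) k,
    (∀ a : (Fin D → Sg n) → k, (∀ b ∈ B, pf a b.val = 0) → pf a g.val = 0) → g ∈ B := by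
  obtain ⟨s, hs⟩ := (inferInstance : IsNoetherianRing (MvPolynomial (Fin n × Fin n) k)).noetherian
    (vanishingIdeal k (pts B))
  choose D0 hD0 using pf_repr (k := k) (n := n)
  refine ⟨s.sup D0, fun g hg => hB g fun F hF => ?_⟩
  have hle : vanishingIdeal k (pts B) ≤ vanishingIdeal k {vec g.val} := by
    rw [← hs, Submodule.span_le]
    intro p hp
    obtain ⟨a, ha⟩ := hD0 p _ (Finset.le_sup (f := D0) hp)
    have hpB : p ∈ vanishingIdeal k (pts B) := by rw [← hs]; exact Submodule.subset_span hp
    rw [mem_vanishingIdeal_iff] at hpB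
    rw [SetLike.mem_coe, mem_vanishingIdeal_iff]
    rintro _ rfl
    rw [← ha]
    refine hg a fun b hb => ?_
    rw [ha]
    exact hpB _ ⟨b, hb, rfl⟩
  have : F ∈ vanishingIdeal k {vec g.val} := hle (by rw [mem_vanishingIdeal_iff]; exact hF)
  rw [mem_vanishingIdeal_iff] at this
  exact this _ rfl

theorem chevalley (B : Subgroup (GL (Fin n) k)) (hB : Cl (B : Set (GL (Fin n) k)))
    (w : GL (Fin n) k) (hw : ∀ b ∈ B, w⁻¹ * b * w ∈ B) :
    ∃ (N : Type) (_ : Fintype N) (_ : DecidableEq N)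
      (ψ : Matrix N N (MvPolynomial (Fin n × Fin n) k)) (w0 w0' : Matrix N N k) (v0 : N → k),
      (∀ G, IsRep ψ G) ∧ v0 ≠ 0 ∧ w0 * w0' = 1 ∧
      (∀ g : GL (Fin n) k, w0 * ev ψ g.val = ev ψ (w * g * w⁻¹).val * w0) ∧
      (∃ c : k, w0.mulVec v0 = c • v0) ∧
      ∀ g : GL (Fin n) k, g ∈ B ↔ ∃ c : k, (ev ψ g.val).mulVec v0 = c • v0 := by
  obtain ⟨D, hD⟩ := exists_D (B : Set (GL (Fin n) k)) hB
  let M : Submodule k ((Fin D → Sg n) → k) :=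
    { carrier := {a | ∀ b ∈ B, pf a b.val = 0}
      zero_mem' := fun b _ => by simp [pf]
      add_mem' := fun {a c} ha hc b hb => by
        have : pf (a + c) b.val = pf a b.val + pf c b.val := by
          simp only [pf, Pi.add_apply, add_mul, Finset.sum_add_distrib]
        rw [this, ha b hb, hc b hb, add_zero]
      smul_mem' := fun c a ha b hb => by
        have : pf (c • a) b.val = c * pf a b.val := by
          simp only [pf, Pi.smul_apply, smul_eq_mul, Finset.mul_sum, mul_assoc]
        rw [this, ha b hb, mul_zero] }
  have hMm : ∀ a, a ∈ M ↔ ∀ b ∈ B, pf a b.val = 0 := fun a => Iff.rfl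
  let d := Module.finrank k M
  let bs := Module.finBasis k M
  let Mm : Matrix (Fin D → Sg n) (Fin d) k := Matrix.of fun I b => (bs b : (Fin D → Sg n) → k) I
  have hrange : ∀ t : Fin d → k, Mm.mulVec t = (bs.equivFun.symm t : (Fin D → Sg n) → k) := by
    intro t
    ext I
    simp [Mm, Matrix.mulVec, dotProduct, Module.Basis.equivFun_symm_apply, mul_comm]
    rfl
  have hrange1 : ∀ t, Mm.mulVec t ∈ M := fun t => by rw [hrange]; exact Subtype.prop _
  have hrange2 : ∀ a ∈ M, ∃ t, Mm.mulVec t = a := fun a ha => by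
    refine ⟨bs.equivFun ⟨a, ha⟩, ?_⟩
    rw [hrange, LinearEquiv.symm_apply_apply]
  -- left inverse
  obtain ⟨Ll, hLl⟩ := LinearMap.exists_leftInverse_of_injective Mm.mulVecLin (by
    rw [LinearMap.ker_eq_bot]
    intro t t' h
    simp only [Matrix.mulVecLin_apply, hrange] at h
    exact bs.equivFun.symm.injective (Subtype.ext h))
  have hL : LinearMap.toMatrix' Ll * Mm = 1 := by
    have := congrArg LinearMap.toMatrix' hLl
    rw [LinearMap.toMatrix'_comp, show Mm.mulVecLin = Matrix.toLin' Mm from rfl,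
      LinearMap.toMatrix'_toLin', LinearMap.toMatrix'_id] at this
    exact this
  have hv0 := plu_ne_zero Mm _ hL
  -- stable matrices act by scalars
  have hstab : ∀ A : Matrix (Fin D → Sg n) (Fin D → Sg n) k, (∀ a ∈ M, A.mulVec a ∈ M) →
      ∃ c : k, (Tn d A).mulVec (plu Mm) = c • plu Mm := by
    intro A hA
    choose t ht using fun b : Fin d => hrange2 _ (hA _ (bs b).2)
    have : A * Mm = Mm * Matrix.of fun i b => t b i := by
      ext I b
      have := congrFun (ht b) I
      exact this.symm
    refine ⟨(Matrix.of fun i b => t b i).det, ?_⟩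
    rw [Tn_plu, this, plu_mul]
  let ψ : Matrix (Fin d → Fin D → Sg n) (Fin d → Fin D → Sg n) (MvPolynomial (Fin n × Fin n) k) :=
    Tn d (Tn D (kap 1 (Matrix.mvPolynomialX (Fin n) (Fin n) k)))
  have hψ : ∀ A : Matrix (Fin n) (Fin n) k, ev ψ A = Tn d (Tn D (kap 1 A)) := by
    intro A
    have h1 : ev ψ A = ψ.map (aeval (vec A) : MvPolynomial (Fin n × Fin n) k →ₐ[k] k).toRingHom := rfl
    rw [h1]
    simp only [ψ]
    rw [Tn_map, Tn_map, kap_map]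
    congr 3
    · ext i j; simp [Matrix.one_apply, apply_ite]
    · ext i j
      simp [vec, Matrix.mvPolynomialX]
  have hw1 : w.val * (w⁻¹).val = 1 := by rw [← Units.val_mul]; simp
  have hw2 : (w⁻¹).val * w.val = 1 := by rw [← Units.val_mul]; simp
  refine ⟨Fin d → Fin D → Sg n, inferInstance, inferInstance, ψ,
    Tn d (Tn D (kap (w⁻¹).val w.val)), Tn d (Tn D (kap w.val (w⁻¹).val)), plu Mm,
    fun G => ⟨?_, ?_⟩, hv0, ?_, ?_, ?_, ?_⟩
  · rw [hψ, kap_one, Tn_one, Tn_one]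
  · intro g _ h _
    rw [hψ, hψ, hψ, ← Tn_mul, ← Tn_mul, kap_mul, mul_one]
  · rw [← Tn_mul, ← Tn_mul, kap_mul, hw1, kap_one, Tn_one, Tn_one]
  · intro g
    rw [hψ, hψ, ← Tn_mul, ← Tn_mul, ← Tn_mul, ← Tn_mul, kap_mul, kap_mul]
    congr 3
    · simp
    · rw [Units.val_mul, Units.val_mul, mul_assoc, hw2, mul_one]
  · refine hstab _ fun a ha b hb => ?_
    rw [pf_kap, ← Units.val_mul, ← Units.val_mul]
    exact ha _ (hw b hb)
  · intro g
    constructor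
    · intro hg
      rw [hψ]
      refine hstab _ fun a ha b hb => ?_
      rw [pf_kap, one_mul, ← Units.val_mul]
      exact ha _ (B.mul_mem hb hg)
    · rintro ⟨c, hc⟩
      rw [hψ, Tn_plu] at hc
      have hc0 : c ≠ 0 := by
        rintro rfl
        rw [← Tn_plu, zero_smul] at hc
        have h1 := congrArg (Tn d (Tn D (kap 1 (g⁻¹).val))).mulVec hc
        rw [Matrix.mulVec_mulVec, ← Tn_mul, ← Tn_mul, kap_mul, ← Units.val_mul, inv_mul_cancel,
          Units.val_one, mul_one, kap_one, Tn_one, Tn_one, Matrix.one_mulVec,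
          Matrix.mulVec_zero] at h1
        exact hv0 h1
      obtain ⟨Q, hQ⟩ := plu_eq _ _ hv0 c hc0 hc
      refine hD g fun a ha => ?_
      obtain ⟨t, rfl⟩ := hrange2 a ha
      have h1 := hrange1 (Q.mulVec t)
      rw [Matrix.mulVec_mulVec, ← hQ, ← Matrix.mulVec_mulVec] at h1
      have h2 := h1 1 B.one_mem
      rw [pf_kap, Units.val_one, one_mul, one_mul] at h2
      exact h2

end rp

end Stein

namespace Stein
set_option linter.unusedSectionVars false
universe u v

section homog
variable {k : Type u} [Field k] {n : ℕ}

lemma aeval_detK {K : Type*} [Field K] [Algebra k K] (A : Matrix (Fin n) (Fin n) K) :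
    aeval (vec A) (Matrix.det (Matrix.mvPolynomialX (Fin n) (Fin n) k)) = A.det := by
  rw [AlgHom.map_det]
  congr 1
  ext i j
  simp [vec, Matrix.mvPolynomialX]

lemma generic_GL {S : Set (GL (Fin n) k)} (hS : Irr (pts S)) :
    ∃ (K : Type u) (_ : Field K) (_ : Algebra k K) (_ : IsAlgClosed K) (ξ : GL (Fin n) K),
      ∀ F : MvPolynomial (Fin n × Fin n) k, aeval (vec ξ.val) F = 0 ↔
        ∀ g ∈ S, aeval (vec g.val) F = 0 := by
  obtain ⟨K, i1, i2, i3, τ, hτ⟩ := exists_generic hS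
  have hv : vec (Matrix.of fun i j => τ (i, j)) = τ := by ext ⟨i, j⟩; rfl
  have hd : (Matrix.of fun i j => τ (i, j)).det ≠ 0 := by
    rw [← aeval_detK (k := k), hv, Ne, hτ]
    intro h
    obtain ⟨_, g, hg, rfl⟩ := hS.1
    have := h _ ⟨g, hg, rfl⟩
    rw [aeval_detK] at this
    exact (Matrix.isUnits_det_units g).ne_zero this
  refine ⟨K, i1, i2, i3, Matrix.GeneralLinearGroup.mkOfDetNeZero _ hd, fun F => ?_⟩
  have : vec (Matrix.GeneralLinearGroup.mkOfDetNeZero _ hd).val = τ := hv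
  rw [this, hτ]
  constructor
  · intro h g hg; exact h _ ⟨g, hg, rfl⟩
  · rintro h _ ⟨g, hg, rfl⟩; exact h g hg

variable {N : Type*} [Fintype N] [DecidableEq N]
  {ψ : Matrix N N (MvPolynomial (Fin n × Fin n) k)} {G : Subgroup (GL (Fin n) k)}

lemma ne_zero_K {K : Type*} [Field K] [Algebra k K] {M : Type*} {z : M → k} (hz : z ≠ 0) :
    (fun i => algebraMap k K (z i)) ≠ 0 := by
  obtain ⟨i, hi⟩ := Function.ne_iff.1 hz
  intro h
  apply hi
  have := congrFun h i
  simpa using this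

lemma line_K {K : Type*} [Field K] [Algebra k K] (B : Subgroup (GL (Fin n) k)) {z : N → k}
    (hz : z ≠ 0) (h : ∀ b ∈ B, ∃ c : k, (ev ψ b.val).mulVec z = c • z) {x : GL (Fin n) K}
    (hx : x ∈ GKs (B : Set (GL (Fin n) k)) K) :
    ∃ c : K, (ev ψ x.val).mulVec (fun i => algebraMap k K (z i)) =
      c • (fun i => algebraMap k K (z i)) := by
  rw [← par_iff (ne_zero_K hz)]
  intro i j
  have := hx (colP ψ z i * C (z j) - colP ψ z j * C (z i)) (by
    rintro _ ⟨b, hb, rfl⟩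
    have h1 := (par_iff hz).2 (h b hb) i j
    simp only [map_sub, map_mul, aeval_C, aeval_colP_self]
    exact sub_eq_zero.2 h1)
  simp only [map_sub, map_mul, aeval_C, aeval_colP] at this
  exact sub_eq_zero.1 this

theorem homog [IsAlgClosed k] (hG : Cl (G : Set (GL (Fin n) k)))
    (hirr : Irr (pts (G : Set (GL (Fin n) k)))) (hψ : IsRep ψ G) (B : Subgroup (GL (Fin n) k))
    (hB : IsBor B G) (z : N → k) (hz : z ≠ 0)
    (h : ∀ b ∈ B, ∃ c : k, (ev ψ b.val).mulVec z = c • z) (q : N → k)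
    (hq : q ∈ ext k (orb ψ G z)) :
    ∃ g ∈ G, ∃ c : k, q = c • (ev ψ g.val).mulVec z := by
  have : Infinite k := IsAlgClosed.instInfinite
  obtain ⟨K, i1, i2, i3, τ, hτ⟩ := exists_generic (irr_option hirr)
  have hqs : ∀ F : MvPolynomial N k, aeval (pmap K (orbΦ ψ z) τ) F = 0 → aeval q F = 0 := by
    intro F hF
    rw [aeval_pmap, hτ] at hF
    apply hq F
    rw [orb_eq]
    rintro _ ⟨t, ht, rfl⟩
    rw [aeval_pmap]
    exact hF t ht
  obtain ⟨P, hP⟩ := exists_place_spec _ _ hqs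
  have hv : vec (Matrix.of fun i j => τ (some (i, j))) = τ ∘ some := by
    ext ⟨i, j⟩; rfl
  have hd : (Matrix.of fun i j => τ (some (i, j))).det ≠ 0 := by
    intro h0
    rw [← aeval_detK (k := k), hv, ← aeval_rename, hτ] at h0
    obtain ⟨_, g, hg, rfl⟩ := hirr.1
    have := h0 (fun o => o.elim 0 (vec g.val)) ⟨g, hg, rfl⟩
    rw [aeval_rename] at this
    change aeval (vec g.val) _ = 0 at this
    rw [aeval_detK] at this
    exact (Matrix.isUnits_det_units g).ne_zero this
  let ξ : GL (Fin n) K := Matrix.GeneralLinearGroup.mkOfDetNeZero _ hd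
  have hξv : ξ.val = Matrix.of fun i j => τ (some (i, j)) := rfl
  have hξ : ξ ∈ GKs (G : Set (GL (Fin n) k)) K := by
    intro F hF
    rw [hξv, hv, ← aeval_rename, hτ]
    intro s hs
    rw [aeval_rename]
    exact hF _ hs
  obtain ⟨y, ⟨hyG, g, hg, hyg, hyg'⟩, b, hb, hyb⟩ := iwasawa P B G hG hirr hB ξ hξ
  obtain ⟨c, hc⟩ := line_K B hz h hb
  have hbG : b ∈ GKs (G : Set (GL (Fin n) k)) K := ext_mono (fun _ hs => subset_ext
    (Set.image_mono hB.1 hs)) hb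
  have hu : pmap K (orbΦ ψ z) τ =
      (τ none * c) • (ev ψ y.val).mulVec (fun i => algebraMap k K (z i)) := by
    rw [pmap_orbΦ, ← hξv, hyb, hψ.mulK hG hyG hbG, ← Matrix.mulVec_mulVec, hc, Matrix.mulVec_smul,
      smul_smul]
  obtain ⟨i, hi⟩ := Function.ne_iff.1 hz
  have h2 : (ev ψ (y⁻¹).val).mulVec (pmap K (orbΦ ψ z) τ) =
      (τ none * c) • (fun i => algebraMap k K (z i)) := by
    rw [hu, Matrix.mulVec_smul, Matrix.mulVec_mulVec, hψ.invK hG hyG, Matrix.one_mulVec]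
  have h3 := (ev_res ψ hyg').mulVec hP i
  rw [h2] at h3
  have h4 : P.Res (τ none * c) ((ev ψ (g⁻¹).val).mulVec q i * (z i)⁻¹) := by
    have := h3.mul ((P.res_algebraMap (z i)).inv hi)
    rwa [Pi.smul_apply, smul_eq_mul, mul_assoc, mul_inv_cancel₀
      (by simpa using hi), mul_one] at this
  refine ⟨g, hg, (ev ψ (g⁻¹).val).mulVec q i * (z i)⁻¹, ?_⟩
  ext j
  have h5 := h4.mul ((ev_res ψ hyg).mulVec (fun i => P.res_algebraMap (z i)) j)
  have h6 : P.Res (pmap K (orbΦ ψ z) τ j) (q j) := hP j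
  rw [hu] at h6
  exact h6.unique h5

end homog

end Stein

namespace Stein
set_option linter.unusedSectionVars false
universe u v

section compr

/-- hypotheses of the fixed point theorem -/
structure TAH {N : ℕ} {k : Type u} [Field k] (X : Set (Fin N → k)) (S : Set (GL (Fin N) k))
    (y : GL (Fin N) k) : Prop where
  cl : ext k X ⊆ X
  cone : ∀ u ∈ X, ∀ c : k, c • u ∈ X
  one : 1 ∈ S
  irr : Irr (pts S)
  act : ∀ g ∈ S, ∀ u ∈ X, g.val.mulVec u ∈ X
  hom : ∀ u ∈ X, u ≠ 0 → ∀ u' ∈ X, u' ∈ ext k {v | ∃ g ∈ S, ∃ c : k, v = c • g.val.mulVec u}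
  ne : ∃ u ∈ X, u ≠ 0
  yX : ∀ u ∈ X, y.val.mulVec u ∈ X

/-- the fixed point theorem in dimension `N` over `k` -/
def TA (N : ℕ) (k : Type u) [Field k] : Prop :=
  ∀ (X : Set (Fin N → k)) (S : Set (GL (Fin N) k)) (y : GL (Fin N) k), TAH X S y →
    ∃ u ∈ X, u ≠ 0 ∧ ∃ c : k, y.val.mulVec u = c • u

variable {k : Type u} [Field k] {N d : ℕ}

noncomputable def mulΦ2 (A : Matrix (Fin d) (Fin N) k) (B : Matrix (Fin N) (Fin d) k) :
    Fin d × Fin d → MvPolynomial (Fin N × Fin N) k :=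
  fun q => ((A.map C : Matrix (Fin d) (Fin N) (MvPolynomial (Fin N × Fin N) k)) *
    Matrix.mvPolynomialX (Fin N) (Fin N) k *
    (B.map C : Matrix (Fin N) (Fin d) (MvPolynomial (Fin N × Fin N) k))) q.1 q.2

lemma pmap_mulΦ2 (A : Matrix (Fin d) (Fin N) k) (B : Matrix (Fin N) (Fin d) k)
    (M : Matrix (Fin N) (Fin N) k) : pmap k (mulΦ2 A B) (vec M) = vec (A * M * B) := by
  ext ⟨i, j⟩
  simp [pmap, mulΦ2, vec, Matrix.mul_apply, Matrix.mvPolynomialX]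

lemma compress0 (hIH : TA d k) {X : Set (Fin N → k)} {S : Set (GL (Fin N) k)} {y : GL (Fin N) k}
    (H : TAH X S y) (p : Matrix (Fin d) (Fin N) k) (s : Matrix (Fin N) (Fin d) k)
    (hps : p * s = 1) (y1 : GL (Fin d) k) (hy1 : y.val * s = s * y1.val)
    (hX : ∀ u ∈ X, s.mulVec (p.mulVec u) ∈ X) (hne : ∃ u ∈ X, p.mulVec u ≠ 0) :
    ∃ u ∈ X, u ≠ 0 ∧ ∃ c : k, y.val.mulVec u = c • u := by
  have hps' : ∀ t, p.mulVec (s.mulVec t) = t := fun t => by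
    rw [Matrix.mulVec_mulVec, hps, Matrix.one_mulVec]
  have hs0 : ∀ t, t ≠ 0 → s.mulVec t ≠ 0 := fun t ht h => ht (by rw [← hps' t, h, Matrix.mulVec_zero])
  let S1 : Set (GL (Fin d) k) := {h | ∃ g ∈ S, h.val = p * g.val * s}
  have hdet1 : ∃ g ∈ S, (p * g.val * s).det ≠ 0 := ⟨1, H.one, by simp [hps]⟩
  let D : MvPolynomial (Fin N × Fin N) k :=
    bind₁ (mulΦ2 p s) (Matrix.det (Matrix.mvPolynomialX (Fin d) (Fin d) k))
  have hD : ∀ g : GL (Fin N) k, aeval (vec g.val) D = (p * g.val * s).det := fun g => by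
    rw [← aeval_pmap, pmap_mulΦ2, aeval_detK]
  -- density
  have hdens : ∀ F : MvPolynomial (Fin N × Fin N) k,
      (∀ g ∈ S, (p * g.val * s).det ≠ 0 → aeval (vec g.val) F = 0) →
      ∀ g ∈ S, aeval (vec g.val) F = 0 := by
    intro F hF g hg
    rcases H.irr.2 F D (by
      rintro _ ⟨g, hg, rfl⟩
      rw [map_mul]
      by_cases h : (p * g.val * s).det = 0
      · rw [hD, h, mul_zero]
      · rw [hF g hg h, zero_mul]) with h | h
    · exact h _ ⟨g, hg, rfl⟩
    · obtain ⟨g, hg, h0⟩ := hdet1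
      exact absurd (h _ ⟨g, hg, rfl⟩) (by rw [hD]; exact h0)
  have hmk : ∀ g ∈ S, (p * g.val * s).det ≠ 0 → ∃ h ∈ S1, h.val = p * g.val * s :=
    fun g hg h => ⟨Matrix.GeneralLinearGroup.mkOfDetNeZero _ h, ⟨g, hg, rfl⟩, rfl⟩
  obtain ⟨t, ht, ht0, c, hc⟩ := hIH {t | s.mulVec t ∈ X} S1 y1
    { cl := fun t ht => H.cl (mulVec_mem_ext_self s (fun t ht => subset_ext ht) ht)
      cone := fun t ht c => by
        change s.mulVec _ ∈ X
        rw [Matrix.mulVec_smul]; exact H.cone _ ht c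
      one := ⟨1, H.one, by simp [hps]⟩
      irr := by
        refine ⟨⟨_, 1, ⟨1, H.one, by simp [hps]⟩, rfl⟩, fun F1 F2 hF => ?_⟩
        rcases H.irr.2 (bind₁ (mulΦ2 p s) F1) (bind₁ (mulΦ2 p s) F2) (by
          rintro _ ⟨g, hg, rfl⟩
          rw [← map_mul]
          refine hdens _ (fun g hg h => ?_) g hg
          obtain ⟨h, hh, hhv⟩ := hmk g hg h
          rw [← aeval_pmap, pmap_mulΦ2, ← hhv]
          exact hF _ ⟨h, hh, rfl⟩) with h | h
        · left
          rintro _ ⟨x, ⟨g, hg, hxg⟩, rfl⟩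
          have := h _ ⟨g, hg, rfl⟩
          rwa [← aeval_pmap, pmap_mulΦ2, ← hxg] at this
        · right
          rintro _ ⟨x, ⟨g, hg, hxg⟩, rfl⟩
          have := h _ ⟨g, hg, rfl⟩
          rwa [← aeval_pmap, pmap_mulΦ2, ← hxg] at this
      act := by
        rintro h ⟨g, hg, hh⟩ t ht
        change s.mulVec _ ∈ X
        rw [hh, ← Matrix.mulVec_mulVec, ← Matrix.mulVec_mulVec]
        exact hX _ (H.act g hg _ ht)
      hom := by
        intro t ht ht0 t' ht' F hF
        have h1 := H.hom _ ht (hs0 t ht0) _ ht' (bind₁ (linΦ p) F) (by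
          rintro _ ⟨g, hg, c, rfl⟩
          -- polynomial in g
          let Ψ : Fin d → MvPolynomial (Fin N × Fin N) k := fun i =>
            C c * ∑ j, mulΦ2 p s (i, j) * C (t j)
          have hΨ : ∀ g : GL (Fin N) k, pmap k Ψ (vec g.val) = c • (p * g.val * s).mulVec t := by
            intro g
            ext i
            have := fun j => congrFun (pmap_mulΦ2 p s g.val) (i, j)
            simp only [pmap] at this
            simp only [pmap, Ψ, map_mul, map_sum, aeval_C, this]
            rfl
          have h2 := hdens (bind₁ Ψ F) (fun g hg h => by
            obtain ⟨h, hh, hhv⟩ := hmk g hg h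
            rw [← aeval_pmap, hΨ, ← hhv]
            exact hF _ ⟨h, hh, c, rfl⟩) g hg
          rw [← aeval_pmap, hΨ] at h2
          rw [← aeval_pmap, pmap_linΦ_self, Matrix.mulVec_smul, Matrix.mulVec_mulVec,
            Matrix.mulVec_mulVec]
          exact h2)
        rwa [← aeval_pmap, pmap_linΦ_self, hps'] at h1
      ne := by
        obtain ⟨u, hu, hu0⟩ := hne
        exact ⟨_, hX u hu, hu0⟩
      yX := fun t ht => by
        change s.mulVec _ ∈ X
        rw [Matrix.mulVec_mulVec, ← hy1, ← Matrix.mulVec_mulVec]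
        exact H.yX _ ht }
  refine ⟨_, ht, hs0 t ht0, c, ?_⟩
  rw [Matrix.mulVec_mulVec, hy1, ← Matrix.mulVec_mulVec, hc, Matrix.mulVec_smul]

lemma compress (hIH : ∀ d < N, TA d k) {X : Set (Fin N → k)} {S : Set (GL (Fin N) k)}
    {y : GL (Fin N) k} (H : TAH X S y) (U : Submodule k (Fin N → k))
    (q : (Fin N → k) →ₗ[k] (Fin N → k)) (hqU : ∀ v, q v ∈ U) (hq : ∀ v ∈ U, q v = v)
    (hqX : ∀ u ∈ X, q u ∈ X) (hne : ∃ u ∈ X, q u ≠ 0) (hyU : ∀ v ∈ U, y.val.mulVec v ∈ U)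
    (hlt : Module.finrank k U < N) : ∃ u ∈ X, u ≠ 0 ∧ ∃ c : k, y.val.mulVec u = c • u := by
  let bs := Module.finBasis k U
  let ls : (Fin (Module.finrank k U) → k) →ₗ[k] (Fin N → k) :=
    U.subtype ∘ₗ bs.equivFun.symm.toLinearMap
  let lp : (Fin N → k) →ₗ[k] (Fin (Module.finrank k U) → k) :=
    bs.equivFun.toLinearMap ∘ₗ (q.codRestrict U hqU)
  have hls : ∀ t, ls t ∈ U := fun t => Subtype.prop _
  have hlsp : ∀ v, ls (lp v) = q v := fun v => by simp [ls, lp]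
  have hlps : ∀ t, lp (ls t) = t := fun t => by
    have : q.codRestrict U hqU (ls t) = bs.equivFun.symm t := Subtype.ext (hq _ (hls t))
    simp only [lp, LinearMap.comp_apply, this]
    exact bs.equivFun.apply_symm_apply t
  have hinj : Function.Injective ls := Function.LeftInverse.injective hlps
  have hmul : lp.toMatrix' * ls.toMatrix' = 1 := by
    rw [← LinearMap.toMatrix'_comp, ← LinearMap.toMatrix'_id]
    congr 1
    exact LinearMap.ext hlps
  let Y1 : Matrix (Fin (Module.finrank k U)) (Fin (Module.finrank k U)) k :=
    lp.toMatrix' * y.val * ls.toMatrix'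
  have hY1 : ∀ t, Y1.mulVec t = lp (y.val.mulVec (ls t)) := fun t => by
    simp only [Y1]
    rw [← Matrix.mulVec_mulVec, ← Matrix.mulVec_mulVec, LinearMap.toMatrix'_mulVec,
      LinearMap.toMatrix'_mulVec]
  have hsY : ∀ t, ls (Y1.mulVec t) = y.val.mulVec (ls t) := fun t => by
    rw [hY1, hlsp, hq _ (hyU _ (hls t))]
  have hunit : IsUnit Y1 := by
    rw [← Matrix.mulVec_injective_iff_isUnit]
    intro t t' h
    have h1 := congrArg ls h
    simp only [hsY] at h1
    have h2 := congrArg (y⁻¹).val.mulVec h1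
    rw [Matrix.mulVec_mulVec, Matrix.mulVec_mulVec, ← Units.val_mul, inv_mul_cancel,
      Units.val_one, Matrix.one_mulVec, Matrix.one_mulVec] at h2
    exact hinj h2
  refine compress0 (hIH _ hlt) H lp.toMatrix' ls.toMatrix' hmul hunit.unit ?_ ?_ ?_
  · apply Matrix.ext_of_mulVec_single
    intro i
    rw [← Matrix.mulVec_mulVec, ← Matrix.mulVec_mulVec, LinearMap.toMatrix'_mulVec,
      LinearMap.toMatrix'_mulVec]
    exact (hsY _).symm
  · intro u hu
    rw [LinearMap.toMatrix'_mulVec, LinearMap.toMatrix'_mulVec, hlsp]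
    exact hqX u hu
  · obtain ⟨u, hu, hu0⟩ := hne
    refine ⟨u, hu, fun h => hu0 ?_⟩
    rw [LinearMap.toMatrix'_mulVec] at h
    rw [← hlsp, h, map_zero]

lemma span_case (hIH : ∀ d < N, TA d k) {X : Set (Fin N → k)} {S : Set (GL (Fin N) k)}
    {y : GL (Fin N) k} (H : TAH X S y) (hsp : Submodule.span k X ≠ ⊤) :
    ∃ u ∈ X, u ≠ 0 ∧ ∃ c : k, y.val.mulVec u = c • u := by
  obtain ⟨f, hf⟩ := LinearMap.exists_leftInverse_of_injective (Submodule.span k X).subtype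
    (by simp)
  have hq : ∀ v (hv : v ∈ Submodule.span k X), (f v : Fin N → k) = v := fun v hv =>
    congrArg Subtype.val (LinearMap.congr_fun hf ⟨v, hv⟩)
  refine compress hIH H (Submodule.span k X) ((Submodule.span k X).subtype ∘ₗ f)
    (fun v => (f v).2) hq ?_ ?_ ?_ ?_
  · intro u hu
    change (f u : Fin N → k) ∈ X
    rw [hq u (Submodule.subset_span hu)]; exact hu
  · obtain ⟨u, hu, hu0⟩ := H.ne
    refine ⟨u, hu, ?_⟩
    change (f u : Fin N → k) ≠ 0
    rw [hq u (Submodule.subset_span hu)]; exact hu0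
  · intro v hv
    have : Submodule.span k X ≤ (Submodule.span k X).comap y.val.mulVecLin := by
      rw [Submodule.span_le]
      intro u hu
      exact Submodule.subset_span (H.yX u hu)
    exact this hv
  · have := Submodule.finrank_lt hsp
    simpa using this

end compr

end Stein

namespace Stein
set_option linter.unusedSectionVars false
universe u v

section linalg
variable {K : Type*} [Field K]

lemma aeval_mem_of_inv {V : Type*} [AddCommGroup V] [Module K V] (T : Module.End K V)
    (M : Submodule K V) (hM : ∀ v ∈ M, T v ∈ M) (q : Polynomial K) :
    ∀ v ∈ M, Polynomial.aeval T q v ∈ M := by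
  induction q using Polynomial.induction_on' with
  | add p q hp hq =>
    intro v hv
    rw [map_add, LinearMap.add_apply]
    exact M.add_mem (hp v hv) (hq v hv)
  | monomial n a =>
    intro v hv
    rw [Polynomial.aeval_monomial, Module.End.mul_apply, Module.algebraMap_end_apply]
    refine M.smul_mem _ ?_
    induction n with
    | zero => simpa using hv
    | succ n ih => rw [pow_succ', Module.End.mul_apply]; exact hM _ ih

lemma aeval_restrict {V : Type*} [AddCommGroup V] [Module K V] (T : Module.End K V)
    (M : Submodule K V) (hM : ∀ v ∈ M, T v ∈ M) (q : Polynomial K) (v : M) :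
    ((Polynomial.aeval (T.restrict hM) q v : M) : V) = Polynomial.aeval T q v := by
  induction q using Polynomial.induction_on' with
  | add p q hp hq =>
    rw [map_add, map_add, LinearMap.add_apply, LinearMap.add_apply, Submodule.coe_add, hp, hq]
  | monomial n a =>
    rw [Polynomial.aeval_monomial, Polynomial.aeval_monomial, Module.End.mul_apply,
      Module.End.mul_apply, Module.algebraMap_end_apply, Module.algebraMap_end_apply,
      Submodule.coe_smul]
    congr 1
    induction n generalizing v with
    | zero => simp
    | succ n ih => rw [pow_succ, pow_succ, Module.End.mul_apply, Module.End.mul_apply, ih]; rfl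

/-- an annihilating polynomial whose roots are eigenvalues -/
lemma exists_ann {V : Type*} [AddCommGroup V] [Module K V] (T : Module.End K V)
    (M : Submodule K V) [FiniteDimensional K M] (hM : ∀ v ∈ M, T v ∈ M) :
    ∃ q : Polynomial K, (∀ v ∈ M, Polynomial.aeval T q v = 0) ∧
      ∀ c, q.eval c = 0 → ∃ v ∈ M, v ≠ 0 ∧ T v = c • v := by
  refine ⟨minpoly K (T.restrict hM), fun v hv => ?_, fun c hc => ?_⟩
  · rw [← aeval_restrict T M hM _ ⟨v, hv⟩, minpoly.aeval]; rfl
  · obtain ⟨v, hv⟩ := (Module.End.hasEigenvalue_of_isRoot hc).exists_hasEigenvector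
    refine ⟨v, v.2, fun h => hv.2 (Subtype.ext h), ?_⟩
    exact congrArg Subtype.val hv.apply_eq_smul

lemma proj_inv [IsAlgClosed K] {V : Type*} [AddCommGroup V] [Module K V] (T Q : Module.End K V)
    (hTQ : ∀ v, T (Q v) = Q (T v)) (hQ : ∀ v, Q (Q v) = Q v) (W : Submodule K V)
    [FiniteDimensional K W] (hWT : ∀ v ∈ W, T v ∈ W) (hWQ : ∀ v ∈ W, Q v ∈ W)
    (hne : ∀ (c : K) (v v' : V), v ≠ 0 → v' ≠ 0 → T v = c • v → T v' = c • v' → Q v = v → Q v' = 0 → False)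
    (M : Submodule K V) (hM : ∀ v ∈ M, T v ∈ M) (v : V) (hvW : v ∈ W) (hvM : v ∈ M) :
    Q v ∈ M := by
  let W1 : Submodule K V := W ⊓ LinearMap.ker (Q - 1)
  let W2 : Submodule K V := W ⊓ LinearMap.ker Q
  have h1 : ∀ v, v ∈ W1 ↔ v ∈ W ∧ Q v = v := fun v => by
    simp only [W1, Submodule.mem_inf, LinearMap.mem_ker, LinearMap.sub_apply, Module.End.one_apply,
      sub_eq_zero]
  have h2 : ∀ v, v ∈ W2 ↔ v ∈ W ∧ Q v = 0 := fun v => by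
    simp only [W2, Submodule.mem_inf, LinearMap.mem_ker]
  have : FiniteDimensional K W1 := Submodule.finiteDimensional_of_le inf_le_left
  have : FiniteDimensional K W2 := Submodule.finiteDimensional_of_le inf_le_left
  obtain ⟨q1, hq1, hq1'⟩ := exists_ann T W1 (fun v hv => by
    rw [h1] at hv ⊢
    exact ⟨hWT v hv.1, by rw [← hTQ, hv.2]⟩)
  obtain ⟨q2, hq2, hq2'⟩ := exists_ann T W2 (fun v hv => by
    rw [h2] at hv ⊢
    exact ⟨hWT v hv.1, by rw [← hTQ, hv.2, map_zero]⟩)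
  have hco : IsCoprime q1 q2 := by
    rw [Polynomial.isCoprime_iff_aeval_ne_zero_of_isAlgClosed K K]
    intro c
    by_contra! h
    obtain ⟨a, ha, ha0, hac⟩ := hq1' c (by simpa using h.1)
    obtain ⟨b, hb, hb0, hbc⟩ := hq2' c (by simpa using h.2)
    exact hne c a b ha0 hb0 hac hbc ((h1 a).1 ha).2 ((h2 b).1 hb).2
  obtain ⟨a, b, hab⟩ := hco
  have e1 : Polynomial.aeval T (b * q2) v = Q v := by
    have e2 : Polynomial.aeval T (b * q2) (v - Q v) = 0 := by
      rw [map_mul, Module.End.mul_apply, hq2 _ ((h2 _).2 ⟨W.sub_mem hvW (hWQ v hvW), by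
        rw [map_sub, hQ, sub_self]⟩), map_zero]
    have e3 : Polynomial.aeval T (a * q1) (Q v) = 0 := by
      rw [map_mul, Module.End.mul_apply, hq1 _ ((h1 _).2 ⟨hWQ v hvW, hQ v⟩), map_zero]
    have e4 : Polynomial.aeval T (a * q1 + b * q2) (Q v) = Q v := by
      rw [hab, map_one, Module.End.one_apply]
    rw [map_add, LinearMap.add_apply, e3, zero_add] at e4
    rw [map_sub, sub_eq_zero] at e2
    rw [e2, e4]
  rw [← e1]
  exact aeval_mem_of_inv T M hM _ v hvM

end linalg

section bdd
variable {k K : Type*} [Field k] [Field K] [Algebra k K] [IsAlgClosed K]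

lemma bdd_basis (P : Place k K) (ε : K) (hε : ε ≠ 0) (hε0 : P.Res ε 0) (Q : k → Prop) (d : ℕ) :
    ∀ (V : Type v) [AddCommGroup V] [Module K V] [FiniteDimensional K V],
      Module.finrank K V = d → ∀ f : Module.End K V,
      (∀ c, f.HasEigenvalue c → ∃ a, P.Res c a ∧ Q a) →
      ∃ (b : Fin d → V) (m : Matrix (Fin d) (Fin d) K) (mb : Fin d → k), LinearIndependent K b ∧
        (∀ j, f (b j) = ∑ i, m i j • b i) ∧ P.ResM m (Matrix.diagonal mb) ∧ ∀ i, Q (mb i) := by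
  induction d with
  | zero =>
    intro V _ _ _ _ f _
    exact ⟨Fin.elim0, 0, Fin.elim0, linearIndependent_empty_type, fun j => j.elim0,
      fun i => i.elim0, fun i => i.elim0⟩
  | succ d ih =>
    intro V _ _ _ hd f hf
    have : Nontrivial V := Module.nontrivial_of_finrank_pos (R := K) (by omega)
    obtain ⟨c, hc⟩ := Module.End.exists_eigenvalue f
    obtain ⟨a, hca, hQa⟩ := hf c hc
    have hns : LinearMap.range (f - c • 1) ≠ ⊤ := by
      intro h
      have h1 := LinearMap.range_eq_top.1 h
      have h2 := LinearMap.injective_iff_surjective.2 h1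
      obtain ⟨v, hv⟩ := hc.exists_hasEigenvector
      apply hv.2
      apply h2
      rw [map_zero, LinearMap.sub_apply, hv.apply_eq_smul]
      simp
    obtain ⟨g, hg0, hg⟩ := Submodule.exists_le_ker_of_lt_top _ (lt_top_iff_ne_top.2 hns)
    have hgf : ∀ v, f v - c • v ∈ LinearMap.ker g := fun v => hg ⟨v, by simp⟩
    have hW : ∀ w ∈ LinearMap.ker g, f w ∈ LinearMap.ker g := fun w hw => by
      have := (LinearMap.ker g).add_mem (hgf w) ((LinearMap.ker g).smul_mem c hw)
      rwa [sub_add_cancel] at this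
    obtain ⟨v, hv⟩ : ∃ v, g v ≠ 0 := by
      by_contra! h
      exact hg0 (LinearMap.ext h)
    have hfr : Module.finrank K (LinearMap.ker g) = d := by
      have h1 := LinearMap.finrank_range_add_finrank_ker g
      have h2 : LinearMap.range g = ⊤ := LinearMap.range_eq_top.2 (LinearMap.surjective hg0)
      rw [h2, finrank_top, Module.finrank_self] at h1
      omega
    obtain ⟨b, m, mb, hb, hm, hr, hQ⟩ := ih (LinearMap.ker g) hfr (f.restrict hW) (by
      intro c hc
      apply hf
      obtain ⟨w, hw⟩ := hc.exists_hasEigenvector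
      refine Module.End.hasEigenvalue_of_hasEigenvector (x := (w : V)) ?_
      rw [Module.End.hasEigenvector_iff, Module.End.mem_eigenspace_iff]
      exact ⟨congrArg Subtype.val hw.apply_eq_smul, fun h => hw.2 (Subtype.ext h)⟩)
    -- expand the last vector
    have hsp : Submodule.span K (Set.range b) = ⊤ :=
      hb.span_eq_top_of_card_eq_finrank' (by simp [hfr])
    obtain ⟨t, ht⟩ : ∃ t : Fin d → K, ∑ i, t i • b i = ⟨_, hgf v⟩ := by
      have : (⟨_, hgf v⟩ : LinearMap.ker g) ∈ Submodule.span K (Set.range b) := by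
        rw [hsp]; trivial
      exact (Submodule.mem_span_range_iff_exists_fun K).1 this
    have ht' : f v = c • v + ∑ i, t i • (b i : V) := by
      have := congrArg Subtype.val ht
      rw [AddSubmonoidClass.coe_finsetSum] at this
      simp only [Submodule.coe_smul] at this
      rw [this]; abel
    obtain ⟨s, hs, hst⟩ : ∃ s : K, s ≠ 0 ∧ ∀ i, P.Res (s * t i) 0 := by
      by_cases h0 : t = 0
      · exact ⟨1, one_ne_zero, fun i => by rw [h0]; simpa using P.res_zero⟩
      · obtain ⟨s, ub, hs, h, -⟩ := P.exists_scale t h0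
        refine ⟨ε * s, mul_ne_zero hε hs, fun i => ?_⟩
        have := hε0.mul (h i)
        rwa [zero_mul, ← mul_assoc] at this
    refine ⟨Fin.cons (s • v) (fun i => (b i : V)),
      Matrix.of (Fin.cons (Fin.cons c (fun _ => 0)) (fun i => Fin.cons (s * t i) (m i))),
      Fin.cons a mb, ?_, ?_, ?_, ?_⟩
    · rw [linearIndependent_finCons]
      refine ⟨?_, fun h => ?_⟩
      · exact hb.map' (LinearMap.ker g).subtype (by simp)
      · have h1 : Submodule.span K (Set.range fun i => (b i : V)) ≤ LinearMap.ker g := by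
          rw [Submodule.span_le]
          rintro _ ⟨i, rfl⟩
          exact (b i).2
        have h2 := h1 h
        rw [LinearMap.mem_ker, map_smul, smul_eq_mul] at h2
        exact mul_ne_zero hs hv h2
    · intro j
      refine Fin.cases ?_ (fun j => ?_) j
      · rw [Fin.sum_univ_succ]
        simp only [Fin.cons_zero, Fin.cons_succ, Matrix.of_apply]
        rw [map_smul, ht', smul_add, Finset.smul_sum, smul_comm]
        simp only [smul_smul]
      · rw [Fin.sum_univ_succ]
        simp only [Fin.cons_zero, Fin.cons_succ, Matrix.of_apply, zero_smul, zero_add]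
        have := congrArg Subtype.val (hm j)
        rw [AddSubmonoidClass.coe_finsetSum] at this
        exact this
    · intro i j
      refine Fin.cases ?_ (fun i => ?_) i <;> refine Fin.cases ?_ (fun j => ?_) j
      · simpa using hca
      · simpa [Matrix.diagonal_apply, (Fin.succ_ne_zero j).symm] using P.res_zero
      · simpa [Matrix.diagonal_apply] using hst i
      · have := hr i j
        simpa [Matrix.diagonal_apply] using this
    · intro i
      exact Fin.cases hQa hQ i

end bdd

end Stein

namespace Stein
set_option linter.unusedSectionVars false
universe u v

section lfs
variable {R : Type*} [CommRing R] {σ : Type*} [Fintype σ]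

/-- linear substitution -/
noncomputable def lf (A : Matrix σ σ R) : MvPolynomial σ R →ₐ[R] MvPolynomial σ R :=
  bind₁ (fun i => ∑ j, C (A i j) * X j)

lemma eval_lf (A : Matrix σ σ R) (t : σ → R) (F : MvPolynomial σ R) :
    eval t (lf A F) = eval (A.mulVec t) F := by
  rw [lf, ← coe_aeval_eq_eval, ← coe_aeval_eq_eval, RingHom.coe_coe, RingHom.coe_coe, aeval_bind₁]
  congr 2
  ext i
  simp only [map_sum, map_mul, aeval_C, aeval_X]
  rfl

lemma lf_lf (A B : Matrix σ σ R) (F : MvPolynomial σ R) : lf A (lf B F) = lf (B * A) F := by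
  simp only [lf, bind₁_bind₁]
  congr 2
  ext1 i
  simp only [map_sum, map_mul, bind₁_X_right, algHom_C, algebraMap_eq, Matrix.mul_apply,
    Finset.mul_sum, Finset.sum_mul]
  rw [Finset.sum_comm]
  simp only [mul_assoc]

lemma map_lf {S : Type*} [CommRing S] (f : R →+* S) (A : Matrix σ σ R) (F : MvPolynomial σ R) :
    MvPolynomial.map f (lf A F) = lf (A.map f) (MvPolynomial.map f F) := by
  simp only [lf, map_bind₁, map_sum, map_mul, map_C, map_X, Matrix.map_apply]

lemma lf_deg (A : Matrix σ σ R) (D : ℕ) (F : MvPolynomial σ R) (hF : F.totalDegree ≤ D) :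
    (lf A F).totalDegree ≤ D := by
  classical
  rw [F.as_sum, map_sum]
  refine totalDegree_finsetSum_le fun d hd => ?_
  rw [lf, bind₁_monomial]
  refine (totalDegree_mul _ _).trans ?_
  rw [totalDegree_C, zero_add]
  refine (totalDegree_finsetProd _ _).trans ?_
  refine le_trans ?_ ((le_totalDegree hd).trans hF)
  rw [Finsupp.sum]
  refine Finset.sum_le_sum fun i _ => ?_
  refine (totalDegree_pow _ _).trans ?_
  refine le_trans (Nat.mul_le_mul_left _ (?_ : _ ≤ 1)) (by simp)
  refine totalDegree_finsetSum_le fun j _ => ?_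
  refine (totalDegree_mul _ _).trans ?_
  rw [totalDegree_C, zero_add]
  rcases subsingleton_or_nontrivial R with h | h
  · rw [Subsingleton.elim (X j : MvPolynomial σ R) 0]
    simp
  · simp

end lfs

/-- the standard projection -/
def Dm (σ₁ σ₂ R : Type*) [CommRing R] [DecidableEq σ₁] [DecidableEq σ₂] :
    Matrix (σ₁ ⊕ σ₂) (σ₁ ⊕ σ₂) R :=
  Matrix.diagonal (Sum.elim (fun _ => 1) (fun _ => 0))

section lim
variable {k K : Type*} [Field k] [Field K] [Algebra k K]

lemma fst_inj (P : Place k K) : Function.Injective (fstΓ P.Γ) := by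
  rw [injective_iff_map_eq_zero]
  rintro ⟨⟨x, a⟩, h⟩ h0
  change x = 0 at h0
  subst h0
  have := P.func a h
  subst this
  rfl

lemma exists_prim (P : Place k K) {σ : Type*} (F : MvPolynomial σ K) (hF : F ≠ 0) :
    ∃ (s : K) (F' : MvPolynomial σ P.Γ), s ≠ 0 ∧ MvPolynomial.map (fstΓ P.Γ) F' = s • F ∧
      MvPolynomial.map (sndΓ P.Γ) F' ≠ 0 := by
  classical
  obtain ⟨d, hd⟩ := ne_zero_iff.1 hF
  obtain ⟨s, ub, hs, hr, hub⟩ := P.exists_scale (fun d : F.support => F.coeff d) (by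
    intro h
    exact hd (congrFun h ⟨d, mem_support_iff.2 hd⟩))
  let F' : MvPolynomial σ P.Γ := ∑ d : F.support, monomial d.1 ⟨(s * F.coeff d, ub d), hr d⟩
  refine ⟨s, F', hs, ?_, ?_⟩
  · simp only [F', map_sum, map_monomial]
    conv_rhs => rw [F.as_sum, Finset.smul_sum, ← Finset.sum_coe_sort]
    refine Finset.sum_congr rfl fun d _ => ?_
    rw [smul_monomial]
    rfl
  · obtain ⟨e, he⟩ := Function.ne_iff.1 hub
    intro h0
    apply he
    have h1 := congrArg (coeff e.1) h0
    simp only [F', map_sum, map_monomial, coeff_sum, coeff_monomial, coeff_zero] at h1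
    rw [Finset.sum_eq_single e] at h1
    · rw [if_pos rfl] at h1
      exact h1
    · intro b _ hb
      rw [if_neg (fun h => hb (Subtype.ext h))]
    · simp

variable [IsAlgClosed K]

/-- the limit projection preserves closed stable sets -/
lemma limit_proj (P : Place k K) {σ₁ σ₂ : Type*} [Fintype σ₁] [Fintype σ₂] [DecidableEq σ₁]
    [DecidableEq σ₂] (m : Matrix (σ₁ ⊕ σ₂) (σ₁ ⊕ σ₂) K) (mb : σ₁ ⊕ σ₂ → k)
    (hm : P.ResM m (Matrix.diagonal mb)) (hm1 : ∀ i, mb (Sum.inl i) ≠ 0)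
    (hm2 : ∀ i, mb (Sum.inr i) = 0) (h12 : ∀ i j, m (Sum.inl i) (Sum.inr j) = 0)
    (h21 : ∀ i j, m (Sum.inr i) (Sum.inl j) = 0) (Z : Set (σ₁ ⊕ σ₂ → K)) (hZ : ext K Z ⊆ Z)
    (hmZ : ∀ t ∈ Z, m.mulVec t ∈ Z) (t : σ₁ ⊕ σ₂ → K) (ht : t ∈ Z) :
    Sum.elim (fun i => t (Sum.inl i)) 0 ∈ Z := by
  have hDmap1 : (Dm σ₁ σ₂ P.Γ).map (fstΓ P.Γ) = Dm σ₁ σ₂ K := by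
    simp only [Dm, Matrix.diagonal_map (map_zero _)]
    congr 1; ext i; rcases i with i | i <;> simp
  have hDmap2 : (Dm σ₁ σ₂ P.Γ).map (sndΓ P.Γ) = Dm σ₁ σ₂ k := by
    simp only [Dm, Matrix.diagonal_map (map_zero _)]
    congr 1; ext i; rcases i with i | i <;> simp
  have hDD : Dm σ₁ σ₂ K * Dm σ₁ σ₂ K = Dm σ₁ σ₂ K := by
    simp only [Dm, Matrix.diagonal_mul_diagonal]
    congr 1; ext i; rcases i with i | i <;> simp
  have hDm : Dm σ₁ σ₂ K * m = m * Dm σ₁ σ₂ K := by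
    ext i j
    simp only [Dm, Matrix.diagonal_mul, Matrix.mul_diagonal]
    rcases i with i | i <;> rcases j with j | j <;> simp [h12, h21]
  have hDt : (Dm σ₁ σ₂ K).mulVec t = Sum.elim (fun i => t (Sum.inl i)) 0 := by
    ext i
    rw [Dm, Matrix.mulVec_diagonal]
    rcases i with i | i <;> simp
  let m' : Matrix (σ₁ ⊕ σ₂) (σ₁ ⊕ σ₂) P.Γ := Matrix.of fun i j =>
    ⟨(m i j, Matrix.diagonal mb i j), hm i j⟩
  have hm'1 : m'.map (fstΓ P.Γ) = m := rfl
  have hm'2 : m'.map (sndΓ P.Γ) = Matrix.diagonal mb := rfl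
  -- eigenvectors
  have key1 : ∀ (c : K) (F : MvPolynomial (σ₁ ⊕ σ₂) K), F ≠ 0 → lf m F = c • F →
      lf (Dm σ₁ σ₂ K) F = F → ¬ P.Res c 0 := by
    intro c F hF hc hDF hc0
    obtain ⟨s, F', hs, h1, h2⟩ := exists_prim P F hF
    have h3 : lf (Dm σ₁ σ₂ P.Γ) F' = F' := by
      apply MvPolynomial.map_injective _ (fst_inj P)
      rw [map_lf, hDmap1, h1, map_smul, hDF]
    have h4 : lf (Dm σ₁ σ₂ k) (MvPolynomial.map (sndΓ P.Γ) F') = MvPolynomial.map (sndΓ P.Γ) F' := by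
      rw [← hDmap2, ← map_lf, h3]
    have h5 : lf m' F' = C (⟨(c, 0), hc0⟩ : P.Γ) * F' := by
      apply MvPolynomial.map_injective _ (fst_inj P)
      rw [map_lf, hm'1, h1, map_smul, hc, map_mul, map_C, h1, ← smul_eq_C_mul]
      rw [smul_comm]; rfl
    have h6 := congrArg (MvPolynomial.map (sndΓ P.Γ)) h5
    rw [map_lf, hm'2, map_mul, map_C] at h6
    have h7 : (sndΓ P.Γ) (⟨(c, 0), hc0⟩ : P.Γ) = 0 := rfl
    rw [h7, C_0, zero_mul] at h6
    have h8 := congrArg (lf (Matrix.diagonal (fun i => (mb i)⁻¹))) h6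
    rw [lf_lf, map_zero] at h8
    have h9 : Matrix.diagonal mb * Matrix.diagonal (fun i => (mb i)⁻¹) = Dm σ₁ σ₂ k := by
      simp only [Dm, Matrix.diagonal_mul_diagonal]
      congr 1; ext i; rcases i with i | i <;> simp [hm1, hm2]
    rw [h9, h4] at h8
    exact h2 h8
  have key2 : ∀ (c : K) (F : MvPolynomial (σ₁ ⊕ σ₂) K), F ≠ 0 → lf m F = c • F →
      lf (Dm σ₁ σ₂ K) F = 0 → P.Res c 0 := by
    intro c F hF hc hDF
    obtain ⟨s, F', hs, h1, h2⟩ := exists_prim P F hF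
    have h3 : lf (Dm σ₁ σ₂ P.Γ) F' = 0 := by
      apply MvPolynomial.map_injective _ (fst_inj P)
      rw [map_lf, hDmap1, h1, map_smul, hDF, smul_zero, map_zero]
    have h4 : lf (Dm σ₁ σ₂ k) (MvPolynomial.map (sndΓ P.Γ) F') = 0 := by
      rw [← hDmap2, ← map_lf, h3, map_zero]
    have h5 : lf (Matrix.diagonal mb) (MvPolynomial.map (sndΓ P.Γ) F') = 0 := by
      have h6 := congrArg (lf (Matrix.diagonal mb)) h4
      rw [lf_lf, map_zero] at h6
      have h9 : Dm σ₁ σ₂ k * Matrix.diagonal mb = Matrix.diagonal mb := by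
        simp only [Dm, Matrix.diagonal_mul_diagonal]
        congr 1; ext i; rcases i with i | i <;> simp [hm2]
      rwa [h9] at h6
    obtain ⟨d, hd⟩ := ne_zero_iff.1 h2
    rw [coeff_map] at hd
    have h6 : P.Res (fstΓ P.Γ (coeff d (lf m' F'))) (sndΓ P.Γ (coeff d (lf m' F'))) :=
      (coeff d (lf m' F')).2
    have h7 : P.Res (fstΓ P.Γ (coeff d F')) (sndΓ P.Γ (coeff d F')) := (coeff d F').2
    rw [← coeff_map, ← coeff_map, map_lf, map_lf, hm'1, hm'2, h5, coeff_zero, h1, map_smul, hc,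
      smul_comm, ← h1, coeff_smul, coeff_map] at h6
    have h8 := h6.mul (h7.inv hd)
    rwa [zero_mul, smul_eq_mul, mul_assoc, mul_inv_cancel₀ (h7.ne_zero hd), mul_one] at h8
  -- conclusion
  apply hZ
  intro F hF
  let M : Submodule K (MvPolynomial (σ₁ ⊕ σ₂) K) :=
    { carrier := {F | ∀ t ∈ Z, eval t F = 0}
      zero_mem' := fun t _ => map_zero _
      add_mem' := fun {a b} ha hb t ht => by rw [map_add, ha t ht, hb t ht, add_zero]
      smul_mem' := fun c a ha t ht => by rw [smul_eval, ha t ht, mul_zero] }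
  have := proj_inv (lf m).toLinearMap (lf (Dm σ₁ σ₂ K)).toLinearMap
    (fun v => by
      simp only [AlgHom.toLinearMap_apply]
      rw [lf_lf, lf_lf, hDm])
    (fun v => by
      simp only [AlgHom.toLinearMap_apply]
      rw [lf_lf, hDD]) (restrictTotalDegree _ K F.totalDegree)
    (fun v hv => by
      rw [mem_restrictTotalDegree] at hv ⊢
      exact lf_deg _ _ _ hv)
    (fun v hv => by
      rw [mem_restrictTotalDegree] at hv ⊢
      exact lf_deg _ _ _ hv)
    (fun c v v' hv hv' h h' hD hD' => key1 c v hv h hD (key2 c v' hv' h' hD'))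
    M (fun v hv t ht => by
      rw [AlgHom.toLinearMap_apply, eval_lf]
      exact hv _ (hmZ t ht)) F (by rw [mem_restrictTotalDegree])
    (fun t ht => hF t ht) t ht
  rw [AlgHom.toLinearMap_apply, eval_lf, hDt] at this
  exact this

end lim

end Stein

namespace Stein
set_option linter.unusedSectionVars false
universe u v

section spl
variable {K : Type*} [Field K] [IsAlgClosed K] {V : Type*} [AddCommGroup V] [Module K V]
  [FiniteDimensional K V]

/-- splitting of a space according to a predicate on eigenvalues -/
lemma split_space (f : Module.End K V) (p : K → Prop) :
    ∃ U W : Submodule K V, IsCompl U W ∧ (∀ v ∈ U, f v ∈ U) ∧ (∀ v ∈ W, f v ∈ W) ∧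
      (∀ v c, f.HasEigenvector c v → (v ∈ U → p c) ∧ (v ∈ W → ¬ p c) ∧ (p c → v ∈ U) ∧
        (¬ p c → v ∈ W)) := by
  classical
  let r := f.charpoly.roots
  let q : (K → Prop) → Polynomial K := fun p =>
    ((r.filter p).map fun a => Polynomial.X - Polynomial.C a).prod
  have hq0 : ∀ p c, (q p).eval c = 0 ↔ c ∈ r ∧ p c := by
    intro p c
    simp only [q]
    rw [← Polynomial.IsRoot.def, ← Polynomial.mem_roots
      (Polynomial.monic_multisetProd_X_sub_C _).ne_zero, Polynomial.roots_multiset_prod_X_sub_C,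
      Multiset.mem_filter]
  have hmul : q p * q (fun c => ¬ p c) = f.charpoly := by
    simp only [q]
    rw [← Multiset.prod_add, ← Multiset.map_add]
    refine Eq.trans (congrArg (fun s => (Multiset.map _ s).prod) (?_ : _ = r)) ?_
    · convert Multiset.filter_add_not p r
    exact ((IsAlgClosed.splits f.charpoly).eq_prod_roots_of_monic f.charpoly_monic).symm
  have hco : IsCoprime (q p) (q (fun c => ¬ p c)) := by
    refine (Polynomial.isCoprime_iff_aeval_ne_zero_of_isAlgClosed (k := K) K _ _).2 ?_
    intro a
    simp only [Polynomial.coe_aeval_eq_eval, ne_eq, hq0]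
    tauto
  have hst : ∀ Q : Polynomial K, ∀ v ∈ LinearMap.ker (Polynomial.aeval f Q),
      f v ∈ LinearMap.ker (Polynomial.aeval f Q) := by
    intro Q v hv
    rw [LinearMap.mem_ker] at hv ⊢
    have : Polynomial.aeval f Q * f = f * Polynomial.aeval f Q := by
      have := congrArg (Polynomial.aeval f) (mul_comm Q Polynomial.X)
      simpa using this
    have h2 := congrArg (fun g : Module.End K V => g v) this
    simp only [Module.End.mul_apply] at h2
    rw [h2, hv, map_zero]
  have hev : ∀ p v c, f.HasEigenvector c v →
      (v ∈ LinearMap.ker (Polynomial.aeval f (q p)) ↔ p c) := by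
    intro p v c h
    rw [LinearMap.mem_ker, Module.End.aeval_apply_of_hasEigenvector h, smul_eq_zero, hq0]
    have h1 : c ∈ r := by
      rw [Polynomial.mem_roots f.charpoly_monic.ne_zero,
        ← Module.End.hasEigenvalue_iff_isRoot_charpoly]
      exact Module.End.hasEigenvalue_of_hasEigenvector h
    have h2 := h.2
    tauto
  refine ⟨_, _, ⟨Polynomial.disjoint_ker_aeval_of_isCoprime f hco, ?_⟩, hst _, hst _, ?_⟩
  · rw [codisjoint_iff, Polynomial.sup_ker_aeval_eq_ker_aeval_mul_of_coprime f hco, hmul,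
      LinearMap.aeval_self_charpoly, LinearMap.ker_zero]
  · intro v c h
    rw [hev _ v c h, hev _ v c h]
    tauto

end spl

section spl2
variable {k : Type u} {K : Type v} [Field k] [Field K] [Algebra k K] [IsAlgClosed K]

lemma split_proj (P : Place k K) {N : ℕ} (A : Matrix (Fin N) (Fin N) K)
    (hres : ∀ c v, v ≠ 0 → A.mulVec v = c • v → ∃ a, P.Res c a)
    (c0 : K) (v0 : Fin N → K) (hv0 : v0 ≠ 0) (hc0 : A.mulVec v0 = c0 • v0) (hr0 : P.Res c0 0)
    (hc00 : c0 ≠ 0)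
    (c1 : K) (a1 : k) (v1 : Fin N → K) (hv1 : v1 ≠ 0) (hc1 : A.mulVec v1 = c1 • v1)
    (hr1 : P.Res c1 a1) (ha1 : a1 ≠ 0)
    (X : Set (Fin N → K)) (hX : ext K X ⊆ X) (hAX : ∀ u ∈ X, A.mulVec u ∈ X) :
    ∃ (U : Submodule K (Fin N → K)) (q : (Fin N → K) →ₗ[K] (Fin N → K)),
      (∀ v, q v ∈ U) ∧ (∀ v ∈ U, q v = v) ∧ (∀ u ∈ X, q u ∈ X) ∧ q ≠ 0 ∧
      (∀ v ∈ U, A.mulVec v ∈ U) ∧ Module.finrank K U < N := by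
  classical
  let f : Module.End K (Fin N → K) := A.mulVecLin
  have hf : ∀ v, f v = A.mulVec v := fun v => rfl
  have hfe : ∀ c v, f.HasEigenvector c v ↔ A.mulVec v = c • v ∧ v ≠ 0 := by
    intro c v
    rw [Module.End.hasEigenvector_iff, Module.End.mem_eigenspace_iff, hf]
  obtain ⟨U, W, hUW, hfU, hfW, hev⟩ := split_space f (fun c => ∃ a, P.Res c a ∧ a ≠ 0)
  have hUe : ∀ c, Module.End.HasEigenvalue (f.restrict hfU) c → ∃ a, P.Res c a ∧ a ≠ 0 := by
    intro c hc
    obtain ⟨v, hv⟩ := hc.exists_hasEigenvector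
    rw [Module.End.hasEigenvector_iff, Module.End.mem_eigenspace_iff] at hv
    refine (hev v c ((hfe _ _).2 ⟨congrArg Subtype.val hv.1, ?_⟩)).1 v.2
    exact fun h => hv.2 (Subtype.ext h)
  have hWe : ∀ c, Module.End.HasEigenvalue (f.restrict hfW) c → ∃ a, P.Res c a ∧ a = 0 := by
    intro c hc
    obtain ⟨v, hv⟩ := hc.exists_hasEigenvector
    rw [Module.End.hasEigenvector_iff, Module.End.mem_eigenspace_iff] at hv
    have h1 : A.mulVec v.1 = c • v.1 := congrArg Subtype.val hv.1
    have h2 : v.1 ≠ 0 := fun h => hv.2 (Subtype.ext h)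
    have h3 := (hev v c ((hfe _ _).2 ⟨h1, h2⟩)).2.1 v.2
    obtain ⟨a, ha⟩ := hres c v.1 h2 h1
    refine ⟨a, ha, ?_⟩
    by_contra h
    exact h3 ⟨a, ha, h⟩
  obtain ⟨e1, m1, mb1, hli1, hm1, hr1', hmb1⟩ := bdd_basis P c0 hc00 hr0 (fun a => a ≠ 0) _ U rfl
    (f.restrict hfU) hUe
  obtain ⟨e2, m2, mb2, hli2, hm2, hr2, hmb2⟩ := bdd_basis P c0 hc00 hr0 (fun a => a = 0) _ W rfl
    (f.restrict hfW) hWe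
  let q : (Fin N → K) →ₗ[K] (Fin N → K) := U.projection W hUW
  have hv1U : v1 ∈ U := (hev v1 c1 ((hfe _ _).2 ⟨hc1, hv1⟩)).2.2.1 ⟨a1, hr1, ha1⟩
  have hqv : ∀ v ∈ U, q v = v := fun v hv => by
    simpa [q] using Submodule.projection_apply_left hUW ⟨v, hv⟩
  have hqW : ∀ v ∈ W, q v = 0 := fun v hv => by
    simpa [q] using Submodule.projection_apply_right hUW ⟨v, hv⟩
  have hqU : ∀ v, q v ∈ U := fun v => by
    simp only [q]
    exact Submodule.projection_apply_mem hUW v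
  refine ⟨U, q, hqU, hqv, ?_, ?_, hfU, ?_⟩
  · -- the main claim
    let e : Fin (Module.finrank K U) ⊕ Fin (Module.finrank K W) → (Fin N → K) :=
      Sum.elim (fun i => (e1 i).1) (fun i => (e2 i).1)
    let m : Matrix (Fin (Module.finrank K U) ⊕ Fin (Module.finrank K W))
      (Fin (Module.finrank K U) ⊕ Fin (Module.finrank K W)) K := Matrix.fromBlocks m1 0 0 m2
    have hspan : ∀ v : Fin N → K, ∃ t : Fin (Module.finrank K U) ⊕ Fin (Module.finrank K W) → K, v = ∑ i, t i • e i := by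
      intro v
      have h1 : ∀ (x : U), ∃ t : Fin (Module.finrank K U) → K, x = ∑ i, t i • e1 i := by
        intro x
        let b := basisOfLinearIndependentOfCardEqFinrank' e1 hli1 (by simp)
        refine ⟨b.repr x, ?_⟩
        conv_lhs => rw [← b.sum_repr x]
        simp [b]
      have h2 : ∀ (x : W), ∃ t : Fin (Module.finrank K W) → K, x = ∑ i, t i • e2 i := by
        intro x
        let b := basisOfLinearIndependentOfCardEqFinrank' e2 hli2 (by simp)
        refine ⟨b.repr x, ?_⟩
        conv_lhs => rw [← b.sum_repr x]
        simp [b]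
      obtain ⟨x, hx, y, hy, hxy⟩ := Submodule.mem_sup.1
        (hUW.sup_eq_top ▸ Submodule.mem_top : v ∈ U ⊔ W)
      obtain ⟨t1, ht1⟩ := h1 ⟨x, hx⟩
      obtain ⟨t2, ht2⟩ := h2 ⟨y, hy⟩
      refine ⟨Sum.elim t1 t2, ?_⟩
      rw [Fintype.sum_sum_type, ← hxy]
      have h3 := congrArg Subtype.val ht1
      have h4 := congrArg Subtype.val ht2
      simp only [Submodule.coe_sum, Submodule.coe_smul] at h3 h4
      simp only [e, Sum.elim_inl, Sum.elim_inr]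
      rw [← h3, ← h4]
    have hfe' : ∀ j, f (e j) = ∑ i, m i j • e i := by
      intro j
      rcases j with j | j
      · have := congrArg Subtype.val (hm1 j)
        simp only [Submodule.coe_sum, Submodule.coe_smul] at this
        simp only [e, m, Fintype.sum_sum_type, Sum.elim_inl, Sum.elim_inr, Matrix.fromBlocks_apply₁₁,
          Matrix.fromBlocks_apply₂₁, Matrix.zero_apply, zero_smul, Finset.sum_const_zero, add_zero]
        rw [← this]; rfl
      · have := congrArg Subtype.val (hm2 j)
        simp only [Submodule.coe_sum, Submodule.coe_smul] at this
        simp only [e, m, Fintype.sum_sum_type, Sum.elim_inl, Sum.elim_inr, Matrix.fromBlocks_apply₂₂,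
          Matrix.fromBlocks_apply₁₂, Matrix.zero_apply, zero_smul, Finset.sum_const_zero, zero_add]
        rw [← this]; rfl
    let E : Matrix (Fin N) (Fin (Module.finrank K U) ⊕ Fin (Module.finrank K W)) K :=
      Matrix.of fun i j => e j i
    have hE : ∀ t : Fin (Module.finrank K U) ⊕ Fin (Module.finrank K W) → K,
        E.mulVec t = ∑ i, t i • e i := by
      intro t
      ext i
      simp [E, Matrix.mulVec, dotProduct, mul_comm]
    have hEm : ∀ t, E.mulVec (m.mulVec t) = A.mulVec (E.mulVec t) := by
      intro t
      rw [hE t, ← hf, map_sum]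
      simp only [map_smul, hfe', hE, Finset.smul_sum, Matrix.mulVec, dotProduct, Finset.sum_smul]
      rw [Finset.sum_comm]
      refine Finset.sum_congr rfl fun i _ => Finset.sum_congr rfl fun j _ => ?_
      rw [smul_smul, mul_comm]
    intro u hu
    obtain ⟨t, ht⟩ := hspan u
    have := limit_proj P m (Sum.elim mb1 mb2) (by
        intro i j
        rcases i with i | i <;> rcases j with j | j
        · simpa [m, Matrix.diagonal_apply] using hr1' i j
        · simpa [m, Matrix.diagonal_apply] using P.res_zero
        · simpa [m, Matrix.diagonal_apply] using P.res_zero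
        · simpa [m, Matrix.diagonal_apply] using hr2 i j) (fun i => hmb1 i) (fun i => hmb2 i)
      (fun i j => rfl) (fun i j => rfl) {t | E.mulVec t ∈ X}
      (fun t ht => hX (mulVec_mem_ext_self E (fun s hs => subset_ext hs) ht))
      (fun t ht => by
        change E.mulVec (m.mulVec t) ∈ X
        rw [hEm]; exact hAX _ ht) t (by
          change E.mulVec t ∈ X
          rw [hE, ← ht]; exact hu)
    change E.mulVec _ ∈ X at this
    rw [hE, Fintype.sum_sum_type] at this
    simp only [Sum.elim_inl, Sum.elim_inr, Pi.zero_apply, zero_smul, Finset.sum_const_zero,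
      add_zero] at this
    rw [ht, map_sum, Fintype.sum_sum_type]
    have h5 : ∀ i, q (e (Sum.inl i)) = e (Sum.inl i) := fun i => hqv _ (e1 i).2
    have h6 : ∀ i, q (e (Sum.inr i)) = 0 := fun i => hqW _ (e2 i).2
    simpa only [map_smul, h5, h6, smul_zero, Finset.sum_const_zero, add_zero] using this
  · intro h
    have := hqv v1 hv1U
    rw [h] at this
    exact hv1 this.symm
  · have h1 : U ≠ ⊤ := by
      intro h
      obtain ⟨a, ha, ha0⟩ := (hev v0 c0 ((hfe _ _).2 ⟨hc0, hv0⟩)).1 (h ▸ Submodule.mem_top)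
      exact ha0 (ha.unique hr0)
    simpa using Submodule.finrank_lt h1

end spl2

end Stein

namespace Stein
set_option linter.unusedSectionVars false
universe u v

section grp
variable {k : Type u} [Field k] {N : ℕ}

lemma aeval_lf (A : Matrix (Fin N) (Fin N) k) (t : Fin N → k) (F : MvPolynomial (Fin N) k) :
    aeval t (lf A F) = aeval (A.mulVec t) F := by
  have := eval_lf A t F
  rwa [← coe_aeval_eq_eval, ← coe_aeval_eq_eval] at this

lemma auto_inv (a : GL (Fin N) k) {Z : Set (Fin N → k)} (hZ : ext k Z ⊆ Z)
    (ha : ∀ u ∈ Z, a.val.mulVec u ∈ Z) : ∀ u ∈ Z, (a⁻¹).val.mulVec u ∈ Z := by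
  let I : ℕ → Ideal (MvPolynomial (Fin N) k) := fun n =>
    { carrier := {F | ∀ z ∈ Z, aeval ((a ^ n).val.mulVec z) F = 0}
      zero_mem' := fun z _ => map_zero _
      add_mem' := fun {p q} hp hq z hz => by rw [map_add, hp z hz, hq z hz, add_zero]
      smul_mem' := fun c p hp z hz => by rw [smul_eq_mul, map_mul, hp z hz, mul_zero] }
  have hI : ∀ n F, F ∈ I n ↔ ∀ z ∈ Z, aeval ((a ^ n).val.mulVec z) F = 0 := fun n F => Iff.rfl
  have hmono : Monotone I := by
    refine monotone_nat_of_le_succ fun n F hF => ?_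
    rw [hI] at hF ⊢
    intro z hz
    have := hF _ (ha z hz)
    rwa [Matrix.mulVec_mulVec, ← Units.val_mul, ← pow_succ] at this
  obtain ⟨n, hn⟩ := monotone_stabilizes_iff_noetherian.2
    (inferInstance : IsNoetherianRing (MvPolynomial (Fin N) k)) ⟨I, hmono⟩
  have hn1 : I n = I (n + 1) := hn (n + 1) (Nat.le_succ n)
  intro u hu
  apply hZ
  intro F hF
  have h1 : lf ((a ^ (n + 1))⁻¹).val F ∈ I (n + 1) := by
    rw [hI]
    intro z hz
    rw [aeval_lf, Matrix.mulVec_mulVec, ← Units.val_mul, inv_mul_cancel,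
      Units.val_one, Matrix.one_mulVec]
    exact hF z hz
  rw [← hn1, hI] at h1
  have h2 := h1 u hu
  rw [aeval_lf, Matrix.mulVec_mulVec, ← Units.val_mul] at h2
  have h3 : (a ^ (n + 1))⁻¹ * a ^ n = a⁻¹ := by
    rw [pow_succ]
    group
  rwa [h3] at h2

/-- the standard representation -/
noncomputable def std (N : ℕ) (k : Type u) [Field k] :
    Matrix (Fin N) (Fin N) (MvPolynomial (Fin N × Fin N) k) := Matrix.mvPolynomialX _ _ _

lemma ev_std {K : Type*} [Field K] [Algebra k K] (A : Matrix (Fin N) (Fin N) K) :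
    ev (std N k) A = A := by
  ext i j
  simp [ev, std, vec]

lemma std_rep (G : Subgroup (GL (Fin N) k)) : IsRep (std N k) G := by
  refine ⟨ev_std _, fun g hg h hh => ?_⟩
  rw [ev_std, ev_std, ev_std]

/-- homogeneous cone under a connected group -/
structure TAG (X : Set (Fin N → k)) (G : Subgroup (GL (Fin N) k)) : Prop where
  cl : ext k X ⊆ X
  cone : ∀ u ∈ X, ∀ c : k, c • u ∈ X
  gcl : Cl (G : Set (GL (Fin N) k))
  irr : Irr (pts (G : Set (GL (Fin N) k)))
  act : ∀ g ∈ G, ∀ u ∈ X, g.val.mulVec u ∈ X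
  hom : ∀ u ∈ X, u ≠ 0 → X ⊆ ext k (orb (std N k) G u)

lemma TAH.group {X : Set (Fin N → k)} {S : Set (GL (Fin N) k)} {y : GL (Fin N) k}
    (H : TAH X S y) : ∃ G, TAG X G := by
  let Q : Subgroup (GL (Fin N) k) :=
    { carrier := {a | ∀ u ∈ X, a.val.mulVec u ∈ X}
      one_mem' := fun u hu => by simpa using hu
      mul_mem' := fun {a b} ha hb u hu => by
        rw [Units.val_mul, ← Matrix.mulVec_mulVec]
        exact ha _ (hb _ hu)
      inv_mem' := fun {a} ha => auto_inv a H.cl ha }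
  have hQ : Cl (Q : Set (GL (Fin N) k)) := by
    intro g hg u hu
    apply H.cl
    have := pmap_mem_ext (colP (std N k) u) (S := pts (Q : Set (GL (Fin N) k))) (S' := X)
      (t := vec g.val) (K := k) ?_ hg
    · convert this using 1
      ext i
      change _ = aeval (vec g.val) _
      rw [aeval_colP_self, ev_std]
    · rintro _ ⟨h, hh, rfl⟩
      apply subset_ext
      convert hh u hu using 1
      ext i
      change aeval (vec h.val) _ = _
      rw [aeval_colP_self, ev_std]
  obtain ⟨G, hGQ, hGcl, hGirr, -, hS, -⟩ := exists_comp Q hQ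
  have hSG := hS S (fun g hg => H.act g hg) H.one H.irr
  refine ⟨G, H.cl, H.cone, hGcl, hGirr, fun g hg => hGQ hg, fun u hu hu0 u' hu' => ?_⟩
  refine ext_mono ?_ (H.hom u hu hu0 u' hu')
  rintro _ ⟨g, hg, c, rfl⟩
  exact subset_ext ⟨c, g, hSG hg, by rw [ev_std]⟩

variable {X : Set (Fin N → k)} {G : Subgroup (GL (Fin N) k)}

lemma TAG.ext_eq (H : TAG X G) {z : Fin N → k} (hz : z ∈ X) (hz0 : z ≠ 0) :
    ext k (orb (std N k) G z) = X := by
  refine Set.Subset.antisymm (fun u hu => H.cl (ext_mono ?_ hu)) (H.hom z hz hz0)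
  rintro _ ⟨c, g, hg, rfl⟩
  rw [ev_std]
  exact subset_ext (H.cone _ (H.act g hg _ hz) c)

lemma TAG.extK_eq (H : TAG X G) {z : Fin N → k} (hz : z ∈ X) (hz0 : z ≠ 0)
    (K : Type v) [Field K] [Algebra k K] :
    ext K (orb (std N k) G z) = ext K X := by
  refine Set.Subset.antisymm (ext_mono ?_) (ext_mono (H.hom z hz hz0))
  rw [← H.ext_eq hz hz0]
  exact fun u hu => subset_ext (subset_ext hu)

variable [IsAlgClosed k]

lemma TAG.lemL (H : TAG X G) {z : Fin N → k} (hz : z ∈ X) (hz0 : z ≠ 0)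
    {K : Type v} [Field K] [Algebra k K] [IsAlgClosed K] (P : Place k K) (u : Fin N → K)
    (ub : Fin N → k) (hu : ∀ i, P.Res (u i) (ub i)) (hub : ub ≠ 0) (huX : u ∈ ext K X) :
    ∃ x ∈ GKs (G : Set (GL (Fin N) k)) K, ∃ g ∈ G, P.ResM x.val g.val ∧
      P.ResM (x⁻¹).val (g⁻¹).val ∧ ∃ c cb,
      P.Res c cb ∧ cb ≠ 0 ∧ u = c • x.val.mulVec (fun i => algebraMap k K (z i)) := by
  have := lemmaL H.gcl H.irr (std_rep G) z hz0 (fun u hu hu0 => by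
    rw [H.ext_eq hz hz0] at hu
    rw [H.ext_eq hu hu0]; exact hz) P u ub hu hub (by rwa [H.extK_eq hz hz0])
  simpa only [ev_std] using this

lemma TAG.transK (H : TAG X G) {z : Fin N → k} (hz : z ∈ X) (hz0 : z ≠ 0)
    {K : Type v} [Field K] [Algebra k K] [IsAlgClosed K] {u : Fin N → K} (hu0 : u ≠ 0)
    (huX : u ∈ ext K X) :
    ∃ x ∈ GKs (G : Set (GL (Fin N) k)) K, ∃ c : K, c ≠ 0 ∧
      u = c • x.val.mulVec (fun i => algebraMap k K (z i)) := by
  obtain ⟨P, -⟩ := exists_place_fin (k := k) (∅ : Set K) Set.finite_empty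
  obtain ⟨s, ub, hs, hr, hub⟩ := P.exists_scale u hu0
  obtain ⟨x, hx, g, hg, -, -, c, cb, hc, hcb, he⟩ := H.lemL hz hz0 P (s • u) ub hr hub
    (smul_mem_ext H.cl H.cone huX s)
  refine ⟨x, hx, s⁻¹ * c, mul_ne_zero (inv_ne_zero hs) (hc.ne_zero hcb), ?_⟩
  rw [mul_smul, ← he, smul_smul, inv_mul_cancel₀ hs, one_smul]

lemma TAG.trans (H : TAG X G) {z : Fin N → k} (hz : z ∈ X) (hz0 : z ≠ 0)
    {u : Fin N → k} (hu0 : u ≠ 0) (huX : u ∈ X) :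
    ∃ x ∈ G, ∃ c : k, c ≠ 0 ∧ u = c • x.val.mulVec z := by
  obtain ⟨x, hx, c, hc, h⟩ := H.transK (K := k) hz hz0 hu0 (subset_ext huX)
  exact ⟨x, (GKs_self H.gcl).1 hx, c, hc, by simpa using h⟩

/-- base change of irreducibility -/
lemma irr_K {S : Set (GL (Fin N) k)} (hS : Irr (pts S)) (K : Type v) [Field K] [Algebra k K] :
    Irr (pts (GKs S K)) := by
  classical
  obtain ⟨⟨_, ⟨g0, hg0, rfl⟩⟩, hmul⟩ := hS
  have hmapv : ∀ g : GL (Fin N) k, vec (Matrix.GeneralLinearGroup.map (algebraMap k K) g).val =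
      fun i => algebraMap k K (vec g.val i) := fun g => rfl
  have hmem : ∀ g ∈ S, Matrix.GeneralLinearGroup.map (algebraMap k K) g ∈ GKs S K := by
    intro g hg
    change vec _ ∈ ext K (pts S)
    rw [hmapv]
    exact algebraMap_mem_ext (subset_ext ⟨g, hg, rfl⟩)
  refine ⟨⟨_, ⟨_, hmem g0 hg0, rfl⟩⟩, fun F₁ F₂ h => ?_⟩
  by_contra hcon
  push Not at hcon
  obtain ⟨⟨_, ⟨x1, hx1, rfl⟩, h1⟩, ⟨_, ⟨x2, hx2, rfl⟩, h2⟩⟩ := hcon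
  have key : ∀ F : MvPolynomial (Fin N × Fin N) K, ∀ x ∈ GKs S K, aeval (vec x.val) F ≠ 0 →
      ∃ g ∈ S, aeval (fun i => algebraMap k K (vec g.val i)) F ≠ 0 := by
    intro F x hx hne
    by_contra hno
    push Not at hno
    refine hne (ext_baseChange F ?_ hx)
    rintro _ ⟨g, hg, rfl⟩
    exact hno g hg
  obtain ⟨g1, hg1, h1⟩ := key F₁ x1 hx1 h1
  obtain ⟨g2, hg2, h2⟩ := key F₂ x2 hx2 h2
  obtain ⟨P, hP⟩ := exists_place_fin (k := k)
    (({aeval (fun i => algebraMap k K (vec g1.val i)) F₁,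
      aeval (fun i => algebraMap k K (vec g2.val i)) F₂} : Set K) ∪
      ((fun d => F₁.coeff d) '' F₁.support ∪ (fun d => F₂.coeff d) '' F₂.support))
    (by
      refine Set.Finite.union (by simp) (Set.Finite.union ?_ ?_) <;>
      exact (Finset.finite_toSet _).image _)
  have hred : ∀ F : MvPolynomial (Fin N × Fin N) K, (∀ d ∈ F.support, ∃ a, P.Res (F.coeff d) a) →
      ∃ Fb : MvPolynomial (Fin N × Fin N) k, ∀ g : GL (Fin N) k,
        P.Res (aeval (fun i => algebraMap k K (vec g.val i)) F) (aeval (vec g.val) Fb) := by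
    intro F hF
    choose! a ha using hF
    refine ⟨∑ d ∈ F.support, monomial d (a d), fun g => ?_⟩
    conv in (aeval _ F) => rw [F.as_sum]
    rw [map_sum, map_sum]
    refine Place.Res.sum fun d hd => ?_
    rw [aeval_monomial, aeval_monomial]
    refine (ha d hd).mul ?_
    rw [Finsupp.prod, Finsupp.prod]
    exact Place.Res.prod fun i _ => (P.res_algebraMap _).pow _
  obtain ⟨f1, hf1⟩ := hred F₁ (fun d hd => by
    obtain ⟨a, ha, -⟩ := hP _ (Or.inr (Or.inl ⟨d, hd, rfl⟩))
    exact ⟨a, ha⟩)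
  obtain ⟨f2, hf2⟩ := hred F₂ (fun d hd => by
    obtain ⟨a, ha, -⟩ := hP _ (Or.inr (Or.inr ⟨d, hd, rfl⟩))
    exact ⟨a, ha⟩)
  have hz : ∀ s ∈ pts S, aeval s (f1 * f2) = 0 := by
    rintro _ ⟨g, hg, rfl⟩
    rw [map_mul]
    have h3 := (hf1 g).mul (hf2 g)
    rw [← map_mul] at h3
    have h4 := h _ ⟨_, hmem g hg, rfl⟩
    change aeval (vec _) _ = 0 at h4
    rw [hmapv] at h4
    rw [h4] at h3
    exact h3.unique P.res_zero
  rcases hmul f1 f2 hz with h0 | h0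
  · obtain ⟨a, ha, ha0⟩ := hP _ (Or.inl (Or.inl rfl))
    exact ha0 h1 ((ha.unique (hf1 g1)).trans (h0 _ ⟨g1, hg1, rfl⟩))
  · obtain ⟨a, ha, ha0⟩ := hP _ (Or.inl (Or.inr rfl))
    exact ha0 h2 ((ha.unique (hf2 g2)).trans (h0 _ ⟨g2, hg2, rfl⟩))

lemma extK_cl (X : Set (Fin N → k)) (K : Type v) [Field K] [Algebra k K] :
    ext K (ext K X) ⊆ ext K X := by
  intro u hu F hF
  have := hu (MvPolynomial.map (algebraMap k K) F) (fun s hs => by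
    rw [aeval_map_algebraMap]
    exact hs F hF)
  rwa [aeval_map_algebraMap] at this

lemma TAG.TAHK (H : TAG X G) (hne : ∃ u ∈ X, u ≠ 0)
    {K : Type v} [Field K] [Algebra k K] [IsAlgClosed K] (y : GL (Fin N) K)
    (hy : ∀ u ∈ ext K X, y.val.mulVec u ∈ ext K X) :
    TAH (ext K X) (GKs (G : Set (GL (Fin N) k)) K) y := by
  obtain ⟨z, hz, hz0⟩ := hne
  have hone : (1 : GL (Fin N) K) ∈ GKs (G : Set (GL (Fin N) k)) K := by
    simpa using GKs_map (K := K) G.one_mem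
  have hzero : (0 : Fin N → K) ∈ ext K X := by
    simpa using smul_mem_ext (K := K) H.cl H.cone (algebraMap_mem_ext (subset_ext hz)) (0 : K)
  refine ⟨extK_cl X K, fun u hu c => smul_mem_ext H.cl H.cone hu c, hone, irr_K H.irr K, ?_, ?_,
    ⟨fun i => algebraMap k K (z i), algebraMap_mem_ext (subset_ext hz), ne_zero_K hz0⟩, hy⟩
  · intro x hx u hu
    by_cases hu0 : u = 0
    · rw [hu0, Matrix.mulVec_zero]; exact hzero
    obtain ⟨x', hx', c, hc, rfl⟩ := H.transK hz hz0 hu0 hu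
    rw [Matrix.mulVec_smul, Matrix.mulVec_mulVec, ← Units.val_mul, ← H.extK_eq hz hz0]
    have := orb_K (std_rep G) (z := z) (GKs_mul H.gcl hx hx') c
    rwa [ev_std] at this
  · intro u hu hu0 u' hu'
    apply subset_ext
    obtain ⟨x, hx, c, hc, rfl⟩ := H.transK hz hz0 hu0 hu
    by_cases hu0' : u' = 0
    · exact ⟨1, hone, 0, by rw [zero_smul, hu0']⟩
    obtain ⟨x', hx', c', hc', rfl⟩ := H.transK hz hz0 hu0' hu'
    refine ⟨x' * x⁻¹, GKs_mul H.gcl hx' (GKs_inv H.gcl hx), c' * c⁻¹, ?_⟩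
    rw [Matrix.mulVec_smul, smul_smul, mul_assoc, inv_mul_cancel₀ hc, mul_one,
      Matrix.mulVec_mulVec, ← Units.val_mul, inv_mul_cancel_right]

end grp

end Stein

namespace Stein
set_option linter.unusedSectionVars false
universe u v

section eig
variable {K : Type*} [Field K] {N : ℕ}

lemma eig_iff (A : Matrix (Fin N) (Fin N) K) (c : K) :
    (∃ v, v ≠ 0 ∧ A.mulVec v = c • v) ↔ c ∈ A.charpoly.roots := by
  rw [Polynomial.mem_roots A.charpoly_monic.ne_zero, Polynomial.IsRoot.def, Matrix.eval_charpoly,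
    ← Matrix.exists_mulVec_eq_zero_iff]
  refine exists_congr fun v => and_congr_right fun _ => ?_
  have h : (Matrix.scalar (Fin N) c).mulVec v = c • v := by
    ext i; simp [Matrix.mulVec_diagonal]
  rw [Matrix.sub_mulVec, sub_eq_zero, h, eq_comm]

lemma exists_eig [IsAlgClosed K] (A : Matrix (Fin N) (Fin N) K) (hN : N ≠ 0) :
    ∃ (c : K) (v : Fin N → K), v ≠ 0 ∧ A.mulVec v = c • v := by
  have h : A.charpoly.degree ≠ 0 := by
    rw [Matrix.charpoly_degree_eq_dim]
    simpa using hN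
  obtain ⟨c, hc⟩ := IsAlgClosed.exists_root A.charpoly h
  exact ⟨c, (eig_iff A c).2 ((Polynomial.mem_roots A.charpoly_monic.ne_zero).2 hc)⟩

variable {k : Type*} [Field k] [Algebra k K]

lemma eig_res {P : Place k K} {A : Matrix (Fin N) (Fin N) K} {a : Matrix (Fin N) (Fin N) k}
    (hA : P.ResM A a) {u : Fin N → K} (hu : u ≠ 0) {c : K} (hc : A.mulVec u = c • u) :
    ∃ cb s ub, P.Res c cb ∧ ub ≠ 0 ∧ (∀ i, P.Res (s * u i) (ub i)) ∧ a.mulVec ub = cb • ub := by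
  obtain ⟨s, ub, hs, hr, hub⟩ := P.exists_scale u hu
  obtain ⟨i, hi⟩ := Function.ne_iff.1 hub
  have hi : ub i ≠ 0 := hi
  have h1 : ∀ j, P.Res (c * (s * u j)) (a.mulVec ub j) := by
    intro j
    have := hA.mulVec (u := s • u) (v := ub) hr j
    rw [Matrix.mulVec_smul, hc] at this
    simp only [Pi.smul_apply, smul_eq_mul] at this
    rwa [mul_left_comm] at this
  have h2 := (h1 i).mul ((hr i).inv hi)
  rw [mul_assoc, mul_inv_cancel₀ ((hr i).ne_zero hi), mul_one] at h2
  refine ⟨_, s, ub, h2, hub, hr, ?_⟩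
  ext j
  exact (h1 j).unique (h2.mul (hr j))

lemma res_mprod {α : Type*} {P : Place k K} (m : Multiset α) (f : α → K) (g : α → k)
    (h : ∀ a ∈ m, P.Res (f a) (g a)) : P.Res (m.map f).prod (m.map g).prod := by
  induction m using Multiset.induction_on with
  | empty => simpa using P.res_one
  | cons a m ih =>
    rw [Multiset.map_cons, Multiset.map_cons, Multiset.prod_cons, Multiset.prod_cons]
    exact (h a (Multiset.mem_cons_self _ _)).mul
      (ih fun b hb => h b (Multiset.mem_cons_of_mem hb))

lemma exists_expo (E : Set k) (hE : E.Finite) :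
    ∃ e : ℕ, e ≠ 0 ∧ ∀ r : k, r ≠ 0 → (∀ j : ℕ, r ^ j ∈ E) → r ^ e = 1 := by
  classical
  refine ⟨∏ r ∈ hE.toFinset, if orderOf r = 0 then 1 else orderOf r, ?_, ?_⟩
  · rw [Finset.prod_ne_zero_iff]
    intro a _
    split_ifs with h
    · exact one_ne_zero
    · exact h
  · intro r hr h
    have h1 : orderOf r ≠ 0 := by
      intro h0
      have hinj : Function.Injective (fun j : ℕ => r ^ j) := by
        intro i j hij
        wlog hlt : i ≤ j generalizing i j
        · exact (this hij.symm (le_of_not_ge hlt)).symm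
        obtain ⟨d, rfl⟩ := Nat.exists_eq_add_of_le hlt
        simp only [pow_add] at hij
        have h2 : r ^ d = 1 := by
          have h3 := pow_ne_zero i hr
          exact (mul_left_cancel₀ h3 (by rw [mul_one]; exact hij)).symm
        rw [orderOf_eq_zero_iff'] at h0
        by_contra hne
        exact h0 d (by omega) h2
      exact Set.infinite_range_of_injective hinj
        (hE.subset (by rintro _ ⟨j, rfl⟩; exact h j))
    rw [← orderOf_dvd_iff_pow_eq_one]
    have h2 := Finset.dvd_prod_of_mem (fun r => if orderOf r = 0 then 1 else orderOf r)
      (hE.mem_toFinset.2 (by simpa using h 1))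
    simpa [h1] using h2

end eig

section nonconst
variable {k : Type u} [Field k] [IsAlgClosed k] {N : ℕ} {X : Set (Fin N → k)}
  {G : Subgroup (GL (Fin N) k)}
  {K : Type v} [Field K] [Algebra k K] [IsAlgClosed K]

lemma place_gen {S : Set (GL (Fin N) k)} {ξ : GL (Fin N) K}
    (hξ : ∀ F : MvPolynomial (Fin N × Fin N) k, aeval (vec ξ.val) F = 0 ↔
        ∀ g ∈ S, aeval (vec g.val) F = 0) {h : GL (Fin N) k} (hh : h ∈ S) :
    ∃ P : Place k K, P.ResM ξ.val h.val := by
  obtain ⟨P, hP⟩ := exists_place_spec (vec ξ.val) (vec h.val) (fun F hF => (hξ F).1 hF h hh)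
  exact ⟨P, fun i j => hP (i, j)⟩

lemma stab_expo {z : Fin N → k} (hz0 : z ≠ 0)
    {w : GL (Fin N) k} {c0 : k} (hw : w.val.mulVec z = c0 • z) {ξ : GL (Fin N) K}
    (hξ : ∀ F : MvPolynomial (Fin N × Fin N) k, aeval (vec ξ.val) F = 0 ↔
        ∀ g ∈ (G : Set (GL (Fin N) k)), aeval (vec g.val) F = 0)
    (hc : ∀ c ∈ (ξ.val * w.val.map (algebraMap k K)).charpoly.roots,
      ∀ c' ∈ (ξ.val * w.val.map (algebraMap k K)).charpoly.roots, ∃ r : k,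
        c = algebraMap k K r * c') :
    ∃ e : ℕ, e ≠ 0 ∧ ∀ h ∈ G, ∀ χ : k, h.val.mulVec z = χ • z → χ ^ (N * e) = h.val.det ^ e := by
  classical
  set A := ξ.val * w.val.map (algebraMap k K) with hA
  have hN : N ≠ 0 := by
    rintro rfl
    exact hz0 (Subsingleton.elim _ _)
  have hwdet : w.val.det ≠ 0 := (w.isUnit.map Matrix.detMonoidHom).ne_zero
  have hc00 : c0 ≠ 0 := by
    rintro rfl
    rw [zero_smul] at hw
    exact hz0 (by
      have := congrArg (w⁻¹).val.mulVec hw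
      rwa [Matrix.mulVec_mulVec, ← Units.val_mul, inv_mul_cancel, Units.val_one, Matrix.one_mulVec,
        Matrix.mulVec_zero] at this)
  obtain ⟨l, v, hv, hl⟩ := exists_eig A hN
  have hlr := (eig_iff A l).1 ⟨v, hv, hl⟩
  have hc' : ∀ c, c ∈ A.charpoly.roots → ∃ r : k, c = algebraMap k K r * l :=
    fun c h => hc c h l hlr
  choose! r hr using hc'
  let m : Multiset k := A.charpoly.roots.map r
  have hroots : A.charpoly.roots = m.map (fun a => algebraMap k K a * l) := by
    simp only [m, Multiset.map_map]
    conv_lhs => rw [← Multiset.map_id A.charpoly.roots]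
    exact Multiset.map_congr rfl fun c h => hr c h
  have hcard : Multiset.card m = N := by
    simp only [m, Multiset.card_map]
    rw [(IsAlgClosed.splits A.charpoly).natDegree_eq_card_roots.symm, Matrix.charpoly_natDegree_eq_dim,
      Fintype.card_fin]
  have hdet : A.det = (m.map fun a => algebraMap k K a * l).prod := by
    rw [Matrix.det_eq_prod_roots_charpoly, hroots]
  have hev : ∀ t, (Matrix.scalar (Fin N) t - A).det =
      (m.map fun a => t - algebraMap k K a * l).prod := by
    intro t
    rw [← Matrix.eval_charpoly,
      (IsAlgClosed.splits A.charpoly).eq_prod_roots_of_monic A.charpoly_monic, hroots,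
      Polynomial.eval_multiset_prod]
    simp [Multiset.map_map]
  let E : Set k := (fun c => c ^ N * w.val.det / (c0 ^ N * m.prod)) '' {c | c ∈ m}
  have hE : E.Finite := (Multiset.finite_toSet m).image _
  have hmem : ∀ h ∈ G, ∀ χ : k, h.val.mulVec z = χ • z → χ ^ N / h.val.det ∈ E := by
    intro h hh χ hχ
    have hhdet : h.val.det ≠ 0 := (h.isUnit.map Matrix.detMonoidHom).ne_zero
    obtain ⟨P, hP⟩ := place_gen hξ hh
    have hPA : P.ResM A (h.val * w.val) := hP.mul (Place.resM_map _)
    obtain ⟨lb, -, -, hlb, -⟩ := eig_res hPA hv hl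
    have h1 : P.Res A.det (m.map fun a => a * lb).prod := by
      rw [hdet]
      exact res_mprod _ _ _ fun a _ => (P.res_algebraMap a).mul hlb
    have h2 := h1.unique hPA.det
    rw [Multiset.prod_map_mul, Multiset.map_id', Multiset.map_const', Multiset.prod_replicate,
      hcard, Matrix.det_mul] at h2
    have h3 : P.Res (Matrix.scalar (Fin N) (algebraMap k K (c0 * χ)) - A).det
        (m.map fun a => c0 * χ - a * lb).prod := by
      rw [hev]
      exact res_mprod _ _ _ fun a _ => (P.res_algebraMap _).sub ((P.res_algebraMap a).mul hlb)
    have h4 : P.ResM (Matrix.scalar (Fin N) (algebraMap k K (c0 * χ)) - A)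
        (Matrix.scalar (Fin N) (c0 * χ) - h.val * w.val) := by
      intro i j
      refine Place.Res.sub ?_ (hPA i j)
      by_cases hij : i = j
      · subst hij
        simpa using P.res_algebraMap (c0 * χ)
      · simpa [Matrix.diagonal_apply_ne _ hij] using P.res_zero
    have h5 : (Matrix.scalar (Fin N) (c0 * χ) - h.val * w.val).det = 0 := by
      rw [← Matrix.exists_mulVec_eq_zero_iff]
      refine ⟨z, hz0, ?_⟩
      rw [Matrix.sub_mulVec, ← Matrix.mulVec_mulVec, hw, Matrix.mulVec_smul, hχ, sub_eq_zero]
      ext i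
      simp [Matrix.mulVec_diagonal, mul_assoc]
    have h6 := h3.unique h4.det
    rw [h5, Multiset.prod_eq_zero_iff, Multiset.mem_map] at h6
    obtain ⟨c, hcm, hc0⟩ := h6
    have h7 : m.prod ≠ 0 := by
      intro h0
      rw [h0, zero_mul] at h2
      exact mul_ne_zero hhdet hwdet h2.symm
    refine ⟨c, hcm, ?_⟩
    have h8 : (c0 * χ) ^ N = (c * lb) ^ N := by rw [sub_eq_zero.1 hc0]
    rw [mul_pow, mul_pow] at h8
    have h9 := pow_ne_zero N hc00
    simp only
    rw [div_eq_div_iff (mul_ne_zero h9 h7) hhdet]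
    linear_combination (-c ^ N) * h2 - m.prod * h8
  obtain ⟨e, he, hee⟩ := exists_expo E hE
  refine ⟨e, he, fun h hh χ hχ => ?_⟩
  have hhdet : h.val.det ≠ 0 := (h.isUnit.map Matrix.detMonoidHom).ne_zero
  have hχ0 : χ ≠ 0 := by
    rintro rfl
    rw [zero_smul] at hχ
    exact hz0 (by
      have := congrArg (h⁻¹).val.mulVec hχ
      rwa [Matrix.mulVec_mulVec, ← Units.val_mul, inv_mul_cancel, Units.val_one, Matrix.one_mulVec,
        Matrix.mulVec_zero] at this)
  have h1 := hee (χ ^ N / h.val.det) (div_ne_zero (pow_ne_zero _ hχ0) hhdet) (fun j => by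
    have hj : (h ^ j).val.mulVec z = χ ^ j • z := by
      induction j with
      | zero => simp
      | succ j ih =>
        rw [pow_succ, Units.val_mul, ← Matrix.mulVec_mulVec, hχ, Matrix.mulVec_smul, ih, smul_smul,
          pow_succ, mul_comm]
    have := hmem (h ^ j) (G.pow_mem hh j) (χ ^ j) hj
    rwa [Units.val_pow_eq_pow_val, Matrix.det_pow, ← pow_mul, mul_comm j N, pow_mul,
      ← div_pow] at this)
  rw [div_pow, div_eq_one_iff_eq (pow_ne_zero _ hhdet), ← pow_mul] at h1
  exact h1

end nonconst

end Stein

namespace Stein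
set_option linter.unusedSectionVars false
universe u v

section nonconst
variable {k : Type u} [Field k] [IsAlgClosed k] {N : ℕ} {X : Set (Fin N → k)}
  {G : Subgroup (GL (Fin N) k)}
  {K : Type v} [Field K] [Algebra k K] [IsAlgClosed K]

lemma TAG.line (H : TAG X G) {z : Fin N → k} (hz : z ∈ X) (hz0 : z ≠ 0) {ξ : GL (Fin N) K}
    (hξ : ∀ F : MvPolynomial (Fin N × Fin N) k, aeval (vec ξ.val) F = 0 ↔
        ∀ g ∈ (G : Set (GL (Fin N) k)), aeval (vec g.val) F = 0)
    {e : ℕ} (he : e ≠ 0)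
    (hexp : ∀ h ∈ G, ∀ χ : k, h.val.mulVec z = χ • z → χ ^ (N * e) = h.val.det ^ e) :
    ∀ u ∈ X, ∃ c : k, u = c • z := by
  have hN : N ≠ 0 := by
    rintro rfl
    exact hz0 (Subsingleton.elim _ _)
  have hNe : N * e ≠ 0 := mul_ne_zero hN he
  set zK : Fin N → K := fun i => algebraMap k K (z i) with hzK
  have hzK0 : zK ≠ 0 := ne_zero_K hz0
  have hξG : ξ ∈ GKs (G : Set (GL (Fin N) k)) K := by
    intro F hF
    exact (hξ F).2 fun g hg => hF _ ⟨g, hg, rfl⟩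
  have hexpK : ∀ x ∈ GKs (stab (std_rep G) z : Set (GL (Fin N) k)) K, ∀ i,
      (x.val.mulVec zK i) ^ (N * e) = zK i ^ (N * e) * x.val.det ^ e := by
    intro x hx i
    have := hx ((colP (std N k) z i) ^ (N * e) - C (z i) ^ (N * e) *
      (Matrix.det (Matrix.mvPolynomialX (Fin N) (Fin N) k)) ^ e) ?_
    · rw [map_sub, map_mul, map_pow, map_pow, map_pow, aeval_C, aeval_colP, aeval_detK, ev_std,
        sub_eq_zero] at this
      exact this
    · rintro _ ⟨h, hh, rfl⟩
      obtain ⟨hhG, χ, hχ⟩ := mem_stab.1 hh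
      rw [ev_std] at hχ
      change aeval (vec h.val) _ = 0
      rw [map_sub, map_mul, map_pow, map_pow, map_pow, aeval_C, aeval_colP_self, aeval_detK, ev_std, hχ,
        Pi.smul_apply, smul_eq_mul, mul_pow, hexp h hhG χ hχ, Algebra.algebraMap_self,
        RingHom.id_apply]
      ring
  have hdetne : ∀ x : GL (Fin N) K, x.val.det ≠ 0 :=
    fun x => (x.isUnit.map Matrix.detMonoidHom).ne_zero
  have hinv : ∀ (x : GL (Fin N) K) (t : Fin N → K), (x⁻¹).val.mulVec (x.val.mulVec t) = t := by
    intro x t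
    rw [Matrix.mulVec_mulVec, ← Units.val_mul, inv_mul_cancel, Units.val_one, Matrix.one_mulVec]
  have hξz0 : ξ.val.mulVec zK ≠ 0 := by
    intro h
    have := hinv ξ zK
    rw [h, Matrix.mulVec_zero] at this
    exact hzK0 this.symm
  have hξX : ξ.val.mulVec zK ∈ ext K X := by
    have := orb_K (std_rep G) (z := z) hξG (1 : K)
    rwa [ev_std, one_smul, H.extK_eq hz hz0] at this
  have hbd : ∀ j, ∃ c, algebraMap k K c = (ξ.val.mulVec zK j) ^ (N * e) * (ξ.val.det ^ e)⁻¹ := by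
    intro j
    refine const_of_bounded _ fun P => ?_
    obtain ⟨s, ub, hs, hr, hub⟩ := P.exists_scale _ hξz0
    obtain ⟨x, hx, g, hg, hxg, -, c, cb, hc, hcb, hu⟩ := H.lemL hz hz0 P (s • ξ.val.mulVec zK) ub hr
      hub (smul_mem_ext H.cl H.cone hξX s)
    have hη : (x⁻¹ * ξ).val.mulVec zK = (s⁻¹ * c) • zK := by
      rw [Units.val_mul, ← Matrix.mulVec_mulVec]
      have h1 : ξ.val.mulVec zK = (s⁻¹ * c) • x.val.mulVec zK := by
        rw [mul_smul, ← hu, smul_smul, inv_mul_cancel₀ hs, one_smul]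
      rw [h1, Matrix.mulVec_smul, hinv]
    have hηH : x⁻¹ * ξ ∈ GKs (stab (std_rep G) z : Set (GL (Fin N) k)) K := by
      refine stab_K H.gcl (std_rep G) hz0 (GKs_mul H.gcl (GKs_inv H.gcl hx) hξG) ?_
      rw [ev_std]
      exact (par_iff hzK0).2 ⟨_, hη⟩
    obtain ⟨i, hi⟩ := Function.ne_iff.1 hzK0
    have hi : zK i ≠ 0 := hi
    have h2 := hexpK _ hηH i
    rw [hη, Pi.smul_apply, smul_eq_mul, mul_pow, mul_comm] at h2
    have h3 := mul_left_cancel₀ (pow_ne_zero _ hi) h2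
    have h4 : (x⁻¹ * ξ).val.det * x.val.det = ξ.val.det := by
      rw [mul_comm, ← Matrix.det_mul, ← Units.val_mul, mul_inv_cancel_left]
    have h5 : c ^ (N * e) * x.val.det ^ e = s ^ (N * e) * ξ.val.det ^ e := by
      rw [← h4, mul_pow, ← h3, mul_pow, ← mul_assoc, ← mul_assoc, ← mul_pow s, mul_inv_cancel₀ hs,
        one_pow, one_mul]
    have hgdet : g.val.det ≠ 0 := (g.isUnit.map Matrix.detMonoidHom).ne_zero
    have h6 : P.Res (c ^ (N * e) * x.val.det ^ e) (cb ^ (N * e) * g.val.det ^ e) :=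
      (hc.pow _).mul (hxg.det.pow _)
    have h7 := ((hr j).pow (N * e)).mul
      (h6.inv (mul_ne_zero (pow_ne_zero _ hcb) (pow_ne_zero _ hgdet)))
    refine ⟨ub j ^ (N * e) * (cb ^ (N * e) * g.val.det ^ e)⁻¹, ?_⟩
    convert h7 using 1
    rw [h5, mul_pow]
    have h8 := pow_ne_zero (N * e) hs
    have h9 := pow_ne_zero e (hdetne ξ)
    field_simp
  obtain ⟨j0, hj0⟩ := Function.ne_iff.1 hξz0
  have hj0 : ξ.val.mulVec zK j0 ≠ 0 := hj0
  have hrat : ∀ j, ∃ r : k, ξ.val.mulVec zK j = algebraMap k K r * ξ.val.mulVec zK j0 := by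
    intro j
    obtain ⟨a, ha⟩ := hbd j
    obtain ⟨b, hb⟩ := hbd j0
    have h9 := pow_ne_zero e (hdetne ξ)
    have hb0 : b ≠ 0 := by
      rintro rfl
      rw [map_zero] at hb
      exact mul_ne_zero (pow_ne_zero _ hj0) (inv_ne_zero h9) hb.symm
    have h1 : (ξ.val.mulVec zK j / ξ.val.mulVec zK j0) ^ (N * e) = algebraMap k K (a / b) := by
      rw [map_div₀, ha, hb, div_pow]
      field_simp
    obtain ⟨r, hr⟩ := mem_range_of_isAlgebraic (k := k)
      (x := ξ.val.mulVec zK j / ξ.val.mulVec zK j0)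
      ((IsAlgebraic.of_pow (n := N * e) (Nat.pos_of_ne_zero hNe)
        (by rw [h1]; exact isAlgebraic_algebraMap _)))
    exact ⟨r, by rw [hr, div_mul_cancel₀ _ hj0]⟩
  choose r hr using hrat
  have hgz : ∀ g ∈ G, ∀ j, g.val.mulVec z j = r j * g.val.mulVec z j0 := by
    intro g hg j
    have h1 := (hξ (colP (std N k) z j - C (r j) * colP (std N k) z j0)).1 (by
      rw [map_sub, map_mul, aeval_C, aeval_colP, aeval_colP, ev_std, sub_eq_zero]
      exact hr j) g hg
    rw [map_sub, map_mul, aeval_C, aeval_colP_self, aeval_colP_self, ev_std, sub_eq_zero] at h1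
    exact h1
  have hz1 : ∀ j, z j = r j * z j0 := by
    intro j
    simpa using hgz 1 G.one_mem j
  have hzj0 : z j0 ≠ 0 := by
    intro h
    apply hz0
    ext j
    rw [hz1 j, h, mul_zero]; rfl
  intro u hu
  by_cases hu0 : u = 0
  · exact ⟨0, by rw [hu0, zero_smul]⟩
  obtain ⟨g, hg, c, hc, rfl⟩ := H.trans hz hz0 hu0 hu
  refine ⟨c * (g.val.mulVec z j0 / z j0), ?_⟩
  rw [mul_smul]
  congr 1
  ext j
  rw [Pi.smul_apply, smul_eq_mul, hgz g hg j]
  conv_rhs => rw [hz1 j]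
  field_simp

end nonconst

/-- the fixed point theorem -/
theorem TA_all (N : ℕ) : ∀ (k : Type u) [Field k] [IsAlgClosed k], TA N k := by
  induction N using Nat.strong_induction_on with
  | _ N ih =>
  intro k _ _ X S y H0
  by_cases hsp : Submodule.span k X = ⊤
  swap
  · exact span_case (fun d hd => ih d hd k) H0 hsp
  obtain ⟨z, hz, hz0⟩ := H0.ne
  obtain ⟨G, H⟩ := H0.group
  have hyX := H0.yX
  -- the element fixing `z`
  have hinvk : ∀ (x : GL (Fin N) k) (t : Fin N → k), (x⁻¹).val.mulVec (x.val.mulVec t) = t := by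
    intro x t
    rw [Matrix.mulVec_mulVec, ← Units.val_mul, inv_mul_cancel, Units.val_one, Matrix.one_mulVec]
  have hyz0 : y.val.mulVec z ≠ 0 := by
    intro h
    have := hinvk y z
    rw [h, Matrix.mulVec_zero] at this
    exact hz0 this.symm
  obtain ⟨h, hh, c0, hc0, hyz⟩ := H.trans hz hz0 hyz0 (hyX z hz)
  let w : GL (Fin N) k := h⁻¹ * y
  have hw : w.val.mulVec z = c0 • z := by
    simp only [w]
    rw [Units.val_mul, ← Matrix.mulVec_mulVec, hyz, Matrix.mulVec_smul, hinvk]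
  have hwX : ∀ u ∈ X, w.val.mulVec u ∈ X := by
    intro u hu
    simp only [w]
    rw [Units.val_mul, ← Matrix.mulVec_mulVec]
    exact H.act _ (G.inv_mem hh) _ (hyX u hu)
  obtain ⟨K, _, _, _, ξ, hξ⟩ := generic_GL H.irr
  classical
  have hξG : ξ ∈ GKs (G : Set (GL (Fin N) k)) K := by
    intro F hF
    exact (hξ F).2 fun g hg => hF _ ⟨g, hg, rfl⟩
  let A : GL (Fin N) K := ξ * Matrix.GeneralLinearGroup.map (algebraMap k K) w
  have hA : A.val = ξ.val * w.val.map (algebraMap k K) := rfl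
  -- a fixed line over `K` is enough
  have hred : (∃ u ∈ ext K X, u ≠ 0 ∧ ∃ c : K, A.val.mulVec u = c • u) →
      ∃ u ∈ X, u ≠ 0 ∧ ∃ c : k, y.val.mulVec u = c • u := by
    rintro ⟨u, hu, hu0, c, hc⟩
    obtain ⟨P, hP⟩ := place_gen hξ hh
    have hPA : P.ResM A.val (h.val * w.val) := hP.mul (Place.resM_map _)
    obtain ⟨cb, s, ub, -, hub0, hr, he⟩ := eig_res hPA hu0 hc
    refine ⟨ub, H.cl (P.mem_ext (smul_mem_ext H.cl H.cone hu s) hr), hub0, cb, ?_⟩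
    rw [← he, ← Units.val_mul]
    simp only [w]
    rw [mul_inv_cancel_left]
  by_cases hc : ∀ c ∈ A.val.charpoly.roots, ∀ c' ∈ A.val.charpoly.roots, ∃ r : k,
        c = algebraMap k K r * c'
  · obtain ⟨e, he, hexp⟩ := stab_expo (G := G) hz0 hw hξ hc
    obtain ⟨c, hc⟩ := H.line hz hz0 hξ he hexp _ (hyX z hz)
    exact ⟨z, hz, hz0, c, hc⟩
  · apply hred
    push Not at hc
    obtain ⟨c1, hc1, c2, hc2, hne⟩ := hc
    have hunit : ∀ (c : K) (v : Fin N → K), v ≠ 0 → A.val.mulVec v = c • v → c ≠ 0 := by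
      rintro c v hv hcv rfl
      apply hv
      have := congrArg (A⁻¹).val.mulVec hcv
      rwa [Matrix.mulVec_mulVec, ← Units.val_mul, inv_mul_cancel, Units.val_one, Matrix.one_mulVec,
        zero_smul, Matrix.mulVec_zero] at this
    have hroot0 : ∀ c ∈ A.val.charpoly.roots, c ≠ 0 := by
      intro c hc
      obtain ⟨v, hv, hcv⟩ := (eig_iff _ _).2 hc
      exact hunit c v hv hcv
    have hPex : ∃ P : Place k K, ∀ a, ¬ P.Res (c1 / c2) a := by
      by_contra hno
      push Not at hno
      obtain ⟨r, hr⟩ := const_of_bounded (c1 / c2) hno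
      exact hne r (by rw [hr, div_mul_cancel₀ _ (hroot0 c2 hc2)])
    obtain ⟨P, hP⟩ := hPex
    obtain ⟨s, lb, hs, hlr, hlb⟩ := P.exists_scale
      (fun c : {c // c ∈ A.val.charpoly.roots.toFinset} => c.1) (by
        intro h0
        exact hroot0 c1 hc1 (congrFun h0 ⟨c1, Multiset.mem_toFinset.2 hc1⟩))
    have hAX : ∀ u ∈ ext K X, A.val.mulVec u ∈ ext K X := by
      intro u hu
      rw [hA, ← Matrix.mulVec_mulVec]
      refine (H.TAHK H0.ne (1 : GL (Fin N) K) ?_).act ξ hξG _ ?_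
      · intro u hu
        rw [Units.val_one, Matrix.one_mulVec]
        exact hu
      · exact mulVec_mem_ext w.val (fun s hs => subset_ext (hwX s hs)) hu
    have HK := H.TAHK H0.ne A hAX
    -- eigenvalues of `s A`
    have heig : ∀ (c : K) (v : Fin N → K), v ≠ 0 → (s • A.val).mulVec v = c • v →
        ∃ l : {c // c ∈ A.val.charpoly.roots.toFinset}, c = s * l.1 := by
      intro c v hv hcv
      have h1 : A.val.mulVec v = (s⁻¹ * c) • v := by
        rw [mul_smul, ← hcv, Matrix.smul_mulVec, smul_smul, inv_mul_cancel₀ hs, one_smul]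
      refine ⟨⟨s⁻¹ * c, Multiset.mem_toFinset.2 ((eig_iff _ _).1 ⟨v, hv, h1⟩)⟩, ?_⟩
      rw [mul_inv_cancel_left₀ hs]
    have heig2 : ∀ l : {c // c ∈ A.val.charpoly.roots.toFinset}, ∃ v : Fin N → K, v ≠ 0 ∧
        (s • A.val).mulVec v = (s * l.1) • v := by
      intro l
      obtain ⟨v, hv, hcv⟩ := (eig_iff _ _).2 (Multiset.mem_toFinset.1 l.2)
      exact ⟨v, hv, by rw [Matrix.smul_mulVec, hcv, smul_smul]⟩
    obtain ⟨l1, hl1⟩ := Function.ne_iff.1 hlb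
    obtain ⟨v1, hv1, hcv1⟩ := heig2 l1
    have hl2 : lb ⟨c2, Multiset.mem_toFinset.2 hc2⟩ = 0 := by
      by_contra hne0
      have h1 := (hlr ⟨c1, Multiset.mem_toFinset.2 hc1⟩).mul
        ((hlr ⟨c2, Multiset.mem_toFinset.2 hc2⟩).inv hne0)
      apply hP _
      convert h1 using 1
      simp only
      rw [mul_inv, mul_mul_mul_comm, mul_inv_cancel₀ hs, one_mul, div_eq_mul_inv]
    obtain ⟨v2, hv2, hcv2⟩ := heig2 ⟨c2, Multiset.mem_toFinset.2 hc2⟩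
    obtain ⟨U, q, hqU, hq, hqX, hq0, hAU, hlt⟩ := split_proj P (s • A.val)
      (fun c v hv hcv => by
        obtain ⟨l, rfl⟩ := heig c v hv hcv
        exact ⟨_, hlr l⟩) _ v2 hv2 hcv2 (hl2 ▸ hlr ⟨c2, Multiset.mem_toFinset.2 hc2⟩)
      (mul_ne_zero hs (hroot0 c2 hc2)) _ _ v1 hv1 hcv1 (hlr l1) hl1 (ext K X) HK.cl
      (fun u hu => by
        rw [Matrix.smul_mulVec]
        exact HK.cone _ (hAX u hu) s)
    refine compress (fun d hd => ih d hd K) HK U q hqU hq hqX ?_ ?_ hlt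
    · by_contra hno
      push Not at hno
      apply hq0
      have h1 : ∀ u ∈ Submodule.span k X, q (fun i => algebraMap k K (u i)) = 0 := by
        intro u hu
        induction hu using Submodule.span_induction with
        | mem u hu => exact hno _ (algebraMap_mem_ext (subset_ext hu))
        | zero =>
          have : (fun i => algebraMap k K ((0 : Fin N → k) i)) = 0 := by ext i; simp
          rw [this, map_zero]
        | add u v _ _ hu hv =>
          have : (fun i => algebraMap k K ((u + v) i)) = (fun i => algebraMap k K (u i)) +
            fun i => algebraMap k K (v i) := by ext i; simp
          rw [this, map_add, hu, hv, add_zero]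
        | smul a u _ hu =>
          have : (fun i => algebraMap k K ((a • u) i)) =
            algebraMap k K a • (fun i => algebraMap k K (u i)) := by ext i; simp
          rw [this, map_smul, hu, smul_zero]
      refine LinearMap.pi_ext' fun i => LinearMap.ext_ring ?_
      have h2 := h1 (Pi.single i 1) (hsp ▸ Submodule.mem_top)
      have h3 : (fun j => algebraMap k K ((Pi.single i 1 : Fin N → k) j)) = Pi.single i 1 := by
        ext j
        by_cases hij : j = i
        · subst hij; simp
        · simp [hij]
      rw [h3] at h2
      simpa using h2
    · intro v hv
      have h1 := U.smul_mem s⁻¹ (hAU v hv)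
      rwa [Matrix.smul_mulVec, smul_smul, inv_mul_cancel₀ hs, one_smul] at h1

end Stein

namespace Stein
set_option linter.unusedSectionVars false
universe u v

section fin
variable {k : Type u} [Field k] {n : ℕ}

theorem chevalley_fin (B : Subgroup (GL (Fin n) k)) (hB : Cl (B : Set (GL (Fin n) k)))
    (w : GL (Fin n) k) (hw : ∀ b ∈ B, w⁻¹ * b * w ∈ B) :
    ∃ (N : ℕ)
      (ψ : Matrix (Fin N) (Fin N) (MvPolynomial (Fin n × Fin n) k))
      (w0 w0' : Matrix (Fin N) (Fin N) k) (v0 : Fin N → k),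
      (∀ G, IsRep ψ G) ∧ v0 ≠ 0 ∧ w0 * w0' = 1 ∧
      (∀ g : GL (Fin n) k, w0 * ev ψ g.val = ev ψ (w * g * w⁻¹).val * w0) ∧
      (∃ c : k, w0.mulVec v0 = c • v0) ∧
      ∀ g : GL (Fin n) k, g ∈ B ↔ ∃ c : k, (ev ψ g.val).mulVec v0 = c • v0 := by
  obtain ⟨M, _, _, ψ, w0, w0', v0, hψ, hv0, hw0, hc, hcv, hst⟩ := chevalley B hB w hw
  let e : Fin (Fintype.card M) ≃ M := (Fintype.equivFin M).symm
  have hev : ∀ A : Matrix (Fin n) (Fin n) k,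
      ev (ψ.submatrix e e) A = (ev ψ A).submatrix e e := fun A => rfl
  have hmv : ∀ (A : Matrix M M k), (A.submatrix e e).mulVec (v0 ∘ e) = (A.mulVec v0) ∘ e := by
    intro A
    rw [Matrix.submatrix_mulVec_equiv, Function.comp_assoc, Equiv.self_comp_symm,
      Function.comp_id]
  have hsm : ∀ (A : Matrix M M k) (c : k), (A.submatrix e e).mulVec (v0 ∘ e) = c • (v0 ∘ e) ↔
      A.mulVec v0 = c • v0 := by
    intro A c
    rw [hmv]
    constructor
    · intro h
      ext i
      have := congrFun h (e.symm i)
      simpa using this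
    · intro h
      rw [h]
      rfl
  refine ⟨Fintype.card M, ψ.submatrix e e, w0.submatrix e e, w0'.submatrix e e, v0 ∘ e, ?_, ?_, ?_,
    ?_, ?_, ?_⟩
  · intro G
    refine ⟨?_, ?_⟩
    · rw [hev, (hψ G).1, Matrix.submatrix_one_equiv]
    · intro g hg h hh
      rw [hev, hev, hev, (hψ G).2 g hg h hh, Matrix.submatrix_mul_equiv]
  · intro h
    apply hv0
    ext i
    have := congrFun h (e.symm i)
    simpa using this
  · rw [Matrix.submatrix_mul_equiv, hw0, Matrix.submatrix_one_equiv]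
  · intro g
    rw [hev, hev, Matrix.submatrix_mul_equiv, Matrix.submatrix_mul_equiv, hc]
  · obtain ⟨c, h⟩ := hcv
    exact ⟨c, (hsm _ _).2 h⟩
  · intro g
    rw [hst]
    simp only [hev, hsm]

theorem main [IsAlgClosed k] (G B : Subgroup (GL (Fin n) k)) (hG : Cl (G : Set (GL (Fin n) k)))
    (hirr : Irr (pts (G : Set (GL (Fin n) k)))) (hB : IsBor B G) (w : GL (Fin n) k)
    (hwG : ∀ g : GL (Fin n) k, g ∈ G ↔ w * g * w⁻¹ ∈ G)
    (hwB : ∀ b : GL (Fin n) k, b ∈ B ↔ w * b * w⁻¹ ∈ B) :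
    ∀ x ∈ G, ∃ g ∈ G, ∃ b ∈ B, x * w = g * (b * w) * g⁻¹ := by
  intro x hx
  obtain ⟨N, ψ, w0, w0', v0, hψ', hv0, hw0, hconj, ⟨c0, hc0⟩, hst⟩ := chevalley_fin B hB.2.1 w (by
    intro b hb
    rw [hwB]
    simpa [mul_assoc] using hb)
  have hψ := hψ' G
  have hmul : ∀ g ∈ G, ∀ h ∈ G, ev ψ (g * h).val = ev ψ g.val * ev ψ h.val := fun g hg h hh => by
    rw [Units.val_mul]; exact hψ.2 g hg h hh
  have hhom := homog hG hirr hψ B hB v0 hv0 (fun b hb => (hst b).1 hb)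
  -- the image group elements
  let ρ : G → GL (Fin N) k := fun g =>
    ⟨ev ψ g.1.val, ev ψ (g.1⁻¹).val, by
      simpa using hψ.inv (G.inv_mem g.2), hψ.inv g.2⟩
  let W : GL (Fin N) k := ⟨w0, w0', hw0, mul_eq_one_comm.1 hw0⟩
  let X : Set (Fin N → k) := ext k (orb ψ G v0)
  have hWX : ∀ u ∈ X, w0.mulVec u ∈ X := by
    intro u hu
    refine mulVec_mem_ext_self w0 ?_ hu
    rintro _ ⟨c, g, hg, rfl⟩
    apply subset_ext
    refine ⟨c * c0, w * g * w⁻¹, (hwG g).1 hg, ?_⟩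
    rw [Matrix.mulVec_smul, Matrix.mulVec_mulVec, hconj, ← Matrix.mulVec_mulVec, hc0,
      Matrix.mulVec_smul, smul_smul]
  have hH : TAH X (Set.range ρ) (ρ ⟨x, hx⟩ * W) := by
    refine ⟨ext_ext, fun u hu c => ext_orb_smul hψ hu c, ⟨1, ?_⟩, ?_, ?_, ?_,
      ⟨v0, subset_ext (mem_orb_self hψ v0), hv0⟩, ?_⟩
    · ext1
      exact hψ.1
    · have h1 := hirr.pmap (fun q : Fin N × Fin N => ψ q.1 q.2)
      convert h1 using 1
      ext t
      constructor
      · rintro ⟨_, ⟨g, rfl⟩, rfl⟩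
        exact ⟨_, ⟨g.1, g.2, rfl⟩, rfl⟩
      · rintro ⟨_, ⟨g, hg, rfl⟩, rfl⟩
        exact ⟨_, ⟨⟨g, hg⟩, rfl⟩, rfl⟩
    · rintro _ ⟨g, rfl⟩ u hu
      have := ext_orb_act hψ hu g.2 1
      rwa [one_smul] at this
    · intro u hu hu0 u' hu'
      obtain ⟨g, hg, c, rfl⟩ := hhom u hu
      obtain ⟨g', hg', c', rfl⟩ := hhom u' hu'
      have hc : c ≠ 0 := by
        rintro rfl
        exact hu0 (zero_smul _ _)
      apply subset_ext
      refine ⟨ρ ⟨g' * g⁻¹, G.mul_mem hg' (G.inv_mem hg)⟩, ⟨_, rfl⟩, c' * c⁻¹, ?_⟩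
      change _ = (c' * c⁻¹) • (ev ψ (g' * g⁻¹).val).mulVec _
      rw [Matrix.mulVec_smul, Matrix.mulVec_mulVec, smul_smul, inv_mul_cancel_right₀ hc,
        ← hmul _ (G.mul_mem hg' (G.inv_mem hg)) _ hg, inv_mul_cancel_right]
    · intro u hu
      have := ext_orb_act hψ (hWX u hu) hx 1
      rw [one_smul] at this
      rw [Units.val_mul, ← Matrix.mulVec_mulVec]
      exact this
  obtain ⟨u, hu, hu0, d, hd⟩ := TA_all N k _ _ _ hH
  obtain ⟨g, hg, c, rfl⟩ := hhom u hu
  have hc : c ≠ 0 := by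
    rintro rfl
    exact hu0 (zero_smul _ _)
  have hgw := (hwG g).1 hg
  have hc00 : c0 ≠ 0 := by
    rintro rfl
    apply hv0
    have := congrArg w0'.mulVec hc0
    rwa [Matrix.mulVec_mulVec, mul_eq_one_comm.1 hw0, Matrix.one_mulVec, zero_smul,
      Matrix.mulVec_zero] at this
  have hd1 : (c * c0) • (ev ψ (x * (w * g * w⁻¹)).val).mulVec v0 =
      (d * c) • (ev ψ g.val).mulVec v0 := by
    rw [← smul_smul d, ← hd, Units.val_mul (ρ ⟨x, hx⟩) W, ← Matrix.mulVec_mulVec]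
    change _ = (ev ψ x.val).mulVec (w0.mulVec _)
    rw [Matrix.mulVec_smul, Matrix.mulVec_smul, Matrix.mulVec_mulVec _ w0, hconj,
      ← Matrix.mulVec_mulVec _ _ w0, hc0, Matrix.mulVec_smul, Matrix.mulVec_smul, smul_smul,
      hmul _ hx _ hgw, Matrix.mulVec_mulVec]
  refine ⟨g, hg, g⁻¹ * (x * (w * g * w⁻¹)), ?_, by group⟩
  rw [hst]
  refine ⟨(c * c0)⁻¹ * (d * c), ?_⟩
  rw [hmul _ (G.inv_mem hg) _ (G.mul_mem hx hgw), ← Matrix.mulVec_mulVec]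
  have h2 : (ev ψ (x * (w * g * w⁻¹)).val).mulVec v0 =
      ((c * c0)⁻¹ * (d * c)) • (ev ψ g.val).mulVec v0 := by
    rw [← smul_smul, ← hd1, smul_smul, inv_mul_cancel₀ (mul_ne_zero hc hc00), one_smul]
  rw [h2, Matrix.mulVec_smul, Matrix.mulVec_mulVec, hψ.inv hg, Matrix.one_mulVec]

end fin

end Stein

theorem statement12 {k : Type*} [Field k] [IsAlgClosed k] {n : ℕ}
    (G : Subgroup (GL (Fin n) k))
    (hGclosed : @IsClosed _ (zariskiGL k n) (G : Set (GL (Fin n) k)))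
    (hGconn : @IsConnected _ (zariskiGL k n) (G : Set (GL (Fin n) k)))
    (B : Subgroup (GL (Fin n) k)) (hBG : B ≤ G)
    (hBclosed : @IsClosed _ (zariskiGL k n) (B : Set (GL (Fin n) k)))
    (hBconn : @IsConnected _ (zariskiGL k n) (B : Set (GL (Fin n) k)))
    (hBsolv : IsSolvable B)
    (hBmax : ∀ B' : Subgroup (GL (Fin n) k), B' ≤ G →
      @IsClosed _ (zariskiGL k n) (B' : Set (GL (Fin n) k)) →
      @IsConnected _ (zariskiGL k n) (B' : Set (GL (Fin n) k)) →
      IsSolvable B' → B ≤ B' → B' = B)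
    (w : GL (Fin n) k)
    (hwG : ∀ g : GL (Fin n) k, g ∈ G ↔ w * g * w⁻¹ ∈ G)
    (hwB : ∀ b : GL (Fin n) k, b ∈ B ↔ w * b * w⁻¹ ∈ B) :
    ∀ x ∈ G, ∃ g ∈ G, ∃ b ∈ B, x * w = g * (b * w) * g⁻¹ := by
  refine Stein.main G B ((Stein.zar_closed_iff _).1 hGclosed)
    (Stein.irr_of_connected G hGclosed hGconn)
    ⟨hBG, (Stein.zar_closed_iff _).1 hBclosed, Stein.irr_of_connected B hBclosed hBconn, hBsolv, ?_⟩
    w hwG hwB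
  intro B' h1 h2 h3 h4 h5
  exact hBmax B' h1 ((Stein.zar_closed_iff _).2 h2) (Stein.connected_of_irr _ h3) h4 h5
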